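/- Let a, q ≥ 1 be fixed integers with gcd(a,q) = 1 and 1 ≤ a ≤ q, and set α = a/q. Then, as T → ∞, ∫_T^{2T} |ζ(1/2+it, α)|⁴ dt = c₂(α)·T(log T)⁴ + O_q(T(log T)³), where c₂(α) = (1/(2π²q))·∏_{p | q}(1 − 1/(p+1)), the product running over the primes p dividing q. -/

import Mathlib

open Complex Filter MeasureTheory Finset HurwitzZeta
open scoped ArithmeticFunction Real Classical

noncomputable section

/-- The finite set of primes `p ≤ X`. -/
def primesUpTo (X : ℝ) : Finset ℕ :=
  (Finset.range (Nat.floor X + 1)).filter (fun p => p.Prime ∧ (p : ℝ) ≤ X)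

/-- The finite set of naturals `n ≤ X`. -/
def natsUpTo (X : ℝ) : Finset ℕ :=
  (Finset.range (Nat.floor X + 1)).filter (fun n => (n : ℝ) ≤ X)

/-- Truncated Euler product `P_X(s,χ)`, defined via the primitive character `χ*` inducing `χ`:
`P_X(s,χ) = ∏_{p ∣ q} (1 - χ*(p) p^{-s}) · exp(∑_{n ≤ X} χ*(n) Λ(n) / (n^s log n))`. -/
def PX {q : ℕ} (X : ℝ) (χ : DirichletCharacter ℂ q) (s : ℂ) : ℂ :=
  (∏ p ∈ q.primeFactors, (1 - χ.primitiveCharacter ((p : ℕ) : ZMod χ.conductor) * (p : ℂ) ^ (-s))) *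
    Complex.exp (∑ n ∈ natsUpTo X,
      χ.primitiveCharacter ((n : ℕ) : ZMod χ.conductor) * (Λ n : ℂ) / ((n : ℂ) ^ s * (Real.log n : ℂ)))

/-- `𝓟_X^ℓ(s) = ∏_χ P_X(s,χ)^{ℓ_χ}`. -/
def PXl {q : ℕ} (X : ℝ) (ℓ : DirichletCharacter ℂ q → ℕ) (s : ℂ) : ℂ :=
  ∏ χ : DirichletCharacter ℂ q, (PX X χ s) ^ (ℓ χ)

/-- A Dirichlet character as an arithmetic function. -/
def chiArith {q : ℕ} (χ : DirichletCharacter ℂ q) : ArithmeticFunction ℂ :=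
  ⟨fun n => if n = 0 then 0 else χ ((n : ℕ) : ZMod q), by simp⟩

/-- `d_ℓ`, the coefficients of the Dirichlet series of `𝓛^ℓ(s) = ∏_χ L(s,χ)^{ℓ_χ}`,
i.e. the Dirichlet convolution product `∏_χ χ^{*ℓ_χ}`. -/
def dcoef {q : ℕ} (ℓ : DirichletCharacter ℂ q → ℕ) : ArithmeticFunction ℂ :=
  ∏ χ : DirichletCharacter ℂ q, (chiArith χ) ^ (ℓ χ)

/-- `P*_X(s,χ) = ∏_{p ≤ X}(1 − χ(p)p^{−s})^{−1} · ∏_{√X < p ≤ X}(1 + χ(p)²/(2p^{2s}))^{−1}`. -/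
def PstarX {q : ℕ} (X : ℝ) (χ : DirichletCharacter ℂ q) (s : ℂ) : ℂ :=
  ((primesUpTo X).prod (fun p : ℕ => (1 - χ ((p : ℕ) : ZMod q) * (p : ℂ) ^ (-s))⁻¹)) *
    ((primesUpTo X).filter (fun p : ℕ => Real.sqrt X < (p : ℝ))).prod
      (fun p : ℕ => (1 + χ ((p : ℕ) : ZMod q) ^ 2 / (2 * (p : ℂ) ^ (2 * s)))⁻¹)

/-- `𝓟*_X^ℓ(s) = ∏_χ P*_X(s,χ)^{ℓ_χ}`. -/
def PstarXl {q : ℕ} (X : ℝ) (ℓ : DirichletCharacter ℂ q → ℕ) (s : ℂ) : ℂ :=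
  ∏ χ : DirichletCharacter ℂ q, (PstarX X χ s) ^ (ℓ χ)

/-- `Q_X(s,χ) = ∏_{p ≤ √X}(1 − χ(p)p^{−s}) · ∏_{√X < p ≤ X}(1 − χ(p)p^{−s} + χ(p)²/(2p^{2s}))`. -/
def QX {q : ℕ} (X : ℝ) (χ : DirichletCharacter ℂ q) (s : ℂ) : ℂ :=
  (((primesUpTo X).filter (fun p : ℕ => (p : ℝ) ≤ Real.sqrt X)).prod
      (fun p : ℕ => 1 - χ ((p : ℕ) : ZMod q) * (p : ℂ) ^ (-s))) *
    ((primesUpTo X).filter (fun p : ℕ => Real.sqrt X < (p : ℝ))).prod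
      (fun p : ℕ => 1 - χ ((p : ℕ) : ZMod q) * (p : ℂ) ^ (-s)
        + χ ((p : ℕ) : ZMod q) ^ 2 / (2 * (p : ℂ) ^ (2 * s)))

/-- `𝓠_X^ℓ(s) = ∏_χ Q_X(s,χ)^{ℓ_χ}`. -/
def QXl {q : ℕ} (X : ℝ) (ℓ : DirichletCharacter ℂ q → ℕ) (s : ℂ) : ℂ :=
  ∏ χ : DirichletCharacter ℂ q, (QX X χ s) ^ (ℓ χ)

/-- `𝓛^ℓ(s) = ∏_χ L(s,χ)^{ℓ_χ}`. -/
def Ll {q : ℕ} [NeZero q] (ℓ : DirichletCharacter ℂ q → ℕ) (s : ℂ) : ℂ :=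
  ∏ χ : DirichletCharacter ℂ q, (DirichletCharacter.LFunction χ s) ^ (ℓ χ)

/-- GRH for the Dirichlet L-functions modulo `q`: every zero `ρ` of `L(s,χ)` with
`0 < Re ρ < 1` satisfies `Re ρ = 1/2`. -/
def GRHmod (q : ℕ) [NeZero q] : Prop :=
  ∀ χ : DirichletCharacter ℂ q, ∀ ρ : ℂ,
    DirichletCharacter.LFunction χ ρ = 0 → 0 < ρ.re → ρ.re < 1 → ρ.re = 1 / 2

end

lemma inv_mul_sqrt_le_telescope {n : ℕ} (hn : 1 ≤ n) :
    1 / (((n + 1 : ℕ) : ℝ) * √((n + 1 : ℕ) : ℝ)) ≤ 2 / √(n : ℝ) - 2 / √((n + 1 : ℕ) : ℝ) := by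
  have hn' : (1 : ℝ) ≤ n := by exact_mod_cast hn
  push_cast
  set a := √(n : ℝ) with ha
  set b := √((n : ℝ) + 1) with hb
  have ha0 : 0 < a := Real.sqrt_pos.2 (by linarith)
  have hb0 : 0 < b := Real.sqrt_pos.2 (by linarith)
  have ha2 : a ^ 2 = n := Real.sq_sqrt (by linarith)
  have hb2 : b ^ 2 = n + 1 := Real.sq_sqrt (by linarith)
  have hab : a ≤ b := Real.sqrt_le_sqrt (by linarith)
  rw [← hb2, div_sub_div _ _ ha0.ne' hb0.ne', div_le_div_iff₀ (by positivity) (by positivity)]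
  have h1 : (b - a) * (b + a) = 1 := by nlinarith
  have h2 : 0 ≤ b - a := by linarith
  have h3 : a ≤ (2 * b - 2 * a) * b ^ 2 := by
    have : 1 ≤ (b - a) * (2 * b) := by nlinarith
    nlinarith
  nlinarith

lemma sum_Ioc_inv_mul_sqrt_le {M N : ℕ} (hM : 1 ≤ M) :
    ∑ n ∈ Ioc M N, 1 / ((n : ℝ) * √(n : ℝ)) ≤ 2 / √(M : ℝ) := by
  rcases le_total N M with h | h
  · rw [Finset.Ioc_eq_empty_of_le h, Finset.sum_empty]; positivity
  have key : ∑ n ∈ Ioc M N, 1 / ((n : ℝ) * √(n : ℝ)) ≤ 2 / √(M : ℝ) - 2 / √(N : ℝ) := by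
    induction N, h using Nat.le_induction with
    | base => simp
    | succ n hn ih =>
      rw [← Finset.insert_Ioc_right_eq_Ioc_add_one (by omega), Finset.sum_insert (by simp)]
      have := inv_mul_sqrt_le_telescope (hM.trans hn)
      linarith
  have : 0 ≤ 2 / √(N : ℝ) := by positivity
  linarith

lemma sum_Icc_inv_mul_sqrt_le (N : ℕ) :
    ∑ n ∈ Icc 1 N, 1 / ((n : ℝ) * √(n : ℝ)) ≤ 3 := by
  rcases Nat.eq_zero_or_pos N with rfl | h
  · simp
  rw [← Finset.Ioc_insert_left h, Finset.sum_insert (by simp)]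
  have := sum_Ioc_inv_mul_sqrt_le (M := 1) (N := N) le_rfl
  norm_num at this ⊢
  linarith

lemma sum_filter_lt_inv_mul_sqrt_le {Z : ℝ} (hZ : 1 ≤ Z) (N : ℕ) :
    ∑ n ∈ Icc 1 N with Z < ((n : ℕ) : ℝ), 1 / ((n : ℝ) * √(n : ℝ)) ≤ 3 / √Z := by
  have hM : 1 ≤ ⌊Z⌋₊ := Nat.le_floor (by simpa using hZ)
  have hM' : (1 : ℝ) ≤ ⌊Z⌋₊ := by exact_mod_cast hM
  have h1 : ∑ n ∈ Icc 1 N with Z < ((n : ℕ) : ℝ), 1 / ((n : ℝ) * √(n : ℝ)) ≤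
      ∑ n ∈ Ioc ⌊Z⌋₊ N, 1 / ((n : ℝ) * √(n : ℝ)) := by
    refine Finset.sum_le_sum_of_subset_of_nonneg (fun n hn => ?_) (fun _ _ _ => by positivity)
    simp only [Finset.mem_filter, Finset.mem_Icc, Finset.mem_Ioc] at hn ⊢
    exact ⟨(Nat.floor_lt (by linarith)).2 hn.2, hn.1.2⟩
  refine (h1.trans (sum_Ioc_inv_mul_sqrt_le hM)).trans ?_
  have h2 := Nat.lt_floor_add_one Z
  rw [div_le_div_iff₀ (Real.sqrt_pos.2 (by linarith)) (Real.sqrt_pos.2 (by linarith))]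
  have h3 : √Z ≤ √(2 * ⌊Z⌋₊) := Real.sqrt_le_sqrt (by linarith)
  rw [Real.sqrt_mul (by norm_num)] at h3
  have h4 : √(2 : ℝ) ≤ 3 / 2 := by
    rw [Real.sqrt_le_left (by norm_num)]; norm_num
  have := Real.sqrt_nonneg (⌊Z⌋₊ : ℝ)
  nlinarith

lemma sum_Icc_inv_le {Z : ℝ} (hZ : 1 ≤ Z) {N : ℕ} (hN : (N : ℝ) ≤ Z) :
    ∑ n ∈ Icc 1 N, 1 / (n : ℝ) ≤ 1 + Real.log Z := by
  rcases Nat.eq_zero_or_pos N with rfl | h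
  · have := Real.log_nonneg hZ
    simp; linarith
  have h1 := harmonic_le_one_add_log N
  rw [harmonic_eq_sum_Icc] at h1
  push_cast at h1
  simp only [one_div]
  refine h1.trans ?_
  gcongr
  

lemma sum_filter_le_inv_le {Z : ℝ} (hZ : 1 ≤ Z) (N : ℕ) :
    ∑ n ∈ Icc 1 N with ((n : ℕ) : ℝ) ≤ Z, 1 / (n : ℝ) ≤ 1 + Real.log Z := by
  refine le_trans ?_ (sum_Icc_inv_le hZ (N := ⌊Z⌋₊) (Nat.floor_le (by linarith)))
  refine Finset.sum_le_sum_of_subset_of_nonneg (fun n hn => ?_) (fun _ _ _ => by positivity)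
  simp only [Finset.mem_filter, Finset.mem_Icc] at hn ⊢
  exact ⟨hn.1.1, Nat.le_floor hn.2⟩

lemma sum_Icc_inv_sqrt_le (N : ℕ) : ∑ n ∈ Icc 1 N, 1 / √(n : ℝ) ≤ 2 * √(N : ℝ) := by
  induction N with
  | zero => simp
  | succ n ih =>
    rw [← Finset.insert_Icc_right_eq_Icc_add_one (by omega), Finset.sum_insert (by simp)]
    push_cast
    set a := √(n : ℝ) with ha
    set b := √((n : ℝ) + 1) with hb
    have ha0 : 0 ≤ a := Real.sqrt_nonneg _
    have hb0 : 0 < b := Real.sqrt_pos.2 (by positivity)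
    have ha2 : a ^ 2 = n := Real.sq_sqrt (by positivity)
    have hb2 : b ^ 2 = n + 1 := Real.sq_sqrt (by positivity)
    have hab : a ≤ b := Real.sqrt_le_sqrt (by linarith)
    have : 1 / b ≤ 2 * b - 2 * a := by
      rw [div_le_iff₀ hb0]; nlinarith
    linarith

lemma sum_filter_le_inv_sqrt_le {Z : ℝ} (hZ : 1 ≤ Z) (N : ℕ) :
    ∑ n ∈ Icc 1 N with ((n : ℕ) : ℝ) ≤ Z, 1 / √(n : ℝ) ≤ 2 * √Z := by
  refine le_trans ?_ ((sum_Icc_inv_sqrt_le ⌊Z⌋₊).trans ?_)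
  · refine Finset.sum_le_sum_of_subset_of_nonneg (fun n hn => ?_) (fun _ _ _ => by positivity)
    simp only [Finset.mem_filter, Finset.mem_Icc] at hn ⊢
    exact ⟨hn.1.1, Nat.le_floor hn.2⟩
  · gcongr
    exact Nat.floor_le (by linarith)

/-- The sum of `n⁻¹ min(1, √(Z/n))`. -/
lemma sum_inv_mul_min_sqrt_le {X Z : ℝ} (hX : 1 ≤ X) (hZ : 0 < Z) (hZX : Z ≤ X) (N : ℕ) :
    ∑ n ∈ Icc 1 N, 1 / (n : ℝ) * min 1 √(Z / n) ≤ (4 + Real.log X) * min 1 √Z := by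
  have hlog := Real.log_nonneg hX
  have hb : ∀ n ∈ Icc 1 N, 1 / (n : ℝ) * √(Z / n) = √Z * (1 / ((n : ℝ) * √(n : ℝ))) := by
    intro n hn
    have : (0 : ℝ) < n := by exact_mod_cast (Finset.mem_Icc.1 hn).1
    rw [Real.sqrt_div hZ.le]; field_simp
  rcases le_or_gt 1 Z with h1 | h1
  · rw [min_eq_left (Real.one_le_sqrt.2 h1), mul_one,
      ← Finset.sum_filter_add_sum_filter_not _ (fun n : ℕ => (n : ℝ) ≤ Z)]
    have e1 : ∑ n ∈ Icc 1 N with ((n : ℕ) : ℝ) ≤ Z, 1 / (n : ℝ) * min 1 √(Z / n) ≤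
        1 + Real.log X := by
      refine le_trans ?_ ((sum_filter_le_inv_le h1 N).trans ?_)
      · refine Finset.sum_le_sum fun n _ => mul_le_of_le_one_right (by positivity) (min_le_left _ _)
      · gcongr
    have e2 : ∑ n ∈ Icc 1 N with ¬ ((n : ℕ) : ℝ) ≤ Z, 1 / (n : ℝ) * min 1 √(Z / n) ≤ 3 := by
      simp only [not_le]
      calc _ ≤ ∑ n ∈ Icc 1 N with Z < ((n : ℕ) : ℝ), √Z * (1 / ((n : ℝ) * √(n : ℝ))) := by
            refine Finset.sum_le_sum fun n hn => ?_
            rw [← hb n (Finset.mem_filter.1 hn).1]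
            gcongr; exact min_le_right _ _
        _ ≤ √Z * (3 / √Z) := by
            rw [← Finset.mul_sum]; gcongr; exact sum_filter_lt_inv_mul_sqrt_le h1 N
        _ = 3 := by field_simp
    linarith
  · have hs : √Z ≤ 1 := Real.sqrt_le_iff.2 ⟨zero_le_one, by linarith⟩
    rw [min_eq_right hs]
    calc _ ≤ ∑ n ∈ Icc 1 N, √Z * (1 / ((n : ℝ) * √(n : ℝ))) := by
            refine Finset.sum_le_sum fun n hn => ?_
            rw [← hb n hn]
            gcongr; exact min_le_right _ _
      _ ≤ √Z * 3 := by
            rw [← Finset.mul_sum]; gcongr; exact sum_Icc_inv_mul_sqrt_le N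
      _ ≤ _ := by nlinarith [Real.sqrt_nonneg Z]

lemma sum_inv_sqrt_mul_min_le {Z : ℝ} (hZ : 0 < Z) (N : ℕ) :
    ∑ n ∈ Icc 1 N, 1 / √(n : ℝ) * min 1 (Z / n) ≤ 5 * (√Z * min 1 √Z) := by
  have hb : ∀ n ∈ Icc 1 N, 1 / √(n : ℝ) * (Z / n) = Z * (1 / ((n : ℝ) * √(n : ℝ))) := by
    intro n hn
    have : (0 : ℝ) < n := by exact_mod_cast (Finset.mem_Icc.1 hn).1
    field_simp
  rcases le_or_gt 1 Z with h1 | h1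
  · rw [min_eq_left (Real.one_le_sqrt.2 h1), mul_one,
      ← Finset.sum_filter_add_sum_filter_not _ (fun n : ℕ => (n : ℝ) ≤ Z)]
    have e1 : ∑ n ∈ Icc 1 N with ((n : ℕ) : ℝ) ≤ Z, 1 / √(n : ℝ) * min 1 (Z / n) ≤ 2 * √Z := by
      refine le_trans ?_ (sum_filter_le_inv_sqrt_le h1 N)
      refine Finset.sum_le_sum fun n _ => mul_le_of_le_one_right (by positivity) (min_le_left _ _)
    have e2 : ∑ n ∈ Icc 1 N with ¬ ((n : ℕ) : ℝ) ≤ Z, 1 / √(n : ℝ) * min 1 (Z / n) ≤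
        3 * √Z := by
      simp only [not_le]
      calc _ ≤ ∑ n ∈ Icc 1 N with Z < ((n : ℕ) : ℝ), Z * (1 / ((n : ℝ) * √(n : ℝ))) := by
            refine Finset.sum_le_sum fun n hn => ?_
            rw [← hb n (Finset.mem_filter.1 hn).1]
            gcongr; exact min_le_right _ _
        _ ≤ Z * (3 / √Z) := by
            rw [← Finset.mul_sum]; gcongr; exact sum_filter_lt_inv_mul_sqrt_le h1 N
        _ = 3 * √Z := by
            have : 0 < √Z := Real.sqrt_pos.2 hZ
            field_simp; rw [Real.sq_sqrt hZ.le]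
    linarith
  · have hs : √Z ≤ 1 := Real.sqrt_le_iff.2 ⟨zero_le_one, by linarith⟩
    rw [min_eq_right hs, Real.mul_self_sqrt hZ.le]
    calc _ ≤ ∑ n ∈ Icc 1 N, Z * (1 / ((n : ℝ) * √(n : ℝ))) := by
            refine Finset.sum_le_sum fun n hn => ?_
            rw [← hb n hn]
            gcongr; exact min_le_right _ _
      _ ≤ Z * 3 := by
            rw [← Finset.mul_sum]; gcongr; exact sum_Icc_inv_mul_sqrt_le N
      _ ≤ _ := by linarith

lemma sum_inv_mul_min_div_le {R : ℝ} (hR : 0 < R) (N : ℕ) :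
    ∑ n ∈ Icc 1 N, 1 / (n : ℝ) * min (n / R) ((R / n) ^ 2) ≤ 4 * min 1 √R := by
  have hb : ∀ n ∈ Icc 1 N, 1 / (n : ℝ) * (R / n) ^ 2 ≤
      R ^ 2 * (1 / ((n : ℝ) * √(n : ℝ))) := by
    intro n hn
    have h1 : (1 : ℝ) ≤ n := by exact_mod_cast (Finset.mem_Icc.1 hn).1
    have h2 : √(n : ℝ) ≤ n := Real.sqrt_le_self_iff.2 (Or.inr h1)
    have h3 : 0 < √(n : ℝ) := Real.sqrt_pos.2 (by linarith)
    rw [div_pow, one_div_mul_eq_div, div_div, mul_one_div]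
    gcongr
    nlinarith
  rcases le_or_gt 1 R with h1 | h1
  · rw [min_eq_left (Real.one_le_sqrt.2 h1), mul_one,
      ← Finset.sum_filter_add_sum_filter_not _ (fun n : ℕ => (n : ℝ) ≤ R)]
    have e1 : ∑ n ∈ Icc 1 N with ((n : ℕ) : ℝ) ≤ R, 1 / (n : ℝ) * min (n / R) ((R / n) ^ 2) ≤
        1 := by
      have hc : (#{n ∈ Icc 1 N | ((n : ℕ) : ℝ) ≤ R} : ℝ) ≤ R := by
        have : #{n ∈ Icc 1 N | ((n : ℕ) : ℝ) ≤ R} ≤ #(Icc 1 ⌊R⌋₊) := by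
          refine Finset.card_le_card fun n hn => ?_
          simp only [Finset.mem_filter, Finset.mem_Icc] at hn ⊢
          exact ⟨hn.1.1, Nat.le_floor hn.2⟩
        rw [Nat.card_Icc, Nat.add_sub_cancel] at this
        exact (Nat.cast_le.2 this).trans (Nat.floor_le hR.le)
      calc _ ≤ ∑ n ∈ Icc 1 N with ((n : ℕ) : ℝ) ≤ R, 1 / R := by
            refine Finset.sum_le_sum fun n hn => ?_
            have hn0 : (0 : ℝ) < n := by
              exact_mod_cast (Finset.mem_Icc.1 (Finset.mem_filter.1 hn).1).1
            calc _ ≤ 1 / (n : ℝ) * (n / R) := by gcongr; exact min_le_left _ _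
              _ = 1 / R := by field_simp
        _ ≤ R * (1 / R) := by
            rw [Finset.sum_const, nsmul_eq_mul]; gcongr
        _ = 1 := by field_simp
    have e2 : ∑ n ∈ Icc 1 N with ¬ ((n : ℕ) : ℝ) ≤ R, 1 / (n : ℝ) * min (n / R) ((R / n) ^ 2) ≤
        3 := by
      simp only [not_le]
      calc _ ≤ ∑ n ∈ Icc 1 N with R < ((n : ℕ) : ℝ), √R * (1 / ((n : ℝ) * √(n : ℝ))) := by
            refine Finset.sum_le_sum fun n hn => ?_
            have hRn := (Finset.mem_filter.1 hn).2
            have hn0 : (0 : ℝ) < n := hR.trans hRn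
            calc _ ≤ 1 / (n : ℝ) * (R / n) ^ 2 := by gcongr; exact min_le_right _ _
              _ ≤ 1 / (n : ℝ) * √(R / n) := by
                  gcongr
                  have h4 : R / n ≤ 1 := by rw [div_le_one hn0]; exact hRn.le
                  have h5 : 0 ≤ R / n := by positivity
                  calc (R / n) ^ 2 ≤ R / n := by nlinarith
                    _ ≤ _ := Real.le_sqrt_self_iff.2 h4
              _ = _ := by rw [Real.sqrt_div hR.le]; field_simp
        _ ≤ √R * (3 / √R) := by
            rw [← Finset.mul_sum]; gcongr; exact sum_filter_lt_inv_mul_sqrt_le h1 N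
        _ = 3 := by
            have : 0 < √R := Real.sqrt_pos.2 hR
            field_simp
    linarith
  · have hs : √R ≤ 1 := Real.sqrt_le_iff.2 ⟨zero_le_one, by linarith⟩
    rw [min_eq_right hs]
    calc _ ≤ ∑ n ∈ Icc 1 N, R ^ 2 * (1 / ((n : ℝ) * √(n : ℝ))) := by
            refine Finset.sum_le_sum fun n hn => le_trans ?_ (hb n hn)
            gcongr; exact min_le_right _ _
      _ ≤ R ^ 2 * 3 := by
            rw [← Finset.mul_sum]; gcongr; exact sum_Icc_inv_mul_sqrt_le N
      _ ≤ _ := by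
            have : R ≤ √R := Real.le_sqrt_self_iff.2 h1.le
            nlinarith

lemma sum_triple_inv_mul_min_sqrt_le {X : ℝ} (hX : 1 ≤ X) (N : ℕ) :
    ∑ a ∈ Icc 1 N, ∑ b ∈ Icc 1 N, ∑ c ∈ Icc 1 N,
      1 / ((a : ℝ) * b * c) * min 1 √(X / (a * b * c)) ≤ (4 + Real.log X) ^ 3 := by
  have hlog := Real.log_nonneg hX
  have key : ∀ m : ℝ, 1 ≤ m → ∑ c ∈ Icc 1 N, 1 / (m * c) * min 1 √(X / (m * c)) ≤
      (4 + Real.log X) * (1 / m * min 1 √(X / m)) := by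
    intro m hm
    have h := sum_inv_mul_min_sqrt_le hX (Z := X / m) (by positivity) (div_le_self (by linarith) hm) N
    calc _ = 1 / m * ∑ c ∈ Icc 1 N, 1 / (c : ℝ) * min 1 √(X / m / c) := by
          rw [Finset.mul_sum]
          refine Finset.sum_congr rfl fun c _ => ?_
          rw [div_div]; ring
      _ ≤ 1 / m * ((4 + Real.log X) * min 1 √(X / m)) := by gcongr
      _ = _ := by ring
  have one_le : ∀ {a : ℕ}, a ∈ Icc 1 N → (1 : ℝ) ≤ a := fun h => by
    exact_mod_cast (Finset.mem_Icc.1 h).1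
  calc _ ≤ ∑ a ∈ Icc 1 N, ∑ b ∈ Icc 1 N,
        (4 + Real.log X) * (1 / ((a : ℝ) * b) * min 1 √(X / (a * b))) :=
        Finset.sum_le_sum fun a ha => Finset.sum_le_sum fun b hb =>
          key _ (one_le_mul_of_one_le_of_one_le (one_le ha) (one_le hb))
    _ ≤ ∑ a ∈ Icc 1 N, (4 + Real.log X) ^ 2 * (1 / (a : ℝ) * min 1 √(X / a)) := by
        refine Finset.sum_le_sum fun a ha => ?_
        rw [← Finset.mul_sum, pow_two, mul_assoc]
        exact mul_le_mul_of_nonneg_left (key _ (one_le ha)) (by linarith)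
    _ ≤ (4 + Real.log X) ^ 3 := by
        rw [← Finset.mul_sum, pow_succ]
        refine mul_le_mul_of_nonneg_left ?_ (by positivity)
        have := key 1 le_rfl
        simp only [one_mul, div_one] at this
        refine this.trans (mul_le_of_le_one_right (by linarith) (min_le_left _ _))

lemma sum_quad_inv_sqrt_mul_min_le {T : ℝ} (hT : 1 ≤ T) (N : ℕ) :
    ∑ a ∈ Icc 1 N, ∑ b ∈ Icc 1 N, ∑ c ∈ Icc 1 N, ∑ d ∈ Icc 1 N,
      1 / √((a : ℝ) * b * c * d) * min 1 (T ^ 2 / (a * b * c * d)) ≤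
      5 * T * (4 + 2 * Real.log T) ^ 3 := by
  have h3 := sum_triple_inv_mul_min_sqrt_le (X := T ^ 2) (by nlinarith) N
  rw [Real.log_pow] at h3
  push_cast at h3
  have one_le : ∀ {a : ℕ}, a ∈ Icc 1 N → (1 : ℝ) ≤ a := fun h => by
    exact_mod_cast (Finset.mem_Icc.1 h).1
  calc _ ≤ ∑ a ∈ Icc 1 N, ∑ b ∈ Icc 1 N, ∑ c ∈ Icc 1 N,
        5 * T * (1 / ((a : ℝ) * b * c) * min 1 √(T ^ 2 / (a * b * c))) := by
        refine Finset.sum_le_sum fun a ha => Finset.sum_le_sum fun b hb =>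
          Finset.sum_le_sum fun c hc => ?_
        have hm : (1 : ℝ) ≤ a * b * c := one_le_mul_of_one_le_of_one_le
          (one_le_mul_of_one_le_of_one_le (one_le ha) (one_le hb)) (one_le hc)
        set m : ℝ := a * b * c
        have hm0 : 0 < √m := Real.sqrt_pos.2 (by linarith)
        calc _ = 1 / √m * ∑ d ∈ Icc 1 N, 1 / √(d : ℝ) * min 1 (T ^ 2 / m / d) := by
              rw [Finset.mul_sum]
              refine Finset.sum_congr rfl fun d _ => ?_
              rw [div_div, Real.sqrt_mul (by linarith)]; ring
          _ ≤ 1 / √m * (5 * (√(T ^ 2 / m) * min 1 √(T ^ 2 / m))) := by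
              gcongr
              exact sum_inv_sqrt_mul_min_le (by positivity) N
          _ = 5 * (√(T ^ 2 / m) / √m) * min 1 √(T ^ 2 / m) := by ring
          _ = 5 * (T / m) * min 1 √(T ^ 2 / m) := by
              congr 2
              rw [Real.sqrt_div (by positivity), Real.sqrt_sq (by linarith), div_div,
                Real.mul_self_sqrt (by linarith)]
          _ = _ := by ring
    _ ≤ _ := by
        simp only [← Finset.mul_sum]
        gcongr

lemma sum_quad_inv_mul_min_le {T : ℝ} (hT : 1 ≤ T) (N : ℕ) :
    ∑ a ∈ Icc 1 N, ∑ b ∈ Icc 1 N, ∑ c ∈ Icc 1 N, ∑ d ∈ Icc 1 N,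
      1 / ((a : ℝ) * b * c * d) * min (a * b * c * d / T) ((T / (a * b * c * d)) ^ 2) ≤
      4 * (4 + Real.log T) ^ 3 := by
  have h3 := sum_triple_inv_mul_min_sqrt_le hT N
  have one_le : ∀ {a : ℕ}, a ∈ Icc 1 N → (1 : ℝ) ≤ a := fun h => by
    exact_mod_cast (Finset.mem_Icc.1 h).1
  calc _ ≤ ∑ a ∈ Icc 1 N, ∑ b ∈ Icc 1 N, ∑ c ∈ Icc 1 N,
        4 * (1 / ((a : ℝ) * b * c) * min 1 √(T / (a * b * c))) := by
        refine Finset.sum_le_sum fun a ha => Finset.sum_le_sum fun b hb =>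
          Finset.sum_le_sum fun c hc => ?_
        have hm : (1 : ℝ) ≤ a * b * c := one_le_mul_of_one_le_of_one_le
          (one_le_mul_of_one_le_of_one_le (one_le ha) (one_le hb)) (one_le hc)
        set m : ℝ := a * b * c
        calc _ = 1 / m * ∑ d ∈ Icc 1 N, 1 / (d : ℝ) * min (d / (T / m)) ((T / m / d) ^ 2) := by
              rw [Finset.mul_sum]
              refine Finset.sum_congr rfl fun d _ => ?_
              rw [div_div, div_div_eq_mul_div, mul_comm (d : ℝ) m]; ring
          _ ≤ 1 / m * (4 * min 1 √(T / m)) := by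
              gcongr
              exact sum_inv_mul_min_div_le (by positivity) N
          _ = _ := by ring
    _ ≤ _ := by
        simp only [← Finset.mul_sum]
        gcongr

/-- The coefficients of the square of the Dirichlet series with coefficients `f`. -/
noncomputable def dirichletSq (f : ℕ → ℂ) (n : ℕ) : ℂ :=
  ∑ p ∈ n.divisorsAntidiagonal, f p.1 * f p.2

lemma norm_dirichletSq_le {f : ℕ → ℂ} (hf : ∀ n, ‖f n‖ ≤ 1) (n : ℕ) :
    ‖dirichletSq f n‖ ≤ #n.divisors := by
  refine (norm_sum_le _ _).trans ?_
  calc _ ≤ ∑ p ∈ n.divisorsAntidiagonal, (1 : ℝ) := by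
        refine Finset.sum_le_sum fun p _ => ?_
        rw [norm_mul]
        exact mul_le_one₀ (hf _) (norm_nonneg _) (hf _)
    _ = _ := by
        rw [← Nat.map_div_right_divisors]; simp

lemma card_divisors_le_sum_box {n N : ℕ} (hn : n ∈ Icc 1 N) :
    (#n.divisors : ℝ) ≤ ∑ a ∈ Icc 1 N, ∑ b ∈ Icc 1 N, if a * b = n then (1 : ℝ) else 0 := by
  obtain ⟨h1, h2⟩ := Finset.mem_Icc.1 hn
  rw [← Finset.sum_product', Finset.sum_boole]
  have : #n.divisors = #n.divisorsAntidiagonal := by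
    rw [← Nat.map_div_right_divisors, Finset.card_map]
  rw [this]
  refine Nat.cast_le.2 (Finset.card_le_card fun p hp => ?_)
  obtain ⟨hp, -⟩ := Nat.mem_divisorsAntidiagonal.1 hp
  have ha : 0 < p.1 := Nat.pos_of_ne_zero (by rintro h; simp [h] at hp; omega)
  have hb : 0 < p.2 := Nat.pos_of_ne_zero (by rintro h; simp [h] at hp; omega)
  simp only [Finset.mem_filter, Finset.mem_product, Finset.mem_Icc]
  refine ⟨⟨⟨ha, ?_⟩, hb, ?_⟩, hp⟩
  · exact (Nat.le_of_dvd (by omega) ⟨_, hp.symm⟩).trans h2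
  · exact (Nat.le_of_dvd (by omega) ⟨p.1, by rw [mul_comm, hp]⟩).trans h2

lemma sum_card_divisors_mul_le {w : ℕ → ℝ} (hw : ∀ n, 0 ≤ w n) (N : ℕ) :
    ∑ n ∈ Icc 1 N, (#n.divisors : ℝ) * w n ≤ ∑ a ∈ Icc 1 N, ∑ b ∈ Icc 1 N, w (a * b) := by
  calc _ ≤ ∑ n ∈ Icc 1 N, ∑ a ∈ Icc 1 N, ∑ b ∈ Icc 1 N, if a * b = n then w n else 0 := by
        refine Finset.sum_le_sum fun n hn => ?_
        refine (mul_le_mul_of_nonneg_right (card_divisors_le_sum_box hn) (hw n)).trans_eq ?_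
        simp only [Finset.sum_mul, ite_mul, one_mul, zero_mul]
    _ = ∑ a ∈ Icc 1 N, ∑ b ∈ Icc 1 N, ∑ n ∈ Icc 1 N, if a * b = n then w n else 0 := by
        rw [Finset.sum_comm]
        exact Finset.sum_congr rfl fun a _ => Finset.sum_comm
    _ ≤ _ := by
        refine Finset.sum_le_sum fun a _ => Finset.sum_le_sum fun b _ => ?_
        rw [Finset.sum_ite_eq]
        split_ifs
        exacts [le_rfl, hw _]

lemma sum_card_divisors_mul_card_divisors_le {T : ℝ} (hT : 1 ≤ T) (N : ℕ) :
    ∑ m ∈ Icc 1 N, ∑ n ∈ Icc 1 N, (#m.divisors : ℝ) * #n.divisors *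
      (1 / √((m : ℝ) * n) * min 1 (T ^ 2 / (m * n))) ≤ 5 * T * (4 + 2 * Real.log T) ^ 3 := by
  refine le_trans ?_ (sum_quad_inv_sqrt_mul_min_le hT N)
  calc _ = ∑ m ∈ Icc 1 N, (#m.divisors : ℝ) * ∑ n ∈ Icc 1 N, (#n.divisors : ℝ) *
      (1 / √((m : ℝ) * n) * min 1 (T ^ 2 / (m * n))) := by
        simp only [Finset.mul_sum, mul_assoc]
    _ ≤ ∑ a ∈ Icc 1 N, ∑ b ∈ Icc 1 N, ∑ n ∈ Icc 1 N, (#n.divisors : ℝ) *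
      (1 / √(((a * b : ℕ) : ℝ) * n) * min 1 (T ^ 2 / ((a * b : ℕ) * n))) :=
        sum_card_divisors_mul_le (w := fun m => ∑ n ∈ Icc 1 N, (#n.divisors : ℝ) *
          (1 / √((m : ℝ) * n) * min 1 (T ^ 2 / (m * n))))
          (fun m => Finset.sum_nonneg fun n _ => by positivity) N
    _ ≤ _ := by
        refine Finset.sum_le_sum fun a _ => Finset.sum_le_sum fun b _ => ?_
        refine (sum_card_divisors_mul_le (w := fun n => 1 / √(((a * b : ℕ) : ℝ) * n) *
          min 1 (T ^ 2 / ((a * b : ℕ) * n))) (fun n => by positivity) N).trans_eq ?_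
        push_cast
        simp only [mul_assoc]

/-- Pairs of factorisations `u v = u' v' = n` correspond to `n = g k x y` with `x`, `y` coprime,
through `u = g x`, `v = k y`, `u' = g y`, `v' = k x`. -/
lemma sum_divisorsAntidiagonal_sum_divisorsAntidiagonal {M : Type*} [AddCommMonoid M]
    {n N : ℕ} (hn : n ∈ Icc 1 N) (H : ℕ → ℕ → ℕ → ℕ → M) :
    ∑ p ∈ n.divisorsAntidiagonal, ∑ r ∈ n.divisorsAntidiagonal, H p.1 p.2 r.1 r.2 =
      ∑ z ∈ Icc 1 N ×ˢ Icc 1 N ×ˢ Icc 1 N ×ˢ Icc 1 N with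
        z.1 * z.2.1 * z.2.2.1 * z.2.2.2 = n ∧ Nat.Coprime z.2.2.1 z.2.2.2,
        H (z.1 * z.2.2.1) (z.2.1 * z.2.2.2) (z.1 * z.2.2.2) (z.2.1 * z.2.2.1) := by
  obtain ⟨h1, h2⟩ := Finset.mem_Icc.1 hn
  rw [← Finset.sum_product']
  symm
  refine Finset.sum_nbij' (fun z => ((z.1 * z.2.2.1, z.2.1 * z.2.2.2),
      (z.1 * z.2.2.2, z.2.1 * z.2.2.1)))
    (fun w => (Nat.gcd w.1.1 w.2.1, w.1.2 / (w.2.1 / Nat.gcd w.1.1 w.2.1),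
      w.1.1 / Nat.gcd w.1.1 w.2.1, w.2.1 / Nat.gcd w.1.1 w.2.1)) ?_ ?_ ?_ ?_ ?_
  · rintro ⟨g, k, x, y⟩ h
    simp only [Finset.mem_filter, Finset.mem_product, Nat.mem_divisorsAntidiagonal] at h ⊢
    refine ⟨⟨?_, by omega⟩, ?_, by omega⟩ <;> rw [← h.2.1] <;> ring
  · rintro ⟨⟨u, v⟩, ⟨u', v'⟩⟩ h
    simp only [Finset.mem_filter, Finset.mem_product, Nat.mem_divisorsAntidiagonal] at h ⊢
    obtain ⟨⟨hu, -⟩, hu', -⟩ := h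
    have hu0 : 0 < u := Nat.pos_of_ne_zero (by rintro rfl; simp at hu; omega)
    have hu0' : 0 < u' := Nat.pos_of_ne_zero (by rintro rfl; simp at hu'; omega)
    obtain ⟨g, x, y, hg, hxy, rfl, rfl⟩ := Nat.exists_coprime' (Nat.gcd_pos_of_pos_left u' hu0)
    have hx : 0 < x := Nat.pos_of_mul_pos_right hu0
    have hy : 0 < y := Nat.pos_of_mul_pos_right hu0'
    have e1 : Nat.gcd (x * g) (y * g) = g := by rw [Nat.gcd_mul_right, hxy, one_mul]
    have hxv : x * v = y * v' := by
      apply Nat.eq_of_mul_eq_mul_left hg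
      calc g * (x * v) = x * g * v := by ring
        _ = y * g * v' := by rw [hu, hu']
        _ = _ := by ring
    obtain ⟨k, rfl⟩ : y ∣ v := hxy.symm.dvd_of_dvd_mul_left ⟨v', hxv⟩
    have hk : 0 < k := Nat.pos_of_ne_zero (by rintro rfl; simp at hu; omega)
    rw [e1, Nat.mul_div_cancel _ hg, Nat.mul_div_cancel _ hg, Nat.mul_div_cancel_left _ hy]
    have hprod : g * k * x * y = n := by rw [← hu]; ring
    have hle : ∀ d, d ∣ n → d ≤ N := fun d hd => (Nat.le_of_dvd (by omega) hd).trans h2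
    simp only [Finset.mem_Icc]
    refine ⟨⟨⟨hg, hle _ ?_⟩, ⟨hk, hle _ ?_⟩, ⟨hx, hle _ ?_⟩, hy, hle _ ?_⟩, hprod, hxy⟩ <;>
      rw [← hprod]
    · exact ⟨k * x * y, by ring⟩
    · exact ⟨g * x * y, by ring⟩
    · exact ⟨g * k * y, by ring⟩
    · exact ⟨g * k * x, by ring⟩
  · rintro ⟨g, k, x, y⟩ h
    simp only [Finset.mem_filter, Finset.mem_product, Finset.mem_Icc] at h
    obtain ⟨⟨⟨hg, -⟩, ⟨hk, -⟩, ⟨hx, -⟩, hy, -⟩, -, hxy⟩ := h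
    have e1 : Nat.gcd (g * x) (g * y) = g := by rw [Nat.gcd_mul_left, hxy, mul_one]
    simp only [e1, Nat.mul_div_cancel_left _ hg, Nat.mul_div_cancel _ hy]
  · rintro ⟨⟨u, v⟩, ⟨u', v'⟩⟩ h
    simp only [Finset.mem_product, Nat.mem_divisorsAntidiagonal] at h
    obtain ⟨⟨hu, -⟩, hu', -⟩ := h
    have hu0 : 0 < u := Nat.pos_of_ne_zero (by rintro rfl; simp at hu; omega)
    have hu0' : 0 < u' := Nat.pos_of_ne_zero (by rintro rfl; simp at hu'; omega)
    obtain ⟨g, x, y, hg, hxy, rfl, rfl⟩ := Nat.exists_coprime' (Nat.gcd_pos_of_pos_left u' hu0)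
    have hy : 0 < y := Nat.pos_of_mul_pos_right hu0'
    have e1 : Nat.gcd (x * g) (y * g) = g := by rw [Nat.gcd_mul_right, hxy, one_mul]
    have hxv : x * v = y * v' := by
      apply Nat.eq_of_mul_eq_mul_left hg
      calc g * (x * v) = x * g * v := by ring
        _ = y * g * v' := by rw [hu, hu']
        _ = _ := by ring
    obtain ⟨k, rfl⟩ : y ∣ v := hxy.symm.dvd_of_dvd_mul_left ⟨v', hxv⟩
    have hv' : v' = k * x := by
      apply Nat.eq_of_mul_eq_mul_left hy
      rw [← hxv]; ring
    simp only [e1, Nat.mul_div_cancel _ hg, Nat.mul_div_cancel_left _ hy, hv']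
    ext <;> simp <;> ring
  · rintro ⟨g, k, x, y⟩ h
    rfl

lemma sum_card_divisors_sq_mul_le {T : ℝ} (hT : 1 ≤ T) (N : ℕ) :
    ∑ n ∈ Icc 1 N, (#n.divisors : ℝ) ^ 2 * (1 / (n : ℝ) * min (n / T) ((T / n) ^ 2)) ≤
      4 * (4 + Real.log T) ^ 3 := by
  refine le_trans ?_ (sum_quad_inv_mul_min_le hT N)
  set w : ℝ → ℝ := fun x => 1 / x * min (x / T) ((T / x) ^ 2) with hw
  have hw0 : ∀ x, 0 ≤ x → 0 ≤ w x := fun x hx => by simp only [hw]; positivity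
  have hd : ∀ n ∈ Icc 1 N, (#n.divisors : ℝ) ^ 2 * w n ≤
      ∑ z ∈ Icc 1 N ×ˢ Icc 1 N ×ˢ Icc 1 N ×ˢ Icc 1 N,
        if z.1 * z.2.1 * z.2.2.1 * z.2.2.2 = n then w n else 0 := by
    intro n hn
    have h := sum_divisorsAntidiagonal_sum_divisorsAntidiagonal hn (fun _ _ _ _ => w n)
    have hc : #n.divisorsAntidiagonal = #n.divisors := by
      rw [← Nat.map_div_right_divisors, Finset.card_map]
    simp only [Finset.sum_const, hc, nsmul_eq_mul] at h
    rw [← Finset.sum_filter, Finset.sum_const, nsmul_eq_mul, pow_two, mul_assoc, h]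
    have := hw0 _ n.cast_nonneg
    gcongr
    exact fun h => h.1
  calc _ ≤ ∑ n ∈ Icc 1 N, ∑ z ∈ Icc 1 N ×ˢ Icc 1 N ×ˢ Icc 1 N ×ˢ Icc 1 N,
        (if z.1 * z.2.1 * z.2.2.1 * z.2.2.2 = n then w n else 0) := Finset.sum_le_sum hd
    _ = ∑ z ∈ Icc 1 N ×ˢ Icc 1 N ×ˢ Icc 1 N ×ˢ Icc 1 N, ∑ n ∈ Icc 1 N,
        (if z.1 * z.2.1 * z.2.2.1 * z.2.2.2 = n then w n else 0) := Finset.sum_comm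
    _ ≤ ∑ z ∈ Icc 1 N ×ˢ Icc 1 N ×ˢ Icc 1 N ×ˢ Icc 1 N,
        w (z.1 * z.2.1 * z.2.2.1 * z.2.2.2 : ℕ) := by
        refine Finset.sum_le_sum fun z _ => ?_
        rw [Finset.sum_ite_eq]
        split_ifs
        exacts [le_rfl, hw0 _ (Nat.cast_nonneg _)]
    _ = _ := by
        rw [Finset.sum_product]
        refine Finset.sum_congr rfl fun a _ => ?_
        rw [Finset.sum_product]
        refine Finset.sum_congr rfl fun b _ => ?_
        rw [Finset.sum_product]
        refine Finset.sum_congr rfl fun c _ => Finset.sum_congr rfl fun d _ => ?_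
        simp only [hw]
        push_cast
        rfl

lemma card_divisors_le_two_mul {n U : ℕ} (hn : 0 < n) (hU : n ≤ U * U) :
    #n.divisors ≤ 2 * #{u ∈ Icc 1 U | u ∣ n} := by
  have h1 : #{u ∈ n.divisors | u * u ≤ n} ≤ #{u ∈ Icc 1 U | u ∣ n} := by
    refine Finset.card_le_card fun u hu => ?_
    simp only [Finset.mem_filter, Nat.mem_divisors, Finset.mem_Icc] at hu ⊢
    exact ⟨⟨Nat.pos_of_dvd_of_pos hu.1.1 hn, by nlinarith [hu.2]⟩, hu.1.1⟩
  have h2 : #{u ∈ n.divisors | ¬ u * u ≤ n} ≤ #{u ∈ n.divisors | u * u ≤ n} := by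
    refine Finset.card_le_card_of_injOn (fun u => n / u) (fun u hu => ?_) (fun u hu v hv huv => ?_)
    · simp only [Finset.coe_filter, Set.mem_ofPred_eq, Nat.mem_divisors] at hu ⊢
      obtain ⟨⟨⟨k, rfl⟩, -⟩, h⟩ := hu
      have hu0 : 0 < u := Nat.pos_of_mul_pos_right hn
      rw [Nat.mul_div_cancel_left _ hu0]
      refine ⟨⟨⟨u, by ring⟩, hn.ne'⟩, ?_⟩
      have : k < u := by
        by_contra hk
        exact h (Nat.mul_le_mul_left u (not_lt.1 hk))
      exact Nat.mul_le_mul_right k this.le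
    · simp only [Finset.coe_filter, Set.mem_ofPred_eq, Nat.mem_divisors] at hu hv
      rw [← Nat.div_div_self hu.1.1 hn.ne', ← Nat.div_div_self hv.1.1 hn.ne']
      simp only at huv
      rw [huv]
  have h3 := Finset.card_filter_add_card_filter_not (s := n.divisors) (fun u => u * u ≤ n)
  omega

lemma card_filter_dvd_dvd_add_le (X u v h : ℕ) (hu : 0 < u) (hv : 0 < v) :
    #{n ∈ Ico X (2 * X) | u ∣ n ∧ v ∣ n + h} ≤
      if Nat.gcd u v ∣ h then X / Nat.lcm u v + 2 else 0 := by
  have hL : 0 < Nat.lcm u v := Nat.lcm_pos hu hv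
  split_ifs with hg
  · calc _ ≤ #(Icc (X / Nat.lcm u v) (2 * X / Nat.lcm u v)) := by
          refine Finset.card_le_card_of_injOn (fun n => n / Nat.lcm u v) (fun n hn => ?_)
            (fun n hn m hm hnm => ?_)
          · simp only [Finset.coe_filter, Set.mem_ofPred_eq, Finset.mem_Ico, Finset.coe_Icc,
              Set.mem_Icc] at hn ⊢
            exact ⟨Nat.div_le_div_right hn.1.1, Nat.div_le_div_right hn.1.2.le⟩
          · simp only [Finset.coe_filter, Set.mem_ofPred_eq, Finset.mem_Ico] at hn hm
            have e1 : n ≡ m [MOD u] := ((Nat.modEq_zero_iff_dvd.2 hn.2.1).trans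
              (Nat.modEq_zero_iff_dvd.2 hm.2.1).symm)
            have e2 : n ≡ m [MOD v] := Nat.ModEq.add_right_cancel' h
              ((Nat.modEq_zero_iff_dvd.2 hn.2.2).trans (Nat.modEq_zero_iff_dvd.2 hm.2.2).symm)
            have e3 : n % Nat.lcm u v = m % Nat.lcm u v := by
              rcases le_total n m with hle | hle
              · exact (Nat.modEq_iff_dvd' hle).2 (Nat.lcm_dvd
                  ((Nat.modEq_iff_dvd' hle).1 e1) ((Nat.modEq_iff_dvd' hle).1 e2))
              · exact ((Nat.modEq_iff_dvd' hle).2 (Nat.lcm_dvd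
                  ((Nat.modEq_iff_dvd' hle).1 e1.symm) ((Nat.modEq_iff_dvd' hle).1 e2.symm))).symm
            rw [← Nat.div_add_mod n (Nat.lcm u v), ← Nat.div_add_mod m (Nat.lcm u v), e3]
            simp only at hnm
            rw [hnm]
    _ ≤ _ := by
          rw [Nat.card_Icc]
          have h1 : 2 * X / Nat.lcm u v < 2 * (X / Nat.lcm u v) + 2 := by
            rw [Nat.div_lt_iff_lt_mul hL]
            have := Nat.lt_div_mul_add (a := X) hL
            nlinarith
          omega
  · refine le_of_eq (Finset.card_eq_zero.2 (Finset.filter_eq_empty_iff.2 fun n _ hn => hg ?_))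
    exact (Nat.dvd_add_right ((Nat.gcd_dvd_left u v).trans hn.1)).1
      ((Nat.gcd_dvd_right u v).trans hn.2)

lemma sum_filter_dvd_inv_le {g M : ℕ} (hg : 0 < g) (hM : 1 ≤ M) :
    ∑ h ∈ Icc 1 M with g ∣ h, 1 / (h : ℝ) ≤ 1 / g * (1 + Real.log M) := by
  have hM' : (1 : ℝ) ≤ M := by exact_mod_cast hM
  calc _ ≤ ∑ h ∈ (Icc 1 M).image (fun k => g * k), 1 / (h : ℝ) := by
        refine Finset.sum_le_sum_of_subset_of_nonneg (fun h hh => ?_) (fun _ _ _ => by positivity)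
        simp only [Finset.mem_filter, Finset.mem_Icc, Finset.mem_image] at hh ⊢
        obtain ⟨⟨h1, h2⟩, k, rfl⟩ := hh
        have hk : 0 < k := Nat.pos_of_mul_pos_left h1
        exact ⟨k, ⟨hk, by nlinarith⟩, rfl⟩
    _ = ∑ k ∈ Icc 1 M, 1 / (g : ℝ) * (1 / (k : ℝ)) := by
        rw [Finset.sum_image (fun a _ b _ h => Nat.eq_of_mul_eq_mul_left hg h)]
        refine Finset.sum_congr rfl fun k _ => ?_
        push_cast
        rw [one_div_mul_one_div]
    _ ≤ _ := by
        rw [← Finset.mul_sum]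
        gcongr
        exact sum_Icc_inv_le hM' le_rfl

lemma sum_Ico_card_divisors_mul_shift_le {X : ℕ} (hX : 1 ≤ X) :
    ∑ n ∈ Ico X (2 * X), ∑ h ∈ Icc 1 n, (#n.divisors : ℝ) * #(n + h).divisors * (1 / (h : ℝ)) ≤
      132 * X * (1 + Real.log (4 * X)) ^ 3 := by
  have hX' : (1 : ℝ) ≤ X := by exact_mod_cast hX
  obtain ⟨U, hU1, hU2, hU3⟩ : ∃ U : ℕ, 4 * X ≤ U * U ∧ U * U ≤ 16 * X ∧ U ≤ 4 * X := by
    have h1 := Nat.sqrt_le X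
    have h2 := Nat.lt_succ_sqrt X
    have h3 : 1 ≤ Nat.sqrt X := Nat.le_sqrt.2 (by omega)
    simp only [Nat.succ_eq_add_one] at h2
    exact ⟨2 * Nat.sqrt X + 2, by nlinarith, by nlinarith, by nlinarith⟩
  have hd : ∀ n, 0 < n → n ≤ 4 * X → (#n.divisors : ℝ) ≤ 2 * ∑ u ∈ Icc 1 U,
      if u ∣ n then (1 : ℝ) else 0 := by
    intro n hn hn'
    rw [Finset.sum_boole]
    exact_mod_cast card_divisors_le_two_mul hn (hn'.trans hU1)
  have hcount : ∀ u ∈ Icc 1 U, ∀ v ∈ Icc 1 U, ∀ h : ℕ,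
      ∑ n ∈ Ico X (2 * X), (if u ∣ n then (1 : ℝ) else 0) * (if v ∣ n + h then (1 : ℝ) else 0) ≤
      33 * X * (Nat.gcd u v * (1 / u * (1 / v))) * if Nat.gcd u v ∣ h then 1 else 0 := by
    intro u hu v hv h
    rw [Finset.mem_Icc] at hu hv
    have h1 := card_filter_dvd_dvd_add_le X u v h hu.1 hv.1
    have e : ∑ n ∈ Ico X (2 * X), (if u ∣ n then (1 : ℝ) else 0) *
        (if v ∣ n + h then (1 : ℝ) else 0) = #{n ∈ Ico X (2 * X) | u ∣ n ∧ v ∣ n + h} := by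
      rw [← Finset.sum_boole]
      refine Finset.sum_congr rfl fun n _ => ?_
      by_cases h1 : u ∣ n <;> by_cases h2 : v ∣ n + h <;> simp [h1, h2]
    rw [e]
    refine (Nat.cast_le.2 h1).trans ?_
    split_ifs
    · have hL : 0 < Nat.lcm u v := Nat.lcm_pos hu.1 hv.1
      have hgl : (Nat.gcd u v : ℝ) * Nat.lcm u v = u * v := by
        exact_mod_cast Nat.gcd_mul_lcm u v
      have hg0 : (1 : ℝ) ≤ Nat.gcd u v := by exact_mod_cast Nat.gcd_pos_of_pos_left v hu.1
      have hu0 : (0 : ℝ) < u := by exact_mod_cast hu.1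
      have hv0 : (0 : ℝ) < v := by exact_mod_cast hv.1
      have hL' : (0 : ℝ) < Nat.lcm u v := by exact_mod_cast hL
      have huv : (Nat.lcm u v : ℝ) ≤ 16 * X := by
        have h3 : (u : ℝ) * v ≤ 16 * X := by
          exact_mod_cast (Nat.mul_le_mul hu.2 hv.2).trans hU2
        nlinarith
      have h4 : (Nat.gcd u v : ℝ) * (1 / u * (1 / v)) = 1 / Nat.lcm u v := by
        field_simp; linarith
      rw [h4, mul_one]
      push_cast
      have h5 : ((X / Nat.lcm u v : ℕ) : ℝ) ≤ X / Nat.lcm u v := Nat.cast_div_le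
      have h6 : 2 ≤ 32 * (X : ℝ) / Nat.lcm u v := by
        rw [le_div_iff₀ hL']; linarith
      calc _ ≤ (X : ℝ) / Nat.lcm u v + 32 * (X : ℝ) / Nat.lcm u v := by linarith
        _ = _ := by ring
    · simp
  calc _ ≤ ∑ n ∈ Ico X (2 * X), ∑ h ∈ Icc 1 (2 * X),
        (#n.divisors : ℝ) * #(n + h).divisors * (1 / (h : ℝ)) * if n + h ≤ 4 * X then 1 else 0 := by
        refine Finset.sum_le_sum fun n hn => ?_
        rw [Finset.mem_Ico] at hn
        calc _ = ∑ h ∈ Icc 1 n, (#n.divisors : ℝ) * #(n + h).divisors * (1 / (h : ℝ)) *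
              if n + h ≤ 4 * X then 1 else 0 := by
              refine Finset.sum_congr rfl fun h hh => ?_
              rw [Finset.mem_Icc] at hh
              rw [if_pos (by omega), mul_one]
          _ ≤ _ := by
              refine Finset.sum_le_sum_of_subset_of_nonneg (fun h hh => ?_)
                (fun _ _ _ => by positivity)
              rw [Finset.mem_Icc] at hh ⊢
              omega
    _ ≤ ∑ n ∈ Ico X (2 * X), ∑ h ∈ Icc 1 (2 * X), ∑ u ∈ Icc 1 U, ∑ v ∈ Icc 1 U,
        4 * (1 / (h : ℝ)) * ((if u ∣ n then (1 : ℝ) else 0) * (if v ∣ n + h then (1 : ℝ) else 0)) := by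
        refine Finset.sum_le_sum fun n hn => Finset.sum_le_sum fun h hh => ?_
        rw [Finset.mem_Ico] at hn
        rw [Finset.mem_Icc] at hh
        simp only [← Finset.mul_sum]
        rw [← Finset.sum_mul]
        split_ifs with hle
        · calc _ ≤ (2 * ∑ u ∈ Icc 1 U, if u ∣ n then (1 : ℝ) else 0) *
                (2 * ∑ u ∈ Icc 1 U, if u ∣ n + h then (1 : ℝ) else 0) * (1 / (h : ℝ)) * 1 := by
                gcongr
                · exact hd n (by omega) (by omega)
                · exact hd (n + h) (by omega) hle
            _ = _ := by ring
        · rw [mul_zero]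
          exact mul_nonneg (by positivity) (mul_nonneg (Finset.sum_nonneg fun _ _ => by positivity)
            (Finset.sum_nonneg fun _ _ => by positivity))
    _ = ∑ u ∈ Icc 1 U, ∑ v ∈ Icc 1 U, ∑ h ∈ Icc 1 (2 * X), 4 * (1 / (h : ℝ)) *
        ∑ n ∈ Ico X (2 * X), (if u ∣ n then (1 : ℝ) else 0) * (if v ∣ n + h then (1 : ℝ) else 0) := by
        simp only [Finset.mul_sum]
        rw [Finset.sum_comm]
        simp only [Finset.sum_comm (s := Ico X (2 * X))]
        rw [Finset.sum_comm]
        simp only [Finset.sum_comm (s := Icc 1 (2 * X))]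
    _ ≤ ∑ u ∈ Icc 1 U, ∑ v ∈ Icc 1 U, ∑ h ∈ Icc 1 (2 * X), 4 * (1 / (h : ℝ)) *
        (33 * X * (Nat.gcd u v * (1 / u * (1 / v))) * if Nat.gcd u v ∣ h then 1 else 0) := by
        refine Finset.sum_le_sum fun u hu => Finset.sum_le_sum fun v hv =>
          Finset.sum_le_sum fun h _ => ?_
        exact mul_le_mul_of_nonneg_left (hcount u hu v hv h) (by positivity)
    _ ≤ ∑ u ∈ Icc 1 U, ∑ v ∈ Icc 1 U,
        132 * X * (1 + Real.log (4 * X)) * ((1 / (u : ℝ)) * (1 / (v : ℝ))) := by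
        refine Finset.sum_le_sum fun u hu => Finset.sum_le_sum fun v hv => ?_
        rw [Finset.mem_Icc] at hu hv
        have hg : 0 < Nat.gcd u v := Nat.gcd_pos_of_pos_left v hu.1
        have hg' : (0 : ℝ) < Nat.gcd u v := by exact_mod_cast hg
        have h1 := sum_filter_dvd_inv_le hg (M := 2 * X) (by omega)
        have h2 : Real.log ((2 * X : ℕ) : ℝ) ≤ Real.log (4 * X) := by
          push_cast
          exact Real.log_le_log (by linarith) (by linarith)
        calc _ = 132 * X * (Nat.gcd u v * (1 / u * (1 / v))) *
              ∑ h ∈ Icc 1 (2 * X) with Nat.gcd u v ∣ h, 1 / (h : ℝ) := by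
              rw [Finset.sum_filter, Finset.mul_sum]
              refine Finset.sum_congr rfl fun h _ => ?_
              split_ifs <;> ring
          _ ≤ 132 * X * (Nat.gcd u v * (1 / u * (1 / v))) *
              (1 / Nat.gcd u v * (1 + Real.log (4 * X))) := by
              gcongr
              exact h1.trans (by gcongr)
          _ = _ := by field_simp
    _ = 132 * X * (1 + Real.log (4 * X)) * (∑ u ∈ Icc 1 U, 1 / (u : ℝ)) ^ 2 := by
        simp only [← Finset.mul_sum]
        rw [← Finset.sum_mul, pow_two]
    _ ≤ 132 * X * (1 + Real.log (4 * X)) * (1 + Real.log (4 * X)) ^ 2 := by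
        have hl : 0 ≤ Real.log (4 * X) := Real.log_nonneg (by linarith)
        gcongr
        exact sum_Icc_inv_le (by linarith) (by exact_mod_cast hU3)
    _ = _ := by ring

lemma sum_Ico_two_pow_card_divisors_le (j : ℕ) :
    ∑ n ∈ Ico ((2 : ℕ) ^ j) (2 ^ (j + 1)), ∑ h ∈ Icc 1 n,
      (#n.divisors : ℝ) * #(n + h).divisors * (1 / (h : ℝ)) ≤
      3564 * (2 ^ j * ((j : ℝ) + 1) ^ 3) := by
  have h := sum_Ico_card_divisors_mul_shift_le (X := 2 ^ j) Nat.one_le_two_pow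
  rw [pow_succ' 2 j]
  refine h.trans ?_
  push_cast
  have e : (4 : ℝ) * 2 ^ j = 2 ^ (j + 2) := by ring
  rw [e, Real.log_pow]
  have h2 : Real.log 2 ≤ 1 := by linarith [Real.log_two_lt_d9]
  have h3 : 0 ≤ Real.log 2 := by linarith [Real.log_two_gt_d9]
  have h4 : 1 + ((j + 2 : ℕ) : ℝ) * Real.log 2 ≤ 3 * (j + 1) := by
    push_cast
    nlinarith [(Nat.cast_nonneg j : (0 : ℝ) ≤ j)]
  calc _ ≤ 132 * (2 : ℝ) ^ j * (3 * (j + 1)) ^ 3 := by gcongr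
    _ = _ := by ring

lemma sum_range_two_pow_mul_min_le : ∃ C : ℝ, 0 ≤ C ∧ ∀ T : ℝ, 1 ≤ T → ∀ J : ℕ,
    ∑ j ∈ Finset.range J, 2 ^ j * ((j : ℝ) + 1) ^ 3 * min 1 ((T / 2 ^ j) ^ 2) ≤
      C * T * (1 + Real.log T) ^ 3 := by
  have hs : Summable fun i : ℕ => ((i : ℝ) + 1) ^ 3 * (1 / 2 : ℝ) ^ i := by
    have h := (summable_nat_add_iff 1).2
      (summable_pow_mul_geometric_of_norm_lt_one (R := ℝ) 3 (r := 1 / 2) (by norm_num))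
    refine (h.mul_left 2).congr fun i => ?_
    push_cast
    rw [pow_succ]; ring
  set A := ∑' i : ℕ, ((i : ℝ) + 1) ^ 3 * (1 / 2 : ℝ) ^ i with hA
  have hA0 : 0 ≤ A := tsum_nonneg fun i => by positivity
  refine ⟨27 * (2 + A), by positivity, fun T hT J => ?_⟩
  obtain ⟨k, hk1, hk2⟩ : ∃ k : ℕ, T ≤ 2 ^ k ∧ (2 : ℝ) ^ k ≤ 2 * T := by
    obtain ⟨k, h1, h2⟩ := exists_nat_pow_near hT (by norm_num : (1 : ℝ) < 2)
    exact ⟨k + 1, h2.le, by rw [pow_succ]; linarith⟩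
  have hlogT : 0 ≤ Real.log T := Real.log_nonneg hT
  have hk3 : (k : ℝ) + 1 ≤ 3 * (1 + Real.log T) := by
    have h1 : (k : ℝ) * Real.log 2 ≤ Real.log 2 + Real.log T := by
      rw [← Real.log_pow, ← Real.log_mul (by norm_num) (by positivity)]
      exact Real.log_le_log (by positivity) hk2
    nlinarith [Real.log_two_gt_d9, Real.log_two_lt_d9]
  have h1 : ∀ K : ℕ, K ≤ k → ∑ j ∈ Finset.range K, 2 ^ j * ((j : ℝ) + 1) ^ 3 *
      min 1 ((T / 2 ^ j) ^ 2) ≤ 2 * T * ((k : ℝ) + 1) ^ 3 := by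
    intro K hK
    calc _ ≤ ∑ j ∈ Finset.range K, 2 ^ j * ((k : ℝ) + 1) ^ 3 := by
          refine Finset.sum_le_sum fun j hj => ?_
          have hj : (j : ℝ) ≤ k := by exact_mod_cast (Finset.mem_range.1 hj).le.trans hK
          refine (mul_le_of_le_one_right (by positivity) (min_le_left _ _)).trans ?_
          gcongr
      _ ≤ 2 ^ k * ((k : ℝ) + 1) ^ 3 := by
          rw [← Finset.sum_mul]
          gcongr
          rw [geom_sum_eq (by norm_num)]
          have : (2 : ℝ) ^ K ≤ 2 ^ k := pow_le_pow_right₀ (by norm_num) hK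
          norm_num
          linarith
      _ ≤ _ := by gcongr
  have h2 : ∑ j ∈ Finset.range J, 2 ^ j * ((j : ℝ) + 1) ^ 3 * min 1 ((T / 2 ^ j) ^ 2) ≤
      (2 + A) * T * ((k : ℝ) + 1) ^ 3 := by
    rcases le_total J k with hJ | hJ
    · refine (h1 J hJ).trans ?_
      gcongr
      linarith
    · rw [← Finset.sum_range_add_sum_Ico _ hJ, Finset.sum_Ico_eq_sum_range]
      have h3 : ∑ i ∈ Finset.range (J - k), 2 ^ (k + i) * (((k + i : ℕ) : ℝ) + 1) ^ 3 *
          min 1 ((T / 2 ^ (k + i)) ^ 2) ≤ A * (T * ((k : ℝ) + 1) ^ 3) := by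
        calc _ ≤ ∑ i ∈ Finset.range (J - k), ((i : ℝ) + 1) ^ 3 * (1 / 2 : ℝ) ^ i *
              (T * ((k : ℝ) + 1) ^ 3) := by
              refine Finset.sum_le_sum fun i _ => ?_
              have h4 : (((k + i : ℕ) : ℝ) + 1) ≤ ((k : ℝ) + 1) * (i + 1) := by
                push_cast
                nlinarith [(Nat.cast_nonneg k : (0 : ℝ) ≤ k), (Nat.cast_nonneg i : (0 : ℝ) ≤ i)]
              calc _ ≤ 2 ^ (k + i) * (((k : ℝ) + 1) * (i + 1)) ^ 3 * (T / 2 ^ (k + i)) ^ 2 := by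
                    gcongr
                    exact min_le_right _ _
                _ = ((i : ℝ) + 1) ^ 3 * (1 / 2 : ℝ) ^ i * (T * (T / 2 ^ k) * ((k : ℝ) + 1) ^ 3) := by
                    rw [pow_add, one_div, inv_pow]
                    field_simp
                _ ≤ ((i : ℝ) + 1) ^ 3 * (1 / 2 : ℝ) ^ i * (T * 1 * ((k : ℝ) + 1) ^ 3) := by
                    gcongr
                    rw [div_le_one (by positivity)]
                    exact hk1
                _ = _ := by ring
          _ ≤ _ := by
              rw [← Finset.sum_mul]
              gcongr
              exact hs.sum_le_tsum _ (fun i _ => by positivity)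
      have h5 := h1 k le_rfl
      nlinarith
  refine h2.trans ?_
  calc (2 + A) * T * ((k : ℝ) + 1) ^ 3 ≤ (2 + A) * T * (3 * (1 + Real.log T)) ^ 3 := by gcongr
    _ = _ := by ring

lemma sum_card_divisors_shift_le : ∃ C : ℝ, 0 ≤ C ∧ ∀ T : ℝ, 1 ≤ T → ∀ N : ℕ,
    ∑ n ∈ Icc 1 N, ∑ h ∈ Icc 1 n, (#n.divisors : ℝ) * #(n + h).divisors * (1 / (h : ℝ)) *
      min 1 ((T / n) ^ 2) ≤ C * T * (1 + Real.log T) ^ 3 := by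
  obtain ⟨C, hC0, hC⟩ := sum_range_two_pow_mul_min_le
  refine ⟨3564 * C, by positivity, fun T hT N => ?_⟩
  have hblock : ∀ J : ℕ, ∑ n ∈ Ico 1 ((2 : ℕ) ^ J), ∑ h ∈ Icc 1 n,
      (#n.divisors : ℝ) * #(n + h).divisors * (1 / (h : ℝ)) * min 1 ((T / n) ^ 2) ≤
      ∑ j ∈ Finset.range J, 3564 * (2 ^ j * ((j : ℝ) + 1) ^ 3 * min 1 ((T / 2 ^ j) ^ 2)) := by
    intro J
    induction J with
    | zero => simp
    | succ J ih =>
      rw [← Finset.sum_Ico_consecutive _ (Nat.one_le_two_pow (n := J))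
        (Nat.pow_le_pow_right (by norm_num) (Nat.le_succ J)), Finset.sum_range_succ]
      refine add_le_add ih ?_
      calc _ ≤ ∑ n ∈ Ico ((2 : ℕ) ^ J) (2 ^ (J + 1)), ∑ h ∈ Icc 1 n,
            (#n.divisors : ℝ) * #(n + h).divisors * (1 / (h : ℝ)) * min 1 ((T / 2 ^ J) ^ 2) := by
            refine Finset.sum_le_sum fun n hn => Finset.sum_le_sum fun h _ => ?_
            have : (2 : ℝ) ^ J ≤ n := by exact_mod_cast (Finset.mem_Ico.1 hn).1
            gcongr
        _ ≤ 3564 * (2 ^ J * ((J : ℝ) + 1) ^ 3) * min 1 ((T / 2 ^ J) ^ 2) := by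
            simp only [← Finset.sum_mul]
            gcongr
            exact sum_Ico_two_pow_card_divisors_le J
        _ = _ := by ring
  calc _ ≤ ∑ n ∈ Ico 1 ((2 : ℕ) ^ N), ∑ h ∈ Icc 1 n,
      (#n.divisors : ℝ) * #(n + h).divisors * (1 / (h : ℝ)) * min 1 ((T / n) ^ 2) := by
        refine Finset.sum_le_sum_of_subset_of_nonneg (fun n hn => ?_)
          (fun _ _ _ => Finset.sum_nonneg fun _ _ => by positivity)
        rw [Finset.mem_Icc] at hn
        exact Finset.mem_Ico.2 ⟨hn.1, hn.2.trans_lt Nat.lt_two_pow_self⟩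
    _ ≤ _ := hblock N
    _ ≤ 3564 * (C * T * (1 + Real.log T) ^ 3) := by
        rw [← Finset.mul_sum]
        gcongr
        exact hC T hT N
    _ = _ := by ring

lemma pow_succ_sub_pow_succ_bounds {A B : ℝ} (hB : 0 ≤ B) (hBA : B ≤ A) (j : ℕ) :
    (j + 1) * B ^ j * (A - B) ≤ A ^ (j + 1) - B ^ (j + 1) ∧
      A ^ (j + 1) - B ^ (j + 1) ≤ (j + 1) * A ^ j * (A - B) := by
  have hA : 0 ≤ A := hB.trans hBA
  rw [← (Commute.all A B).geom_sum₂_mul]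
  have h0 : 0 ≤ A - B := by linarith
  have e : ∀ c : ℝ, ((j : ℝ) + 1) * c = ∑ i ∈ Finset.range (j + 1), c := fun c => by simp
  constructor
  · refine mul_le_mul_of_nonneg_right ?_ h0
    rw [e]
    refine Finset.sum_le_sum fun i hi => ?_
    have : B ^ j = B ^ i * B ^ (j + 1 - 1 - i) := by
      rw [← pow_add]; congr 1; have := Finset.mem_range.1 hi; omega
    rw [this]
    gcongr
  · refine mul_le_mul_of_nonneg_right ?_ h0
    rw [e]
    refine Finset.sum_le_sum fun i hi => ?_
    have : A ^ j = A ^ i * A ^ (j + 1 - 1 - i) := by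
      rw [← pow_add]; congr 1; have := Finset.mem_range.1 hi; omega
    rw [this]
    gcongr

lemma log_div_sub_log_div_succ {X : ℝ} (hX : 0 < X) {n : ℕ} (hn : 1 ≤ n) :
    1 / ((n : ℝ) + 1) ≤ Real.log (X / n) - Real.log (X / (n + 1)) ∧
      Real.log (X / n) - Real.log (X / (n + 1)) ≤ 1 / (n : ℝ) := by
  have hn' : (0 : ℝ) < n := by exact_mod_cast hn
  have e : Real.log (X / n) - Real.log (X / (n + 1)) = Real.log ((n + 1) / n) := by
    rw [Real.log_div hX.ne' hn'.ne', Real.log_div hX.ne' (by positivity),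
      Real.log_div (by positivity) hn'.ne']; ring
  rw [e]
  constructor
  · have := Real.one_sub_inv_le_log_of_pos (x := ((n : ℝ) + 1) / n) (by positivity)
    refine le_trans (le_of_eq ?_) this
    field_simp; ring
  · have := Real.log_le_sub_one_of_pos (x := ((n : ℝ) + 1) / n) (by positivity)
    refine this.trans (le_of_eq ?_)
    field_simp; ring

lemma sum_inv_mul_log_div_pow_bounds {X : ℝ} (hX : 1 ≤ X) (j : ℕ) :
    Real.log X ^ (j + 1) / (j + 1) ≤ ∑ n ∈ Icc 1 ⌊X⌋₊, 1 / (n : ℝ) * Real.log (X / n) ^ j ∧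
    ∑ n ∈ Icc 1 ⌊X⌋₊, 1 / (n : ℝ) * Real.log (X / n) ^ j ≤
      Real.log X ^ (j + 1) / (j + 1) + Real.log X ^ j := by
  have hX0 : 0 < X := by linarith
  have hj : (0 : ℝ) < j + 1 := by positivity
  have key : ∀ N : ℕ, 1 ≤ N → (N : ℝ) ≤ X →
      Real.log X ^ (j + 1) / (j + 1) - Real.log (X / N) ^ (j + 1) / (j + 1) +
        1 / (N : ℝ) * Real.log (X / N) ^ j ≤
        ∑ n ∈ Icc 1 N, 1 / (n : ℝ) * Real.log (X / n) ^ j ∧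
      ∑ n ∈ Icc 1 N, 1 / (n : ℝ) * Real.log (X / n) ^ j ≤
        Real.log X ^ (j + 1) / (j + 1) - Real.log (X / N) ^ (j + 1) / (j + 1) +
          Real.log X ^ j := by
    intro N hN
    induction N, hN using Nat.le_induction with
    | base => intro _; simp
    | succ n hn ih =>
      intro hnX
      push_cast at hnX
      have hn' : (1 : ℝ) ≤ n := by exact_mod_cast hn
      obtain ⟨h1, h2⟩ := ih (by linarith)
      rw [← Finset.insert_Icc_right_eq_Icc_add_one (by omega), Finset.sum_insert (by simp)]
      push_cast
      have hB : 0 ≤ Real.log (X / (n + 1)) := Real.log_nonneg (by rwa [one_le_div (by positivity)])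
      obtain ⟨d1, d2⟩ := log_div_sub_log_div_succ hX0 hn
      set A := Real.log (X / n)
      set B := Real.log (X / (n + 1))
      have hpos : (0 : ℝ) < 1 / ((n : ℝ) + 1) := by positivity
      obtain ⟨p1, p2⟩ := pow_succ_sub_pow_succ_bounds hB (by linarith : B ≤ A) j
      have q1 : 1 / ((n : ℝ) + 1) * B ^ j ≤ A ^ (j + 1) / (j + 1) - B ^ (j + 1) / (j + 1) := by
        rw [← sub_div, le_div_iff₀ hj]
        have : 1 / ((n : ℝ) + 1) * B ^ j ≤ B ^ j * (A - B) := by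
          rw [mul_comm]; gcongr
        nlinarith
      have q2 : A ^ (j + 1) / (j + 1) - B ^ (j + 1) / (j + 1) ≤ 1 / (n : ℝ) * A ^ j := by
        rw [← sub_div, div_le_iff₀ hj]
        have : A ^ j * (A - B) ≤ 1 / (n : ℝ) * A ^ j := by
          rw [mul_comm]
          have : 0 ≤ A := by linarith
          gcongr
        nlinarith
      constructor <;> linarith
  have hN : 1 ≤ ⌊X⌋₊ := Nat.le_floor (by simpa using hX)
  have hN' : (1 : ℝ) ≤ ⌊X⌋₊ := by exact_mod_cast hN
  have hNX : (⌊X⌋₊ : ℝ) ≤ X := Nat.floor_le hX0.le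
  obtain ⟨h1, h2⟩ := key _ hN hNX
  have hA : 0 ≤ Real.log (X / ⌊X⌋₊) := Real.log_nonneg (by rwa [one_le_div (by positivity)])
  have hA2 : Real.log (X / ⌊X⌋₊) ≤ 1 / ⌊X⌋₊ := by
    refine (Real.log_le_sub_one_of_pos (by positivity)).trans ?_
    have := Nat.lt_floor_add_one X
    rw [div_sub_one (by positivity)]
    gcongr
    linarith
  refine ⟨le_trans ?_ h1, h2.trans ?_⟩
  · have : Real.log (X / ⌊X⌋₊) ^ (j + 1) / (j + 1) ≤ 1 / (⌊X⌋₊ : ℝ) * Real.log (X / ⌊X⌋₊) ^ j := by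
      rw [pow_succ', div_le_iff₀ hj]
      have h3 : Real.log (X / ⌊X⌋₊) * Real.log (X / ⌊X⌋₊) ^ j ≤
        1 / (⌊X⌋₊ : ℝ) * Real.log (X / ⌊X⌋₊) ^ j := by gcongr
      have h4 : 0 ≤ 1 / (⌊X⌋₊ : ℝ) * Real.log (X / ⌊X⌋₊) ^ j := by positivity
      have h5 : (0 : ℝ) ≤ j := by positivity
      nlinarith
    linarith
  · have : 0 ≤ Real.log (X / ⌊X⌋₊) ^ (j + 1) / (j + 1) := by positivity
    linarith

lemma norm_sum_mul_le_of_antitone {a : ℕ → ℂ} {φ : ℕ → ℝ} {B : ℝ} {N : ℕ} (hN : 1 ≤ N)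
    (hB : ∀ m, ‖∑ n ∈ Icc 1 m, a n‖ ≤ B) (hφ : ∀ n, 1 ≤ n → n + 1 ≤ N → φ (n + 1) ≤ φ n)
    (hφ0 : 0 ≤ φ N) :
    ‖∑ n ∈ Icc 1 N, a n * φ n‖ ≤ B * φ 1 := by
  have key : ∀ m, 1 ≤ m → m ≤ N →
      ‖∑ n ∈ Icc 1 m, a n * φ n - (∑ n ∈ Icc 1 m, a n) * φ m‖ ≤ B * (φ 1 - φ m) := by
    intro m hm
    induction m, hm using Nat.le_induction with
    | base => simp
    | succ m hm ih =>
      intro hmN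
      have h1 := ih (by omega)
      have e : ∑ n ∈ Icc 1 (m + 1), a n * φ n - (∑ n ∈ Icc 1 (m + 1), a n) * φ (m + 1) =
          (∑ n ∈ Icc 1 m, a n * φ n - (∑ n ∈ Icc 1 m, a n) * φ m) +
            (∑ n ∈ Icc 1 m, a n) * ((φ m - φ (m + 1) : ℝ) : ℂ) := by
        rw [← Finset.insert_Icc_right_eq_Icc_add_one (by omega), Finset.sum_insert (by simp),
          Finset.sum_insert (by simp)]
        push_cast
        ring
      rw [e]
      have h2 := hφ m hm hmN
      calc _ ≤ B * (φ 1 - φ m) + B * (φ m - φ (m + 1)) := by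
            refine (norm_add_le _ _).trans (add_le_add h1 ?_)
            rw [norm_mul, Complex.norm_real, Real.norm_of_nonneg (by linarith)]
            exact mul_le_mul_of_nonneg_right (hB m) (by linarith)
        _ = _ := by ring
  have h1 := key N hN le_rfl
  have h2 : ‖(∑ n ∈ Icc 1 N, a n) * (φ N : ℂ)‖ ≤ B * φ N := by
    rw [norm_mul, Complex.norm_real, Real.norm_of_nonneg hφ0]
    exact mul_le_mul_of_nonneg_right (hB N) hφ0
  calc _ = ‖(∑ n ∈ Icc 1 N, a n * φ n - (∑ n ∈ Icc 1 N, a n) * φ N) +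
      (∑ n ∈ Icc 1 N, a n) * φ N‖ := by rw [sub_add_cancel]
    _ ≤ B * (φ 1 - φ N) + B * φ N := (norm_add_le _ _).trans (add_le_add h1 h2)
    _ = _ := by ring

lemma sum_range_natCast_zmod {q : ℕ} [NeZero q] (h : ZMod q → ℂ) (c : ZMod q) :
    ∑ i ∈ Finset.range q, h (c + i) = ∑ x, h x := by
  refine Finset.sum_bij' (fun i _ => c + (i : ZMod q)) (fun x _ => (x - c).val) ?_ ?_ ?_ ?_ ?_
  · simp
  · intro x _
    exact Finset.mem_range.2 (ZMod.val_lt _)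
  · intro i hi
    simp [ZMod.val_cast_of_lt (Finset.mem_range.1 hi)]
  · intro x _
    simp
  · simp

lemma norm_sum_periodic_sub_mean_le {q : ℕ} [NeZero q] {h : ZMod q → ℂ} {B : ℝ}
    (hB : ∀ r, ‖h r‖ ≤ B) (m : ℕ) :
    ‖∑ n ∈ Icc 1 m, (h n - (∑ x, h x) / q)‖ ≤ 2 * q * B := by
  have hq : (q : ℂ) ≠ 0 := Nat.cast_ne_zero.2 (NeZero.ne q)
  have hq' : (0 : ℝ) < q := Nat.cast_pos.2 (NeZero.pos q)
  have hB0 : 0 ≤ B := (norm_nonneg _).trans (hB 0)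
  have hmean : ‖(∑ x, h x) / q‖ ≤ B := by
    rw [norm_div, Complex.norm_natCast, div_le_iff₀ hq']
    refine (norm_sum_le _ _).trans ((Finset.sum_le_sum fun x _ => hB x).trans ?_)
    simp [ZMod.card, mul_comm]
  induction m using Nat.strong_induction_on with
  | _ m ih =>
    rcases lt_or_ge m q with hm | hm
    · refine (norm_sum_le _ _).trans ((Finset.sum_le_sum fun n _ =>
        (norm_sub_le _ _).trans (add_le_add (hB _) hmean)).trans ?_)
      simp only [Finset.sum_const, Nat.card_Icc, Nat.add_sub_cancel, nsmul_eq_mul]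
      have : (m : ℝ) ≤ q := by exact_mod_cast hm.le
      nlinarith
    · have hs : ∑ n ∈ Icc 1 m, (h n - (∑ x, h x) / q) =
          ∑ n ∈ Icc 1 (m - q), (h n - (∑ x, h x) / q) := by
        have e1 : ∀ k, Icc 1 k = Ico 1 (k + 1) := fun k => by ext; simp
        rw [e1, e1, ← Finset.sum_Ico_consecutive _ (by omega : 1 ≤ m - q + 1)
          (by omega : m - q + 1 ≤ m + 1),
          Finset.sum_Ico_eq_sum_range _ (m - q + 1) (m + 1),
          (by omega : m + 1 - (m - q + 1) = q),
          Finset.sum_sub_distrib (s := Finset.range q)]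
        have := sum_range_natCast_zmod h ((m - q + 1 : ℕ) : ZMod q)
        simp only [← Nat.cast_add] at this
        rw [this]
        simp [mul_div_cancel₀ _ hq]
      rw [hs]
      exact ih _ (by have := NeZero.pos q; omega)

/-- Summing a function with a known `(log Y)^j` asymptotic against `1/n`, with the coefficient
depending on `n` modulo `q`. -/
lemma norm_sum_inv_mul_sub_le {q : ℕ} [NeZero q] {G : ZMod q → ℝ → ℂ} {μ : ZMod q → ℂ}
    {B E X : ℝ} {j N : ℕ} (hX : 1 ≤ X) (hN : ⌊X⌋₊ ≤ N) (hB : ∀ r, ‖μ r‖ ≤ B) (hE : 0 ≤ E)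
    (hG0 : ∀ r Y, Y < 1 → G r Y = 0)
    (hG : ∀ r Y, 1 ≤ Y → Y ≤ X → ‖G r Y - μ r * (Real.log Y : ℂ) ^ j‖ ≤ E) :
    ‖∑ n ∈ Icc 1 N, 1 / (n : ℂ) * G n (X / n) -
      (∑ r, μ r) / q / (j + 1) * (Real.log X : ℂ) ^ (j + 1)‖ ≤
      E * (1 + Real.log X) + (2 * q + 1) * B * (1 + Real.log X) ^ j := by
  have hq' : (0 : ℝ) < q := Nat.cast_pos.2 (NeZero.pos q)
  have hB0 : 0 ≤ B := (norm_nonneg _).trans (hB 0)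
  have hlog : 0 ≤ Real.log X := Real.log_nonneg hX
  have hX0 : 0 < X := by linarith
  set m := (∑ r, μ r) / q with hm
  have hmean : ‖m‖ ≤ B := by
    rw [hm, norm_div, Complex.norm_natCast, div_le_iff₀ hq']
    refine (norm_sum_le _ _).trans ((Finset.sum_le_sum fun x _ => hB x).trans ?_)
    simp [ZMod.card, mul_comm]
  have hmem : ∀ n ∈ Icc 1 ⌊X⌋₊, (1 : ℝ) ≤ n ∧ (n : ℝ) ≤ X := fun n hn => by
    rw [Finset.mem_Icc] at hn
    exact ⟨by exact_mod_cast hn.1, (Nat.cast_le.2 hn.2).trans (Nat.floor_le hX0.le)⟩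
  set φ : ℕ → ℝ := fun n => 1 / (n : ℝ) * Real.log (X / n) ^ j with hφ
  have hcut : ∑ n ∈ Icc 1 N, 1 / (n : ℂ) * G n (X / n) =
      ∑ n ∈ Icc 1 ⌊X⌋₊, 1 / (n : ℂ) * G n (X / n) := by
    symm
    refine Finset.sum_subset (Finset.Icc_subset_Icc_right hN) fun n hn hn' => ?_
    rw [Finset.mem_Icc] at hn hn'
    have h1 : (0 : ℝ) < n := by exact_mod_cast hn.1
    rw [hG0 _ _ ?_, mul_zero]
    rw [div_lt_one h1]
    exact Nat.lt_of_floor_lt (by omega)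
  have e : ∑ n ∈ Icc 1 ⌊X⌋₊, 1 / (n : ℂ) * G n (X / n) - m / (j + 1) * (Real.log X : ℂ) ^ (j + 1) =
      ∑ n ∈ Icc 1 ⌊X⌋₊, 1 / (n : ℂ) * (G n (X / n) - μ n * (Real.log (X / n) : ℂ) ^ j) +
      ∑ n ∈ Icc 1 ⌊X⌋₊, (μ n - m) * φ n +
      m * ((∑ n ∈ Icc 1 ⌊X⌋₊, φ n - Real.log X ^ (j + 1) / (j + 1) : ℝ) : ℂ) := by
    simp only [hφ]
    push_cast
    rw [mul_sub, Finset.mul_sum, ← add_sub_assoc, ← Finset.sum_add_distrib,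
      ← Finset.sum_add_distrib]
    congr 1
    · refine Finset.sum_congr rfl fun n _ => ?_
      ring
    · ring
  rw [hcut, e]
  have b1 : ‖∑ n ∈ Icc 1 ⌊X⌋₊, 1 / (n : ℂ) * (G n (X / n) - μ n * (Real.log (X / n) : ℂ) ^ j)‖ ≤
      E * (1 + Real.log X) := by
    calc _ ≤ ∑ n ∈ Icc 1 ⌊X⌋₊, E * (1 / (n : ℝ)) := by
          refine (norm_sum_le _ _).trans (Finset.sum_le_sum fun n hn => ?_)
          obtain ⟨h1, h2⟩ := hmem n hn
          rw [norm_mul, norm_div, norm_one, Complex.norm_natCast, mul_comm]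
          gcongr
          exact hG _ _ (by rwa [one_le_div (by linarith)]) (div_le_self hX0.le h1)
      _ ≤ _ := by
          rw [← Finset.mul_sum]
          gcongr
          exact sum_Icc_inv_le hX (Nat.floor_le hX0.le)
  have hN1 : 1 ≤ ⌊X⌋₊ := Nat.le_floor (by simpa using hX)
  have b2 : ‖∑ n ∈ Icc 1 ⌊X⌋₊, (μ n - m) * φ n‖ ≤ 2 * q * B * (1 + Real.log X) ^ j := by
    refine (norm_sum_mul_le_of_antitone hN1 (norm_sum_periodic_sub_mean_le hB) ?_ ?_).trans ?_
    · intro n hn hn'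
      have h1 : (1 : ℝ) ≤ n := by exact_mod_cast hn
      have h2 : ((n + 1 : ℕ) : ℝ) ≤ X := (hmem (n + 1) (Finset.mem_Icc.2 ⟨by omega, hn'⟩)).2
      have h3 : 0 ≤ Real.log (X / (n + 1 : ℕ)) := Real.log_nonneg (by
        rwa [one_le_div (by positivity)])
      simp only [hφ]
      gcongr <;> simp
    · obtain ⟨h1, h2⟩ := hmem _ (Finset.mem_Icc.2 ⟨hN1, le_rfl⟩)
      have h3 : 0 ≤ Real.log (X / ⌊X⌋₊) := Real.log_nonneg (by
        rwa [one_le_div (by linarith)])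
      simp only [hφ]
      positivity
    · simp only [hφ, Nat.cast_one, div_one, one_mul]
      gcongr
      linarith
  have b3 : ‖m * ((∑ n ∈ Icc 1 ⌊X⌋₊, φ n - Real.log X ^ (j + 1) / (j + 1) : ℝ) : ℂ)‖ ≤
      B * (1 + Real.log X) ^ j := by
    obtain ⟨h1, h2⟩ := sum_inv_mul_log_div_pow_bounds hX j
    rw [norm_mul, Complex.norm_real, Real.norm_of_nonneg (by linarith)]
    gcongr
    have : Real.log X ^ j ≤ (1 + Real.log X) ^ j := by gcongr; linarith
    linarith
  refine (norm_add₃_le).trans ?_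
  linarith

/-- The sum of `G n (Y / n) / n` over `1 ≤ n ≤ N`. -/
noncomputable def invSum {q : ℕ} (N : ℕ) (G : ZMod q → ℝ → ℂ) (Y : ℝ) : ℂ :=
  ∑ n ∈ Icc 1 N, 1 / (n : ℂ) * G n (Y / n)

lemma invSum_eq_zero {q N : ℕ} {G : ZMod q → ℝ → ℂ} (hG : ∀ r Y, Y < 1 → G r Y = 0) {Y : ℝ}
    (hY : Y < 1) : invSum N G Y = 0 := by
  refine Finset.sum_eq_zero fun n hn => ?_
  have h1 : (1 : ℝ) ≤ n := by exact_mod_cast (Finset.mem_Icc.1 hn).1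
  rw [hG _ _ ?_, mul_zero]
  rw [div_lt_one (by linarith)]
  linarith

/-- The sum of `F(g, k, x, y) / (g k x y)` over positive integers with `g k x y ≤ X`. -/
noncomputable def invSumQuad {q : ℕ} (N : ℕ) (F : ZMod q → ZMod q → ZMod q → ZMod q → ℂ) :
    ℝ → ℂ :=
  invSum N fun g => invSum N fun k => invSum N fun x => invSum N fun y Y =>
    if 1 ≤ Y then F g k x y else 0

lemma invSumQuad_eq_zero {q N : ℕ} {F : ZMod q → ZMod q → ZMod q → ZMod q → ℂ} {X : ℝ}
    (hX : X < 1) : invSumQuad N F X = 0 :=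
  invSum_eq_zero (fun _ _ hY => invSum_eq_zero (fun _ _ hY => invSum_eq_zero
    (fun _ _ hY => invSum_eq_zero (fun _ _ hY => if_neg (not_le.2 hY)) hY) hY) hY) hX

lemma norm_sum_div_card_le {q : ℕ} [NeZero q] {μ : ZMod q → ℂ} {B : ℝ} (hB : ∀ r, ‖μ r‖ ≤ B) :
    ‖(∑ r, μ r) / q‖ ≤ B := by
  have hq' : (0 : ℝ) < q := Nat.cast_pos.2 (NeZero.pos q)
  rw [norm_div, Complex.norm_natCast, div_le_iff₀ hq']
  refine (norm_sum_le _ _).trans ((Finset.sum_le_sum fun x _ => hB x).trans ?_)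
  simp [ZMod.card, mul_comm]

lemma norm_invSumQuad_sub_le {q : ℕ} [NeZero q] {F : ZMod q → ZMod q → ZMod q → ZMod q → ℂ}
    (hF : ∀ g k x y, ‖F g k x y‖ ≤ 1) {X : ℝ} {N : ℕ} (hX : 1 ≤ X) (hN : ⌊X⌋₊ ≤ N) :
    ‖invSumQuad N F X - (∑ g, ∑ k, ∑ x, ∑ y, F g k x y) / (24 * q ^ 4) * (Real.log X : ℂ) ^ 4‖ ≤
      4 * (2 * q + 1) * (1 + Real.log X) ^ 3 := by
  have hq' : (0 : ℝ) < q := Nat.cast_pos.2 (NeZero.pos q)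
  have hlog : ∀ {Y : ℝ}, 1 ≤ Y → 0 ≤ Real.log Y := fun h => Real.log_nonneg h
  have hmono : ∀ {Y : ℝ}, 1 ≤ Y → Y ≤ X → Real.log Y ≤ Real.log X := fun h1 h2 =>
    Real.log_le_log (by linarith) h2
  have hN' : ∀ {Y : ℝ}, Y ≤ X → ⌊Y⌋₊ ≤ N := fun h => (Nat.floor_le_floor h).trans hN
  have s1 : ∀ g k x Y, 1 ≤ Y → Y ≤ X → ‖invSum N (fun y Y => if 1 ≤ Y then F g k x y else 0) Y -
      (∑ y, F g k x y) / q * (Real.log Y : ℂ) ^ 1‖ ≤ 2 * q + 1 := by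
    intro g k x Y hY hYX
    have := norm_sum_inv_mul_sub_le (G := fun y Y => if 1 ≤ Y then F g k x y else 0)
      (μ := fun y => F g k x y) (j := 0) (B := 1) (E := 0) hY (hN' hYX) (hF g k x) le_rfl
      (fun _ _ h => if_neg (not_le.2 h)) (fun r Z h _ => by simp [h])
    refine (le_of_eq ?_).trans (this.trans (by simp))
    simp [invSum]
  have s2 : ∀ g k Y, 1 ≤ Y → Y ≤ X → ‖invSum N (fun x => invSum N fun y Y =>
      if 1 ≤ Y then F g k x y else 0) Y -
      (∑ x, (∑ y, F g k x y) / q) / q / 2 * (Real.log Y : ℂ) ^ 2‖ ≤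
      2 * (2 * q + 1) * (1 + Real.log X) := by
    intro g k Y hY hYX
    have := norm_sum_inv_mul_sub_le (G := fun x => invSum N fun y Y =>
      if 1 ≤ Y then F g k x y else 0) (μ := fun x => (∑ y, F g k x y) / q) (j := 1) (B := 1)
      (E := 2 * q + 1) hY (hN' hYX) (fun x => norm_sum_div_card_le (hF g k x)) (by positivity)
      (fun _ _ h => invSum_eq_zero (fun _ _ h => if_neg (not_le.2 h)) h)
      (fun x Z h h' => s1 g k x Z h (h'.trans hYX))
    refine (le_of_eq ?_).trans (this.trans ?_)
    · norm_num [invSum]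
    · have := hmono hY hYX
      have : (0 : ℝ) ≤ (2 * q + 1) := by positivity
      nlinarith
  have s3 : ∀ g Y, 1 ≤ Y → Y ≤ X → ‖invSum N (fun k => invSum N fun x => invSum N fun y Y =>
      if 1 ≤ Y then F g k x y else 0) Y -
      (∑ k, (∑ x, (∑ y, F g k x y) / q) / q / 2) / q / 3 * (Real.log Y : ℂ) ^ 3‖ ≤
      3 * (2 * q + 1) * (1 + Real.log X) ^ 2 := by
    intro g Y hY hYX
    have := norm_sum_inv_mul_sub_le (G := fun k => invSum N fun x => invSum N fun y Y =>
      if 1 ≤ Y then F g k x y else 0) (μ := fun k => (∑ x, (∑ y, F g k x y) / q) / q / 2)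
      (j := 2) (B := 1) (E := 2 * (2 * q + 1) * (1 + Real.log X)) hY (hN' hYX) (fun k => ?_)
      (by have := hlog hX; positivity)
      (fun _ _ h => invSum_eq_zero (fun _ _ h => invSum_eq_zero
        (fun _ _ h => if_neg (not_le.2 h)) h) h)
      (fun k Z h h' => s2 g k Z h (h'.trans hYX))
    · refine (le_of_eq ?_).trans (this.trans ?_)
      · norm_num [invSum]
      · have h1 := hmono hY hYX
        have h2 := hlog hY
        have h3 : (0 : ℝ) ≤ (2 * q + 1) := by positivity
        have h4 : (2 * q + 1) * 1 * (1 + Real.log Y) ^ 2 ≤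
          (2 * q + 1) * 1 * (1 + Real.log X) ^ 2 := by gcongr
        have h6 := hlog hX
        have h5 : 2 * (2 * q + 1) * (1 + Real.log X) * (1 + Real.log Y) ≤
          2 * (2 * q + 1) * (1 + Real.log X) * (1 + Real.log X) := by gcongr
        nlinarith
    · rw [norm_div, Complex.norm_ofNat]
      have := norm_sum_div_card_le (fun x => norm_sum_div_card_le (hF g k x))
      linarith
  have := norm_sum_inv_mul_sub_le (G := fun g => invSum N fun k => invSum N fun x =>
      invSum N fun y Y => if 1 ≤ Y then F g k x y else 0)
      (μ := fun g => (∑ k, (∑ x, (∑ y, F g k x y) / q) / q / 2) / q / 3)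
      (j := 3) (B := 1) (E := 3 * (2 * q + 1) * (1 + Real.log X) ^ 2) hX hN (fun g => ?_)
      (by have := hlog hX; positivity)
      (fun _ _ h => invSum_eq_zero (fun _ _ h => invSum_eq_zero (fun _ _ h => invSum_eq_zero
        (fun _ _ h => if_neg (not_le.2 h)) h) h) h)
      (fun k Z h h' => s3 k Z h h')
  · refine (le_of_eq ?_).trans (this.trans (le_of_eq (by ring)))
    rw [invSumQuad, invSum]
    congr 2
    norm_num
    simp only [← Finset.sum_div]
    field_simp
    left
    ring
  · rw [norm_div]
    have h1 : ∀ k, ‖(∑ x, (∑ y, F g k x y) / (q : ℂ)) / q / 2‖ ≤ 1 := fun k => by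
      rw [norm_div, Complex.norm_ofNat]
      have := norm_sum_div_card_le (fun x => norm_sum_div_card_le (hF g k x))
      linarith
    have := norm_sum_div_card_le h1
    rw [Complex.norm_ofNat]
    linarith

lemma sum_Icc_filter_dvd {M : Type*} [AddCommMonoid M] {e N : ℕ} (he : 1 ≤ e) {f : ℕ → M}
    (hf : ∀ n, N < n → f n = 0) :
    ∑ x ∈ Icc 1 N, (if e ∣ x then f x else 0) = ∑ x ∈ Icc 1 N, f (e * x) := by
  rw [← Finset.sum_filter]
  symm
  calc ∑ x ∈ Icc 1 N, f (e * x) = ∑ x ∈ Icc 1 N with e * x ≤ N, f (e * x) := by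
        rw [Finset.sum_filter]
        refine Finset.sum_congr rfl fun x _ => ?_
        split_ifs with h
        exacts [rfl, hf _ (not_le.1 h)]
    _ = _ := by
        refine Finset.sum_nbij' (fun x => e * x) (fun x => x / e) ?_ ?_ ?_ ?_ ?_
        · intro x hx
          simp only [Finset.mem_filter, Finset.mem_Icc] at hx ⊢
          exact ⟨⟨Nat.mul_pos he hx.1.1, hx.2⟩, ⟨x, rfl⟩⟩
        · intro x hx
          simp only [Finset.mem_filter, Finset.mem_Icc] at hx ⊢
          obtain ⟨⟨h1, h2⟩, k, rfl⟩ := hx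
          rw [Nat.mul_div_cancel_left _ he]
          have hk := Nat.pos_of_mul_pos_left h1
          exact ⟨⟨hk, by nlinarith⟩, h2⟩
        · intro x _
          exact Nat.mul_div_cancel_left _ he
        · intro x hx
          exact Nat.mul_div_cancel' (Finset.mem_filter.1 hx).2
        · simp

lemma sum_moebius_dvd_dvd {x y N : ℕ} (hx : x ∈ Icc 1 N) :
    ∑ e ∈ Icc 1 N, (if e ∣ x then (if e ∣ y then (ArithmeticFunction.moebius e : ℂ) else 0) else 0) =
      if Nat.Coprime x y then 1 else 0 := by
  rw [Finset.mem_Icc] at hx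
  have h := congrArg (fun f => (f (Nat.gcd x y) : ℤ))
    ArithmeticFunction.moebius_mul_coe_zeta
  simp only [ArithmeticFunction.coe_mul_zeta_apply, ArithmeticFunction.one_apply] at h
  have h' : (∑ e ∈ (Nat.gcd x y).divisors, (ArithmeticFunction.moebius e : ℂ)) =
      if Nat.gcd x y = 1 then 1 else 0 := by exact_mod_cast congrArg (Int.cast : ℤ → ℂ) h
  simp only [Nat.coprime_iff_gcd_eq_one]
  rw [← h']
  simp only [← ite_and]
  rw [← Finset.sum_filter]
  refine Finset.sum_congr ?_ fun _ _ => rfl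
  ext e
  simp only [Finset.mem_filter, Finset.mem_Icc, Nat.mem_divisors, Nat.dvd_gcd_iff]
  constructor
  · rintro ⟨_, h⟩
    exact ⟨h, (Nat.gcd_pos_of_pos_left y hx.1).ne'⟩
  · rintro ⟨⟨h1, h2⟩, -⟩
    exact ⟨⟨Nat.pos_of_dvd_of_pos h1 hx.1, (Nat.le_of_dvd hx.1 h1).trans hx.2⟩, h1, h2⟩

/-- The quadruple correlation attached to a function modulo `q`. -/
noncomputable def quadCorr {q : ℕ} (f : ZMod q → ℂ) (e : ℕ) (g k x y : ZMod q) : ℂ :=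
  f (g * (e * x)) * f (k * (e * y)) * starRingEnd ℂ (f (g * (e * y)) * f (k * (e * x)))

lemma norm_quadCorr_le {q : ℕ} {f : ZMod q → ℂ} (hf : ∀ r, ‖f r‖ ≤ 1) (e : ℕ) (g k x y : ZMod q) :
    ‖quadCorr f e g k x y‖ ≤ 1 := by
  rw [quadCorr, norm_mul, RCLike.norm_conj, norm_mul, norm_mul]
  exact mul_le_one₀ (mul_le_one₀ (hf _) (norm_nonneg _) (hf _)) (by positivity)
    (mul_le_one₀ (hf _) (norm_nonneg _) (hf _))

lemma sum_inv_mul_dirichletSq_mul_conj {q : ℕ} (f : ZMod q → ℂ) {X : ℝ} (hX : 1 ≤ X) :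
    ∑ n ∈ Icc 1 ⌊X⌋₊, 1 / (n : ℂ) * (dirichletSq (fun m => f m) n *
        starRingEnd ℂ (dirichletSq (fun m => f m) n)) =
      ∑ e ∈ Icc 1 ⌊X⌋₊, (ArithmeticFunction.moebius e : ℂ) / (e : ℂ) ^ 2 *
        invSumQuad ⌊X⌋₊ (quadCorr f e) (X / e ^ 2) := by
  set N := ⌊X⌋₊ with hN
  set H : ℕ → ℕ → ℕ → ℕ → ℂ := fun u v u' v' =>
    f u * f v * starRingEnd ℂ (f u' * f v') with hH
  set W : ℕ → ℕ → ℕ → ℕ → ℂ := fun g k x y => if g * k * x * y ≤ N then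
    1 / ((g : ℂ) * k * x * y) * H (g * x) (k * y) (g * y) (k * x) else 0 with hW
  have step1 : ∀ n ∈ Icc 1 N, 1 / (n : ℂ) * (dirichletSq (fun m => f m) n *
        starRingEnd ℂ (dirichletSq (fun m => f m) n)) =
      ∑ z ∈ Icc 1 N ×ˢ Icc 1 N ×ˢ Icc 1 N ×ˢ Icc 1 N,
        if z.1 * z.2.1 * z.2.2.1 * z.2.2.2 = n then
          (if Nat.Coprime z.2.2.1 z.2.2.2 then W z.1 z.2.1 z.2.2.1 z.2.2.2 else 0) else 0 := by
    intro n hn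
    rw [dirichletSq, map_sum, Finset.sum_mul_sum]
    have := sum_divisorsAntidiagonal_sum_divisorsAntidiagonal hn H
    simp only [hH] at this
    rw [this, Finset.mul_sum, Finset.sum_filter]
    refine Finset.sum_congr rfl fun z _ => ?_
    by_cases h1 : z.1 * z.2.1 * z.2.2.1 * z.2.2.2 = n
    · by_cases h2 : Nat.Coprime z.2.2.1 z.2.2.2
      · simp only [h1, if_true, hW, hH]
        rw [if_pos (Finset.mem_Icc.1 hn).2, ← h1]
        push_cast
        simp
      · simp [h2]
    · simp [h1]
  rw [Finset.sum_congr rfl step1, Finset.sum_comm]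
  have step2 : ∀ z ∈ Icc 1 N ×ˢ Icc 1 N ×ˢ Icc 1 N ×ˢ Icc 1 N, (∑ n ∈ Icc 1 N,
      if z.1 * z.2.1 * z.2.2.1 * z.2.2.2 = n then
        (if Nat.Coprime z.2.2.1 z.2.2.2 then W z.1 z.2.1 z.2.2.1 z.2.2.2 else 0) else 0) =
      ∑ e ∈ Icc 1 N, (if e ∣ z.2.2.1 then (if e ∣ z.2.2.2 then
        (ArithmeticFunction.moebius e : ℂ) * W z.1 z.2.1 z.2.2.1 z.2.2.2 else 0) else 0) := by
    intro z hz
    simp only [Finset.mem_product] at hz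
    have h0 : 1 ≤ z.1 * z.2.1 * z.2.2.1 * z.2.2.2 := by
      simp only [Finset.mem_Icc] at hz
      exact Nat.mul_pos (Nat.mul_pos (Nat.mul_pos hz.1.1 hz.2.1.1) hz.2.2.1.1) hz.2.2.2.1
    have := sum_moebius_dvd_dvd (y := z.2.2.2) hz.2.2.1
    have e2 : ∑ e ∈ Icc 1 N, (if e ∣ z.2.2.1 then (if e ∣ z.2.2.2 then
        (ArithmeticFunction.moebius e : ℂ) * W z.1 z.2.1 z.2.2.1 z.2.2.2 else 0) else 0) =
        (if Nat.Coprime z.2.2.1 z.2.2.2 then 1 else 0) * W z.1 z.2.1 z.2.2.1 z.2.2.2 := by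
      rw [← this, Finset.sum_mul]
      refine Finset.sum_congr rfl fun e _ => ?_
      split_ifs <;> simp
    rw [e2, Finset.sum_ite_eq]
    by_cases h : z.1 * z.2.1 * z.2.2.1 * z.2.2.2 ≤ N
    · rw [if_pos (Finset.mem_Icc.2 ⟨h0, h⟩)]
      simp
    · rw [if_neg (fun h' => h (Finset.mem_Icc.1 h').2)]
      simp [hW, h]
  rw [Finset.sum_congr rfl step2, Finset.sum_comm]
  refine Finset.sum_congr rfl fun e he => ?_
  have he1 : 1 ≤ e := (Finset.mem_Icc.1 he).1
  have he0 : (0 : ℝ) < e := by exact_mod_cast he1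
  have hvan : ∀ g ∈ Icc 1 N, ∀ k ∈ Icc 1 N, ∀ x, 1 ≤ x → ∀ y, 1 ≤ y → (N < x ∨ N < y) →
      W g k x y = 0 := by
    intro g hg k hk x hx y hy h
    rw [Finset.mem_Icc] at hg hk
    refine if_neg (not_le.2 ?_)
    have hgk : 1 ≤ g * k := Nat.mul_pos hg.1 hk.1
    rcases h with h | h
    · refine h.trans_le ?_
      have := Nat.mul_le_mul (Nat.mul_le_mul hgk (le_refl x)) hy
      linarith
    · refine h.trans_le ?_
      have := Nat.mul_le_mul (Nat.mul_le_mul hgk hx) (le_refl y)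
      linarith
  simp only [invSumQuad, invSum, Finset.mul_sum, Finset.sum_product]
  refine Finset.sum_congr rfl fun g hg => Finset.sum_congr rfl fun k hk => ?_
  have hx : ∀ x ∈ Icc 1 N, (∑ y ∈ Icc 1 N, if e ∣ x then if e ∣ y then
      (ArithmeticFunction.moebius e : ℂ) * W g k x y else 0 else 0) = if e ∣ x then
        ∑ y ∈ Icc 1 N, (ArithmeticFunction.moebius e : ℂ) * W g k x (e * y) else 0 := by
    intro x hx
    split_ifs
    · refine sum_Icc_filter_dvd (f := fun y => (ArithmeticFunction.moebius e : ℂ) * W g k x y) he1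
        fun y hy => ?_
      rw [hvan g hg k hk x (Finset.mem_Icc.1 hx).1 y (by omega) (Or.inr hy), mul_zero]
    · simp
  rw [Finset.sum_congr rfl hx, sum_Icc_filter_dvd (f := fun x => ∑ y ∈ Icc 1 N,
    (ArithmeticFunction.moebius e : ℂ) * W g k x (e * y)) he1]
  · refine Finset.sum_congr rfl fun x hx => Finset.sum_congr rfl fun y hy => ?_
    simp only [Finset.mem_Icc] at hg hk hx hy
    have hg0 : (0 : ℝ) < g := by exact_mod_cast hg.1
    have hk0 : (0 : ℝ) < k := by exact_mod_cast hk.1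
    have hx0 : (0 : ℝ) < x := by exact_mod_cast hx.1
    have hy0 : (0 : ℝ) < y := by exact_mod_cast hy.1
    have hiff : (1 : ℝ) ≤ X / e ^ 2 / g / k / x / y ↔ g * k * (e * x) * (e * y) ≤ N := by
      rw [hN, Nat.le_floor_iff (by linarith), div_div, div_div, div_div, div_div,
        one_le_div (by positivity)]
      push_cast
      constructor <;> intro h <;> linarith
    simp only [hW, hiff, quadCorr, hH]
    split_ifs
    · push_cast
      have e1 : (g : ℂ) ≠ 0 := by exact_mod_cast hg0.ne'
      have e2 : (k : ℂ) ≠ 0 := by exact_mod_cast hk0.ne'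
      have e3 : (x : ℂ) ≠ 0 := by exact_mod_cast hx0.ne'
      have e4 : (y : ℂ) ≠ 0 := by exact_mod_cast hy0.ne'
      have e5 : (e : ℂ) ≠ 0 := by exact_mod_cast he0.ne'
      field_simp
    · simp
  · intro x hx
    refine Finset.sum_eq_zero fun y hy => ?_
    rw [hvan g hg k hk x (by omega) (e * y) (Nat.mul_pos he1 (Finset.mem_Icc.1 hy).1)
      (Or.inl hx), mul_zero]

/-- The mean value of the quadruple correlation of `f`, normalised as in the fourth moment. -/
noncomputable def quadMean {q : ℕ} [NeZero q] (f : ZMod q → ℂ) (e : ℕ) : ℂ :=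
  (∑ g, ∑ k, ∑ x, ∑ y, quadCorr f e g k x y) / (24 * q ^ 4)

lemma norm_quadMean_le {q : ℕ} [NeZero q] {f : ZMod q → ℂ} (hf : ∀ r, ‖f r‖ ≤ 1) (e : ℕ) :
    ‖quadMean f e‖ ≤ 1 := by
  have hq' : (0 : ℝ) < q := Nat.cast_pos.2 (NeZero.pos q)
  have h1 : ∀ g k x, ‖(∑ y, quadCorr f e g k x y) / q‖ ≤ 1 := fun g k x =>
    norm_sum_div_card_le (norm_quadCorr_le hf e g k x)
  have h2 := norm_sum_div_card_le fun g => norm_sum_div_card_le fun k => norm_sum_div_card_le (h1 g k)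
  simp only [← Finset.sum_div] at h2
  have : quadMean f e = (∑ g, ∑ k, ∑ x, ∑ y, quadCorr f e g k x y) / q / q / q / q / 24 := by
    rw [quadMean]
    have : (q : ℂ) ≠ 0 := by exact_mod_cast hq'.ne'
    field_simp
  rw [this, norm_div, Complex.norm_ofNat]
  linarith

lemma norm_moebius_div_sq_le (e : ℕ) :
    ‖(ArithmeticFunction.moebius e : ℂ) / (e : ℂ) ^ 2‖ ≤ 1 / (e : ℝ) ^ 2 := by
  rw [norm_div, norm_pow, Complex.norm_natCast]
  gcongr
  rw [Complex.norm_intCast]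
  exact_mod_cast ArithmeticFunction.abs_moebius_le_one

lemma summable_moebius_div_sq_mul {A : ℕ → ℂ} (hA : ∀ e, ‖A e‖ ≤ 1) :
    Summable fun e : ℕ => (ArithmeticFunction.moebius e : ℂ) / (e : ℂ) ^ 2 * A e := by
  refine Summable.of_norm_bounded (g := fun e : ℕ => 1 / (e : ℝ) ^ 2)
    (Real.summable_one_div_nat_pow.2 one_lt_two) fun e => ?_
  rw [norm_mul]
  exact mul_le_of_le_one_right (norm_nonneg _) (hA e) |>.trans (norm_moebius_div_sq_le e)

lemma norm_log_div_pow_sub_le {X y : ℝ} (hy : 1 ≤ y) (hX : y ≤ X) :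
    ‖(Real.log (X / y) : ℂ) ^ 4 - (Real.log X : ℂ) ^ 4‖ ≤ 4 * Real.log y * (1 + Real.log X) ^ 3 := by
  rw [Real.log_div (by linarith) (by linarith)]
  have h1 := Real.log_nonneg hy
  have h2 := Real.log_le_log (by linarith) hX
  set L := Real.log X
  set l := Real.log y
  have e1 : ((L - l : ℝ) : ℂ) ^ 4 - (L : ℂ) ^ 4 = (((L - l) ^ 4 - L ^ 4 : ℝ) : ℂ) := by push_cast; ring
  rw [e1, Complex.norm_real, Real.norm_eq_abs, abs_sub_comm]
  have h3 : (L - l) ^ 4 ≤ L ^ 4 := pow_le_pow_left₀ (by linarith) (by linarith) 4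
  rw [abs_of_nonneg (by linarith)]
  have h4 : L ^ 4 - (L - l) ^ 4 =
      l * (L ^ 3 + L ^ 2 * (L - l) + L * (L - l) ^ 2 + (L - l) ^ 3) := by ring
  rw [h4]
  have h5 : (L - l) ≤ 1 + L := by linarith
  have h6 : 0 ≤ L - l := by linarith
  have h7 : L ≤ 1 + L := by linarith
  have hL : 0 ≤ L := by linarith
  have a1 : L ^ 3 ≤ (1 + L) ^ 3 := by gcongr
  have a2 : L ^ 2 * (L - l) ≤ (1 + L) ^ 2 * (1 + L) := by gcongr
  have a3 : L * (L - l) ^ 2 ≤ (1 + L) * (1 + L) ^ 2 := by gcongr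
  have a4 : (L - l) ^ 3 ≤ (1 + L) ^ 3 := by gcongr
  nlinarith

theorem exists_norm_sum_dirichletSq_sub_le {q : ℕ} [NeZero q] {f : ZMod q → ℂ}
    (hf : ∀ r, ‖f r‖ ≤ 1) : ∃ C : ℝ, 0 ≤ C ∧ ∀ X : ℝ, 1 ≤ X →
      ‖(∑ n ∈ Icc 1 ⌊X⌋₊, 1 / (n : ℂ) * (dirichletSq (fun m => f m) n *
          starRingEnd ℂ (dirichletSq (fun m => f m) n))) -
        (∑' e : ℕ, (ArithmeticFunction.moebius e : ℂ) / (e : ℂ) ^ 2 * quadMean f e) *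
          (Real.log X : ℂ) ^ 4‖ ≤ C * (1 + Real.log X) ^ 3 := by
  have hs : Summable fun e : ℕ => 1 / (e : ℝ) ^ (3 / 2 : ℝ) :=
    Real.summable_one_div_nat_rpow.2 (by norm_num)
  refine ⟨(8 * q + 20) * ∑' e : ℕ, 1 / (e : ℝ) ^ (3 / 2 : ℝ),
    mul_nonneg (by positivity) (tsum_nonneg fun _ => by positivity), fun X hX => ?_⟩
  have hL := Real.log_nonneg hX
  rw [sum_inv_mul_dirichletSq_mul_conj f hX]
  have hsA := summable_moebius_div_sq_mul (norm_quadMean_le hf)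
  have hzero : ∀ e ∉ Icc 1 ⌊X⌋₊, (ArithmeticFunction.moebius e : ℂ) / (e : ℂ) ^ 2 *
        invSumQuad ⌊X⌋₊ (quadCorr f e) (X / e ^ 2) = 0 := by
    intro e he
    rcases Nat.eq_zero_or_pos e with rfl | h0
    · simp
    · have h1 : X < e := by
        rw [← Nat.floor_lt (by linarith)]
        simp only [Finset.mem_Icc] at he
        omega
      rw [invSumQuad_eq_zero, mul_zero]
      have : (1 : ℝ) ≤ e := by exact_mod_cast h0
      rw [div_lt_one (by positivity)]
      nlinarith
  rw [← tsum_eq_sum (L := SummationFilter.unconditional ℕ) hzero, ← tsum_mul_right,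
    ← Summable.tsum_sub (summable_of_ne_finset_zero hzero) (hsA.mul_right _)]
  have hbound : ∀ e : ℕ, ‖(ArithmeticFunction.moebius e : ℂ) / (e : ℂ) ^ 2 *
        invSumQuad ⌊X⌋₊ (quadCorr f e) (X / e ^ 2) - (ArithmeticFunction.moebius e : ℂ) /
        (e : ℂ) ^ 2 * quadMean f e * (Real.log X : ℂ) ^ 4‖ ≤
      (8 * q + 20) * (1 + Real.log X) ^ 3 * (1 / (e : ℝ) ^ (3 / 2 : ℝ)) := by
    intro e
    rcases Nat.eq_zero_or_pos e with rfl | h0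
    · simp
    have he : (1 : ℝ) ≤ e := by exact_mod_cast h0
    have hsq : (1 : ℝ) ≤ (e : ℝ) ^ 2 := one_le_pow₀ he
    have hroot : 1 ≤ √(e : ℝ) := Real.one_le_sqrt.2 he
    have hlog : Real.log ((e : ℝ) ^ 2) ≤ 4 * √(e : ℝ) := by
      rw [Real.log_pow]
      have h1 : Real.log (√(e : ℝ)) ≤ √(e : ℝ) := (Real.log_le_sub_one_of_pos (by positivity)).trans
        (by linarith)
      rw [Real.log_sqrt (by positivity)] at h1
      push_cast
      linarith
    have key : ‖invSumQuad ⌊X⌋₊ (quadCorr f e) (X / e ^ 2) - quadMean f e * (Real.log X : ℂ) ^ 4‖ ≤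
        (8 * q + 20) * (1 + Real.log X) ^ 3 * √(e : ℝ) := by
      have hp : 0 ≤ (1 + Real.log X) ^ 3 := by positivity
      have hm : 4 * Real.log ((e : ℝ) ^ 2) * (1 + Real.log X) ^ 3 ≤
        4 * (4 * √(e : ℝ)) * (1 + Real.log X) ^ 3 := by gcongr
      have hm' : (8 * q + 4) * (1 + Real.log X) ^ 3 ≤
          (8 * q + 4) * (1 + Real.log X) ^ 3 * √(e : ℝ) :=
        le_mul_of_one_le_right (by positivity) hroot
      rcases le_or_gt ((e : ℝ) ^ 2) X with h | h
      · have h1 := norm_invSumQuad_sub_le (N := ⌊X⌋₊) (norm_quadCorr_le hf e)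
          ((one_le_div (by positivity)).2 h) (Nat.floor_le_floor (div_le_self (by linarith) hsq))
        have h2 := norm_log_div_pow_sub_le hsq h
        have h3 : Real.log (X / e ^ 2) ≤ Real.log X := Real.log_le_log (by positivity)
          (div_le_self (by linarith) hsq)
        have h3' : 0 ≤ Real.log (X / e ^ 2) := Real.log_nonneg ((one_le_div (by positivity)).2 h)
        have h4 : 4 * (2 * (q : ℝ) + 1) * (1 + Real.log (X / e ^ 2)) ^ 3 ≤
          4 * (2 * (q : ℝ) + 1) * (1 + Real.log X) ^ 3 := by gcongr
        rw [← quadMean] at h1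
        have e1 : invSumQuad ⌊X⌋₊ (quadCorr f e) (X / e ^ 2) - quadMean f e * (Real.log X : ℂ) ^ 4 =
          (invSumQuad ⌊X⌋₊ (quadCorr f e) (X / e ^ 2) -
            quadMean f e * (Real.log (X / e ^ 2) : ℂ) ^ 4) +
          quadMean f e * ((Real.log (X / e ^ 2) : ℂ) ^ 4 - (Real.log X : ℂ) ^ 4) := by ring
        rw [e1]
        refine (norm_add_le _ _).trans ?_
        rw [norm_mul]
        have h5 := mul_le_of_le_one_left (norm_nonneg ((Real.log (X / e ^ 2) : ℂ) ^ 4 -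
          (Real.log X : ℂ) ^ 4)) (norm_quadMean_le hf e)
        linarith
      · rw [invSumQuad_eq_zero (by rwa [div_lt_one (by positivity)]), zero_sub, norm_neg, norm_mul,
          norm_pow, Complex.norm_real, Real.norm_of_nonneg hL]
        have h1 : Real.log X ≤ 4 * √(e : ℝ) := (Real.log_le_log (by linarith) h.le).trans hlog
        have h2 : Real.log X ^ 4 ≤ 4 * √(e : ℝ) * (1 + Real.log X) ^ 3 := by
          calc Real.log X ^ 4 = Real.log X * Real.log X ^ 3 := by ring
            _ ≤ _ := by gcongr; linarith
        have h5 := mul_le_of_le_one_left (pow_nonneg hL 4) (norm_quadMean_le hf e)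
        have h6 : 0 ≤ (1 + Real.log X) ^ 3 * √(e : ℝ) := by positivity
        nlinarith
    have e1 : (ArithmeticFunction.moebius e : ℂ) / (e : ℂ) ^ 2 *
        invSumQuad ⌊X⌋₊ (quadCorr f e) (X / e ^ 2) - (ArithmeticFunction.moebius e : ℂ) /
        (e : ℂ) ^ 2 * quadMean f e * (Real.log X : ℂ) ^ 4 =
        (ArithmeticFunction.moebius e : ℂ) / (e : ℂ) ^ 2 *
        (invSumQuad ⌊X⌋₊ (quadCorr f e) (X / e ^ 2) - quadMean f e * (Real.log X : ℂ) ^ 4) := by ring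
    rw [e1, norm_mul]
    have e2 : 1 / (e : ℝ) ^ (3 / 2 : ℝ) = 1 / (e : ℝ) ^ 2 * √(e : ℝ) := by
      rw [Real.sqrt_eq_rpow, ← Real.rpow_natCast, one_div, ← Real.rpow_neg (by positivity), one_div,
        ← Real.rpow_neg (by positivity), ← Real.rpow_add (by positivity)]
      norm_num
    calc _ ≤ 1 / (e : ℝ) ^ 2 * ((8 * q + 20) * (1 + Real.log X) ^ 3 * √(e : ℝ)) := by
          gcongr
          exact norm_moebius_div_sq_le e
      _ = _ := by rw [e2]; ring
  refine (tsum_of_norm_bounded (hs.hasSum.mul_left _) hbound).trans (le_of_eq ?_)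
  ring

lemma card_filter_natCast_mul_eq_zero (q e : ℕ) [NeZero q] :
    #{r : ZMod q | (e : ZMod q) * r = 0} = Nat.gcd q e := by
  have hq := NeZero.pos q
  set φ := AddMonoidHom.mulLeft (e : ZMod q)
  have hrange : φ.range = AddSubgroup.zmultiples (e : ZMod q) := by
    ext x
    simp only [AddMonoidHom.mem_range, AddSubgroup.mem_zmultiples_iff, φ, AddMonoidHom.coe_mulLeft]
    constructor
    · rintro ⟨y, rfl⟩
      exact ⟨(y.val : ℤ), by simp [mul_comm]⟩
    · rintro ⟨k, rfl⟩
      exact ⟨(k : ZMod q), by simp [mul_comm]⟩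
  have h1 := AddSubgroup.card_mul_index φ.ker
  rw [AddSubgroup.index_ker, hrange, Nat.card_zmultiples, ZMod.addOrderOf_coe e hq.ne',
    Nat.card_zmod] at h1
  have h2 : Nat.card φ.ker = #{r : ZMod q | (e : ZMod q) * r = 0} := by
    rw [← Fintype.card_subtype, ← Nat.card_eq_fintype_card]
    exact Nat.card_congr (Equiv.subtypeEquivRight fun r => Iff.rfl)
  rw [← h2]
  have hg := Nat.gcd_pos_of_pos_left e hq
  obtain ⟨m, hm⟩ := Nat.gcd_dvd_left q e
  rw [Nat.div_eq_of_eq_mul_right hg hm] at h1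
  have hm0 : 0 < m := by
    rcases Nat.eq_zero_or_pos m with h | h
    · rw [h, mul_zero] at hm
      omega
    · exact h
  exact Nat.eq_of_mul_eq_mul_right hm0 (h1.trans hm)

lemma quadMean_stdAddChar (q : ℕ) [NeZero q] {u : ZMod q} (hu : IsUnit u) (e : ℕ) :
    quadMean (fun r : ZMod q => (ZMod.stdAddChar (u * r) : ℂ)) e = Nat.gcd e q / (24 * q) := by
  have hq' : (q : ℂ) ≠ 0 := Nat.cast_ne_zero.2 (NeZero.ne q)
  have h1 : ∀ g k x y : ZMod q, quadCorr (fun r : ZMod q => (ZMod.stdAddChar (u * r) : ℂ)) e g k x y =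
      ZMod.stdAddChar (x * (u * ((e : ZMod q) * (g - k)))) *
        ZMod.stdAddChar (y * (-(u * ((e : ZMod q) * (g - k))))) := by
    intro g k x y
    simp only [quadCorr, ← AddChar.map_add_eq_mul]
    rw [← AddChar.map_neg_eq_conj, ← AddChar.map_add_eq_mul]
    congr 1
    ring
  have h2 : ∀ g k : ZMod q, ∑ x, ∑ y,
      quadCorr (fun r : ZMod q => (ZMod.stdAddChar (u * r) : ℂ)) e g k x y =
      if (e : ZMod q) * (g - k) = 0 then (q : ℂ) ^ 2 else 0 := by
    intro g k
    simp only [h1, ← Finset.mul_sum, ← Finset.sum_mul]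
    rw [AddChar.sum_mulShift _ (ZMod.isPrimitive_stdAddChar q),
      AddChar.sum_mulShift _ (ZMod.isPrimitive_stdAddChar q)]
    simp only [neg_eq_zero, hu.mul_right_eq_zero]
    split_ifs <;> simp [ZMod.card, sq]
  have h3 : ∀ k : ZMod q, ∑ g : ZMod q, (if (e : ZMod q) * (g - k) = 0 then (q : ℂ) ^ 2 else 0) =
      Nat.gcd e q * (q : ℂ) ^ 2 := by
    intro k
    have h4 := Fintype.sum_equiv (Equiv.subRight k)
      (fun g => if (e : ZMod q) * (g - k) = 0 then (q : ℂ) ^ 2 else 0)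
      (fun r => if (e : ZMod q) * r = 0 then (q : ℂ) ^ 2 else 0) (fun _ => rfl)
    rw [h4, ← Finset.sum_filter, Finset.sum_const, card_filter_natCast_mul_eq_zero, Nat.gcd_comm]
    simp
  rw [quadMean]
  simp only [h2]
  rw [Finset.sum_comm]
  simp only [h3, Finset.sum_const, Finset.card_univ, ZMod.card, nsmul_eq_mul]
  field_simp

lemma quadMean_indicator (q : ℕ) [NeZero q] {u : ZMod q} (hu : IsUnit u) (e : ℕ) :
    quadMean (fun r : ZMod q => if r = u then (1 : ℂ) else 0) e =
      (if Nat.Coprime e q then 1 else 0) * (Nat.totient q / (24 * q ^ 4)) := by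
  have hq' : (q : ℂ) ≠ 0 := Nat.cast_ne_zero.2 (NeZero.ne q)
  have h1 : ∀ g k x y : ZMod q, quadCorr (fun r : ZMod q => if r = u then (1 : ℂ) else 0) e g k x y =
      if (g * (e * x) = u ∧ k = g) ∧ y = x then 1 else 0 := by
    intro g k x y
    have : ((g * (e * x) = u ∧ k = g) ∧ y = x) ↔
        ((g * (e * x) = u ∧ k * (e * y) = u) ∧ g * (e * y) = u ∧ k * (e * x) = u) := by
      constructor
      · rintro ⟨⟨h, rfl⟩, rfl⟩
        exact ⟨⟨h, h⟩, h, h⟩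
      · rintro ⟨⟨h1, h2⟩, h3, h4⟩
        have hg : IsUnit g := isUnit_of_mul_isUnit_left (h1 ▸ hu)
        have hex : IsUnit (e * x) := isUnit_of_mul_isUnit_right (h1 ▸ hu)
        have he : IsUnit (e : ZMod q) := isUnit_of_mul_isUnit_left hex
        exact ⟨⟨h1, hex.mul_right_cancel (h4.trans h1.symm)⟩,
          he.mul_left_cancel (hg.mul_left_cancel (h3.trans h1.symm))⟩
    simp only [this, quadCorr]
    by_cases a1 : g * (e * x) = u <;> by_cases a2 : k * (e * y) = u <;>
      by_cases a3 : g * (e * y) = u <;> by_cases a4 : k * (e * x) = u <;> simp [a1, a2, a3, a4]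
  have h2 : ∑ g : ZMod q, ∑ k : ZMod q, ∑ x : ZMod q, ∑ y : ZMod q,
      (if (g * (e * x) = u ∧ k = g) ∧ y = x then (1 : ℂ) else 0) =
      ∑ g : ZMod q, ∑ x : ZMod q, if g * (e * x) = u then (1 : ℂ) else 0 := by
    refine Finset.sum_congr rfl fun g _ => ?_
    rw [Finset.sum_comm]
    refine Finset.sum_congr rfl fun x _ => ?_
    simp [ite_and]
  rw [quadMean]
  simp only [h1, h2]
  split_ifs with he
  · have heu : IsUnit (e : ZMod q) := (ZMod.isUnit_iff_coprime e q).2 he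
    have h3 : ∀ g : ZMod q, (∑ x : ZMod q, if g * (e * x) = u then (1 : ℂ) else 0) =
        if IsUnit g then 1 else 0 := by
      intro g
      split_ifs with hg
      · obtain ⟨w, hw⟩ := (hg.mul heu)
        rw [Finset.sum_eq_single (↑w⁻¹ * u)]
        · rw [if_pos]
          rw [← mul_assoc, ← hw, Units.mul_inv_cancel_left]
        · intro x _ hx
          refine if_neg fun h => hx ?_
          rw [← h, ← mul_assoc g, ← hw, Units.inv_mul_cancel_left]
        · simp
      · refine Finset.sum_eq_zero fun x _ => if_neg fun h => hg ?_
        exact isUnit_of_mul_isUnit_left (h ▸ hu)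
    have h4 : (∑ g : ZMod q, if IsUnit g then (1 : ℂ) else 0) = Nat.totient q := by
      rw [Finset.sum_ite, Finset.sum_const_zero, add_zero, Finset.sum_const, nsmul_eq_mul, mul_one,
        ← ZMod.card_units_eq_totient]
      congr 1
      rw [← Finset.card_univ, ← Finset.card_map ⟨Units.val, Units.val_injective⟩]
      congr 1
      ext g
      rw [Finset.mem_filter_univ]
      simp [IsUnit]
    simp only [h3, h4, one_mul]
  · rw [zero_mul, div_eq_zero_iff]
    refine Or.inl (Finset.sum_eq_zero fun g _ => Finset.sum_eq_zero fun x _ => if_neg fun h => he ?_)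
    rw [← ZMod.isUnit_iff_coprime]
    exact isUnit_of_mul_isUnit_left (isUnit_of_mul_isUnit_right (h ▸ hu))

lemma hasProd_moebius_div_sq {h : ℕ → ℂ} (h1 : h 1 = 1)
    (hmul : ∀ {m n : ℕ}, Nat.Coprime m n → h (m * n) = h m * h n) {B : ℝ} (hB : ∀ n, ‖h n‖ ≤ B) :
    HasProd (fun p : Nat.Primes => 1 - h p / (p : ℂ) ^ 2)
      (∑' e : ℕ, (ArithmeticFunction.moebius e : ℂ) / (e : ℂ) ^ 2 * h e) := by
  have hs : Summable fun e : ℕ => ‖(ArithmeticFunction.moebius e : ℂ) / (e : ℂ) ^ 2 * h e‖ := by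
    refine Summable.of_nonneg_of_le (fun _ => norm_nonneg _) (fun e => ?_)
      ((Real.summable_one_div_nat_pow.2 one_lt_two).mul_right B)
    rw [norm_mul]
    exact mul_le_mul (norm_moebius_div_sq_le e) (hB e) (norm_nonneg _) (by positivity)
  have := EulerProduct.eulerProduct_hasProd
    (f := fun e : ℕ => (ArithmeticFunction.moebius e : ℂ) / (e : ℂ) ^ 2 * h e) (by simp [h1])
    (fun {m n} hmn => by
      rw [ArithmeticFunction.isMultiplicative_moebius.map_mul_of_coprime hmn, hmul hmn]
      push_cast
      ring) hs (by simp)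
  convert this using 2 with p
  rw [tsum_eq_sum (s := Finset.range 2)]
  · simp [Finset.sum_range_succ, h1, ArithmeticFunction.moebius_apply_prime p.2]
    ring
  · intro k hk
    have hk2 : 2 ≤ k := not_lt.1 fun h => hk (Finset.mem_range.2 h)
    rw [ArithmeticFunction.moebius_apply_prime_pow p.2 (by omega), if_neg (by omega)]
    simp

lemma tsum_moebius_div_sq : ∑' e : ℕ, (ArithmeticFunction.moebius e : ℂ) / (e : ℂ) ^ 2 =
    6 / (π : ℂ) ^ 2 := by
  have h1 := LSeries_one_mul_Lseries_moebius (s := 2) (by norm_num)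
  rw [LSeries_one_eq_riemannZeta (by norm_num), riemannZeta_two] at h1
  have hπ : (π : ℂ) ≠ 0 := by exact_mod_cast Real.pi_ne_zero
  have h2 : LSeries (fun n => (ArithmeticFunction.moebius n : ℂ)) 2 =
      ∑' e : ℕ, (ArithmeticFunction.moebius e : ℂ) / (e : ℂ) ^ 2 := by
    rw [LSeries]
    refine tsum_congr fun e => ?_
    rcases eq_or_ne e 0 with rfl | h
    · simp
    · rw [LSeries.term_of_ne_zero h]
      norm_cast
  rw [← h2]
  field_simp at h1
  rw [eq_div_iff (by positivity), mul_comm]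
  exact h1

lemma tsum_moebius_div_sq_mul {q : ℕ} (hq : q ≠ 0) {h : ℕ → ℂ} (h1 : h 1 = 1)
    (hmul : ∀ {m n : ℕ}, Nat.Coprime m n → h (m * n) = h m * h n) {B : ℝ} (hB : ∀ n, ‖h n‖ ≤ B)
    (hp : ∀ p, p.Prime → ¬ p ∣ q → h p = 1) :
    ∑' e : ℕ, (ArithmeticFunction.moebius e : ℂ) / (e : ℂ) ^ 2 * h e =
      6 / (π : ℂ) ^ 2 * ∏ p ∈ q.primeFactors, (1 - h p / (p : ℂ) ^ 2) / (1 - 1 / (p : ℂ) ^ 2) := by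
  have e1 := hasProd_moebius_div_sq h1 hmul hB
  have e2 := hasProd_moebius_div_sq (h := fun _ => 1) rfl (by simp) (B := 1) (by simp)
  simp only [mul_one, tsum_moebius_div_sq] at e2
  set r : Nat.Primes → ℂ := fun p => (1 - h p / (p : ℂ) ^ 2) / (1 - 1 / (p : ℂ) ^ 2) with hr
  have hne : ∀ p : Nat.Primes, (1 - 1 / (p : ℂ) ^ 2) ≠ 0 := by
    intro p
    have := p.2.two_le
    rw [sub_ne_zero]
    intro hh
    have h0 : (p : ℂ) ^ 2 ≠ 0 := pow_ne_zero _ (Nat.cast_ne_zero.2 p.2.ne_zero)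
    rw [eq_div_iff h0, one_mul] at hh
    have : (p : ℕ) ^ 2 = 1 := by exact_mod_cast hh
    nlinarith
  have e3 : HasProd r (∏ p ∈ q.primeFactors.subtype Nat.Prime, r p) := by
    refine hasProd_prod_of_ne_finset_one fun p hpq => ?_
    have : ¬ (p : ℕ) ∣ q := fun hd => hpq
      (Finset.mem_subtype.2 (Nat.mem_primeFactors.2 ⟨p.2, hd, hq⟩))
    simp only [hr]
    rw [hp p p.2 this, div_self (hne p)]
  have e4 := e2.mul e3
  have e5 : (fun p : Nat.Primes => (1 - 1 / (p : ℂ) ^ 2) * r p) =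
      fun p : Nat.Primes => 1 - h p / (p : ℂ) ^ 2 := by
    funext p
    rw [hr, mul_div_cancel₀ _ (hne p)]
  rw [e5] at e4
  rw [e1.unique e4]
  congr 1
  exact Finset.prod_subtype_of_mem
    (fun p : ℕ => (1 - h p / (p : ℂ) ^ 2) / (1 - 1 / (p : ℂ) ^ 2)) fun p hp =>
      Nat.prime_of_mem_primeFactors hp

lemma tsum_moebius_mul_quadMean_stdAddChar (q : ℕ) [NeZero q] {u : ZMod q} (hu : IsUnit u) :
    ∑' e : ℕ, (ArithmeticFunction.moebius e : ℂ) / (e : ℂ) ^ 2 *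
      quadMean (fun r : ZMod q => (ZMod.stdAddChar (u * r) : ℂ)) e =
      1 / (4 * (π : ℂ) ^ 2 * q) * ∏ p ∈ q.primeFactors, (1 - 1 / ((p : ℂ) + 1)) := by
  have hq' : (q : ℂ) ≠ 0 := Nat.cast_ne_zero.2 (NeZero.ne q)
  have hπ : (π : ℂ) ≠ 0 := by exact_mod_cast Real.pi_ne_zero
  simp only [quadMean_stdAddChar q hu, ← mul_div_assoc]
  rw [tsum_div_const, tsum_moebius_div_sq_mul (NeZero.ne q) (h := fun e => (Nat.gcd e q : ℂ)) (by simp)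
    (fun {m n} hmn => by
      rw [Nat.gcd_comm, Nat.Coprime.gcd_mul _ hmn, Nat.gcd_comm q m, Nat.gcd_comm q n]; push_cast; rfl)
    (B := q) (fun n => by
      rw [Complex.norm_natCast]
      exact_mod_cast Nat.le_of_dvd (NeZero.pos q) (Nat.gcd_dvd_right n q))
    (fun p hp hpq => by
      exact_mod_cast congrArg (Nat.cast : ℕ → ℂ) ((Nat.Prime.coprime_iff_not_dvd hp).2 hpq))]
  have : ∀ p ∈ q.primeFactors, (1 - (Nat.gcd p q : ℂ) / (p : ℂ) ^ 2) / (1 - 1 / (p : ℂ) ^ 2) =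
      1 - 1 / ((p : ℂ) + 1) := by
    intro p hp
    rw [Nat.gcd_eq_left (Nat.dvd_of_mem_primeFactors hp)]
    have h2 := (Nat.prime_of_mem_primeFactors hp).two_le
    have h3 : (p : ℂ) ≠ 0 := by exact_mod_cast (by omega : p ≠ 0)
    have h4 : (p : ℂ) + 1 ≠ 0 := by exact_mod_cast (by omega : p + 1 ≠ 0)
    have h5 : (p : ℂ) - 1 ≠ 0 := by rw [sub_ne_zero]; exact_mod_cast (by omega : p ≠ 1)
    have h6 : (1 - 1 / (p : ℂ) ^ 2) = (p - 1) * (p + 1) / p ^ 2 := by field_simp; ring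
    rw [h6]
    field_simp
    ring
  rw [Finset.prod_congr rfl this]
  generalize ∏ p ∈ q.primeFactors, (1 - 1 / ((p : ℂ) + 1)) = P
  field_simp
  ring

lemma tsum_moebius_mul_quadMean_indicator (q : ℕ) [NeZero q] {u : ZMod q} (hu : IsUnit u) :
    (q : ℂ) ^ 2 * ∑' e : ℕ, (ArithmeticFunction.moebius e : ℂ) / (e : ℂ) ^ 2 *
      quadMean (fun r : ZMod q => if r = u then (1 : ℂ) else 0) e =
      1 / (4 * (π : ℂ) ^ 2 * q) * ∏ p ∈ q.primeFactors, (1 - 1 / ((p : ℂ) + 1)) := by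
  have hq' : (q : ℂ) ≠ 0 := Nat.cast_ne_zero.2 (NeZero.ne q)
  have hπ : (π : ℂ) ≠ 0 := by exact_mod_cast Real.pi_ne_zero
  simp only [quadMean_indicator q hu, ← mul_assoc]
  rw [tsum_mul_right, tsum_moebius_div_sq_mul (NeZero.ne q)
    (h := fun e => if Nat.Coprime e q then 1 else 0) (by simp)
    (fun {m n} hmn => by
      simp only [Nat.coprime_mul_iff_left, ite_and]
      split_ifs <;> simp)
    (B := 1) (fun n => by split_ifs <;> simp)
    (fun p hp hpq => if_pos ((Nat.Prime.coprime_iff_not_dvd hp).2 hpq))]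
  have ht : (Nat.totient q : ℂ) = q * ∏ p ∈ q.primeFactors, (1 - (p : ℂ)⁻¹) := by
    have := congrArg (Rat.cast : ℚ → ℂ) (Nat.totient_eq_mul_prod_factors q)
    push_cast at this
    exact this
  have : ∀ p ∈ q.primeFactors, (1 - (if Nat.Coprime p q then 1 else 0) / (p : ℂ) ^ 2) /
      (1 - 1 / (p : ℂ) ^ 2) * (1 - (p : ℂ)⁻¹) = 1 - 1 / ((p : ℂ) + 1) := by
    intro p hp
    have hnc : ¬ Nat.Coprime p q := fun h => (Nat.Prime.coprime_iff_not_dvd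
      (Nat.prime_of_mem_primeFactors hp)).1 h (Nat.dvd_of_mem_primeFactors hp)
    rw [if_neg hnc]
    have h2 := (Nat.prime_of_mem_primeFactors hp).two_le
    have h3 : (p : ℂ) ≠ 0 := by exact_mod_cast (by omega : p ≠ 0)
    have h4 : (p : ℂ) + 1 ≠ 0 := by exact_mod_cast (by omega : p + 1 ≠ 0)
    have h5 : (p : ℂ) - 1 ≠ 0 := by rw [sub_ne_zero]; exact_mod_cast (by omega : p ≠ 1)
    have h6 : (1 - 1 / (p : ℂ) ^ 2) = (p - 1) * (p + 1) / p ^ 2 := by field_simp; ring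
    rw [h6]
    field_simp
    ring
  rw [← Finset.prod_congr rfl this, Finset.prod_mul_distrib, ht]
  generalize ∏ p ∈ q.primeFactors, (1 - (if Nat.Coprime p q then 1 else 0) / (p : ℂ) ^ 2) /
      (1 - 1 / (p : ℂ) ^ 2) = P
  generalize ∏ p ∈ q.primeFactors, (1 - (p : ℂ)⁻¹) = R
  field_simp
  ring

lemma norm_integral_exp_mul_le {g : ℝ → ℂ} {T S L θ : ℝ} (hT : 0 ≤ T) (hL : 0 ≤ L)
    (hS : ∀ t ∈ Set.Icc T (2 * T), ‖g t‖ ≤ S)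
    (hg : ∀ t ∈ Set.Icc T (2 * T), ∀ t' ∈ Set.Icc T (2 * T), ‖g t - g t'‖ ≤ L * |t - t'|)
    (hθ : θ ≠ 0) :
    ‖∫ t in T..(2 * T), cexp (t * θ * I) * g t‖ ≤ π * (S + L * T) / |θ| := by
  have hS0 : 0 ≤ S := (norm_nonneg _).trans (hS T ⟨le_rfl, by linarith⟩)
  have hθ' : 0 < |θ| := abs_pos.2 hθ
  have hexp : ∀ t : ℝ, ‖cexp (t * θ * I)‖ = 1 := fun t => by
    rw [← Complex.ofReal_mul, Complex.norm_exp_ofReal_mul_I]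
  have hcont : ContinuousOn g (Set.Icc T (2 * T)) := by
    refine (LipschitzOnWith.of_dist_le_mul (K := L.toNNReal) fun x hx y hy => ?_).continuousOn
    rw [dist_eq_norm, Real.dist_eq, Real.coe_toNNReal _ hL]
    exact hg x hx y hy
  rcases le_or_gt (T * |θ|) π with h | h
  · refine (intervalIntegral.norm_integral_le_of_norm_le_const (C := S) fun t ht => ?_).trans ?_
    · rw [norm_mul, hexp, one_mul]
      rw [Set.uIoc_of_le (by linarith)] at ht
      exact hS t ⟨ht.1.le, ht.2⟩
    · rw [abs_of_nonneg (by linarith), le_div_iff₀ hθ']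
      have : 0 ≤ π * (L * T) := by positivity
      nlinarith [mul_le_mul_of_nonneg_left h hS0]
  · set h' := π / |θ| with hh
    have hh0 : 0 < h' := by positivity
    have hhT : h' ≤ T := by rw [hh, div_le_iff₀ hθ']; exact h.le
    have hshift : ∀ t : ℝ, cexp ((t + h' : ℝ) * θ * I) = - cexp (t * θ * I) := by
      intro t
      have e1 : h' * θ = π ∨ h' * θ = -π := by
        rcases lt_or_gt_of_ne hθ with h0 | h0
        · right
          rw [hh, abs_of_neg h0]
          field_simp
        · left
          rw [hh, abs_of_pos h0]
          field_simp
      have e2 : cexp (((h' * θ : ℝ) : ℂ) * I) = -1 := by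
        rcases e1 with e | e <;> rw [e]
        · exact Complex.exp_pi_mul_I
        · rw [Complex.ofReal_neg, neg_mul, Complex.exp_neg, Complex.exp_pi_mul_I]
          norm_num
      rw [show ((t + h' : ℝ) : ℂ) * θ * I = t * θ * I + ((h' * θ : ℝ) : ℂ) * I by push_cast; ring,
        Complex.exp_add, e2]
      ring
    have hF : ContinuousOn (fun t : ℝ => cexp (t * θ * I) * g t) (Set.Icc T (2 * T)) :=
      (Continuous.continuousOn (by fun_prop)).mul hcont
    have hG : ContinuousOn (fun t : ℝ => cexp (t * θ * I) * g (t - h'))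
        (Set.Icc (T + h') (2 * T + h')) :=
      (Continuous.continuousOn (by fun_prop)).mul (hcont.comp (by fun_prop) fun t ht =>
        ⟨by linarith [ht.1], by linarith [ht.2]⟩)
    have i1 : IntervalIntegrable (fun t : ℝ => cexp (t * θ * I) * g t) volume T (T + h') :=
      (hF.mono (Set.Icc_subset_Icc le_rfl (by linarith))).intervalIntegrable_of_Icc (by linarith)
    have i2 : IntervalIntegrable (fun t : ℝ => cexp (t * θ * I) * g t) volume (T + h') (2 * T) :=
      (hF.mono (Set.Icc_subset_Icc (by linarith) le_rfl)).intervalIntegrable_of_Icc (by linarith)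
    have i3 : IntervalIntegrable (fun t : ℝ => cexp (t * θ * I) * g (t - h')) volume (T + h')
        (2 * T) :=
      (hG.mono (Set.Icc_subset_Icc le_rfl (by linarith))).intervalIntegrable_of_Icc (by linarith)
    have i4 : IntervalIntegrable (fun t : ℝ => cexp (t * θ * I) * g (t - h')) volume (2 * T)
        (2 * T + h') :=
      (hG.mono (Set.Icc_subset_Icc (by linarith) le_rfl)).intervalIntegrable_of_Icc (by linarith)
    have e1 : (∫ t in T..(2 * T), cexp (t * θ * I) * g t) =
        -∫ t in (T + h')..(2 * T + h'), cexp (t * θ * I) * g (t - h') := by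
      rw [← intervalIntegral.integral_comp_add_right
        (fun t : ℝ => cexp (t * θ * I) * g (t - h')) h', ← intervalIntegral.integral_neg]
      refine intervalIntegral.integral_congr fun t _ => ?_
      simp only [hshift, add_sub_cancel_right]
      ring
    have e2 : 2 * (∫ t in T..(2 * T), cexp (t * θ * I) * g t) =
        (∫ t in T..(T + h'), cexp (t * θ * I) * g t) +
        (∫ t in (T + h')..(2 * T), (cexp (t * θ * I) * g t - cexp (t * θ * I) * g (t - h'))) -
        (∫ t in (2 * T)..(2 * T + h'), cexp (t * θ * I) * g (t - h')) := by
      rw [intervalIntegral.integral_sub i2 i3, two_mul]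
      nth_rewrite 2 [e1]
      rw [← intervalIntegral.integral_add_adjacent_intervals i1 i2,
        ← intervalIntegral.integral_add_adjacent_intervals i3 i4]
      ring
    have b1 : ‖∫ t in T..(T + h'), cexp (t * θ * I) * g t‖ ≤ S * h' := by
      refine (intervalIntegral.norm_integral_le_of_norm_le_const (C := S) fun t ht => ?_).trans ?_
      · rw [norm_mul, hexp, one_mul]
        rw [Set.uIoc_of_le (by linarith)] at ht
        exact hS t ⟨ht.1.le, by linarith [ht.2]⟩
      · rw [add_sub_cancel_left, abs_of_pos hh0]
    have b2 : ‖∫ t in (T + h')..(2 * T), (cexp (t * θ * I) * g t -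
        cexp (t * θ * I) * g (t - h'))‖ ≤ L * h' * T := by
      refine (intervalIntegral.norm_integral_le_of_norm_le_const (C := L * h') fun t ht => ?_).trans ?_
      · rw [← mul_sub, norm_mul, hexp, one_mul]
        rw [Set.uIoc_of_le (by linarith)] at ht
        refine (hg t ⟨by linarith [ht.1], ht.2⟩ (t - h') ⟨by linarith [ht.1],
          by linarith [ht.2]⟩).trans (le_of_eq ?_)
        rw [sub_sub_cancel, abs_of_pos hh0]
      · rw [abs_of_nonneg (by linarith)]
        gcongr
        linarith
    have b3 : ‖∫ t in (2 * T)..(2 * T + h'), cexp (t * θ * I) * g (t - h')‖ ≤ S * h' := by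
      refine (intervalIntegral.norm_integral_le_of_norm_le_const (C := S) fun t ht => ?_).trans ?_
      · rw [norm_mul, hexp, one_mul]
        rw [Set.uIoc_of_le (by linarith)] at ht
        exact hS _ ⟨by linarith [ht.1], by linarith [ht.2]⟩
      · rw [add_sub_cancel_left, abs_of_pos hh0]
    have b4 : 2 * ‖∫ t in T..(2 * T), cexp (t * θ * I) * g t‖ ≤ S * h' + L * h' * T + S * h' := by
      have := congrArg norm e2
      rw [norm_mul, Complex.norm_ofNat] at this
      rw [this]
      exact (norm_sub_le _ _).trans (add_le_add ((norm_add_le _ _).trans (add_le_add b1 b2)) b3)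
    have e3 : π * (S + L * T) / |θ| = (S + L * T) * h' := by rw [hh]; ring
    rw [e3]
    have : 0 ≤ L * h' * T := by positivity
    nlinarith

/-- The weight of an off-diagonal pair. -/
noncomputable def offDiagWeight (T : ℝ) (m n : ℕ) : ℝ :=
  if m = n then 0 else
    #m.divisors * #n.divisors * (1 / √(m * n) * min 1 (T ^ 2 / (m * n))) / |Real.log (n / m)|

lemma offDiagWeight_comm (T : ℝ) (m n : ℕ) : offDiagWeight T m n = offDiagWeight T n m := by
  rw [offDiagWeight, offDiagWeight]
  by_cases h : m = n
  · rw [if_pos h, if_pos h.symm]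
  · rw [if_neg h, if_neg (Ne.symm h), ← abs_neg (Real.log (n / m)), ← Real.log_inv, inv_div,
      mul_comm (m : ℝ) n, mul_comm (#m.divisors : ℝ)]

/-- A majorant for the off-diagonal pairs with `n < m ≤ 2 n`. -/
noncomputable def nearWeight (T : ℝ) (m n : ℕ) : ℝ :=
  if n < m ∧ m ≤ 2 * n then
    2 * (#n.divisors * #m.divisors * (1 / ((m - n : ℕ) : ℝ)) * min 1 ((T / n) ^ 2)) else 0

lemma nearWeight_nonneg (T : ℝ) (m n : ℕ) : 0 ≤ nearWeight T m n := by
  unfold nearWeight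
  split_ifs <;> positivity

lemma offDiagWeight_le_of_lt {T : ℝ} {m n : ℕ} (hn : 1 ≤ n) (hmn : n < m) :
    offDiagWeight T m n ≤
      2 * (#m.divisors * #n.divisors * (1 / √(m * n) * min 1 (T ^ 2 / (m * n)))) +
      nearWeight T m n := by
  have hn0 : (0 : ℝ) < n := by exact_mod_cast hn
  have hm0 : (0 : ℝ) < m := by exact_mod_cast (by omega : 0 < m)
  have hmn' : (n : ℝ) < m := by exact_mod_cast hmn
  rw [offDiagWeight, if_neg hmn.ne', ← abs_neg, ← Real.log_inv, inv_div]
  have hlb : 1 - n / m ≤ Real.log (m / n) := by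
    have := Real.one_sub_inv_le_log_of_pos (div_pos hm0 hn0)
    rwa [inv_div] at this
  have hpos : 0 < 1 - (n : ℝ) / m := by
    rw [sub_pos, div_lt_one hm0]
    exact hmn'
  rw [abs_of_pos (by linarith)]
  set P := (#m.divisors : ℝ) * #n.divisors * (1 / √(m * n) * min 1 (T ^ 2 / (m * n))) with hP
  have hP0 : 0 ≤ P := by positivity
  have hdiv : P / Real.log (m / n) ≤ P / (1 - n / m) := div_le_div_of_nonneg_left hP0 hpos hlb
  by_cases h : m ≤ 2 * n
  · have hle : P / (1 - n / m) ≤ nearWeight T m n := by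
      rw [nearWeight, if_pos ⟨hmn, h⟩, div_le_iff₀ hpos, Nat.cast_sub hmn.le]
      have hsqrt : 1 / √((m : ℝ) * n) ≤ 1 / n := by
        refine one_div_le_one_div_of_le hn0 (Real.le_sqrt_of_sq_le ?_)
        nlinarith
      have hmin : min 1 (T ^ 2 / ((m : ℝ) * n)) ≤ min 1 ((T / n) ^ 2) := by
        refine min_le_min le_rfl ?_
        rw [div_pow]
        refine div_le_div_of_nonneg_left (by positivity) (by positivity) ?_
        nlinarith
      have h2 : (m : ℝ) ≤ 2 * n := by exact_mod_cast h
      have hd : 0 < (m : ℝ) - n := by linarith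
      have e1 : 2 * ((#n.divisors : ℝ) * #m.divisors * (1 / ((m : ℝ) - n)) * min 1 ((T / n) ^ 2)) *
          (1 - n / m) = (#m.divisors : ℝ) * #n.divisors * (2 / m * min 1 ((T / n) ^ 2)) := by
        field_simp
      rw [e1, hP]
      have h3 : 1 / √((m : ℝ) * n) ≤ 2 / m := hsqrt.trans (by
        rw [div_le_div_iff₀ hn0 hm0]
        linarith)
      gcongr
    linarith
  · have h2 : 2 * (n : ℝ) ≤ m := by exact_mod_cast (by omega : 2 * n ≤ m)
    have : P / (1 - n / m) ≤ 2 * P := by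
      rw [div_le_iff₀ hpos]
      have : (n : ℝ) / m ≤ 1 / 2 := by
        rw [div_le_div_iff₀ hm0 two_pos]
        linarith
      nlinarith
    linarith [nearWeight_nonneg T m n]

lemma offDiagWeight_le {T : ℝ} {m n : ℕ} (hm : 1 ≤ m) (hn : 1 ≤ n) :
    offDiagWeight T m n ≤
      2 * (#m.divisors * #n.divisors * (1 / √(m * n) * min 1 (T ^ 2 / (m * n)))) +
      (nearWeight T m n + nearWeight T n m) := by
  have h1 := nearWeight_nonneg T m n
  have h2 := nearWeight_nonneg T n m
  rcases lt_trichotomy m n with h | rfl | h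
  · rw [offDiagWeight_comm, mul_comm (m : ℝ) n, mul_comm (#m.divisors : ℝ)]
    linarith [offDiagWeight_le_of_lt (T := T) hm h]
  · rw [offDiagWeight, if_pos rfl]
    positivity
  · linarith [offDiagWeight_le_of_lt (T := T) hn h]

lemma sum_nearWeight_le (T : ℝ) (N : ℕ) :
    ∑ n ∈ Icc 1 N, ∑ m ∈ Icc 1 N, nearWeight T m n ≤
      2 * ∑ n ∈ Icc 1 N, ∑ h ∈ Icc 1 n,
        (#n.divisors * #(n + h).divisors * (1 / (h : ℝ)) * min 1 ((T / n) ^ 2)) := by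
  rw [Finset.mul_sum]
  refine Finset.sum_le_sum fun n _ => ?_
  rw [Finset.mul_sum]
  have : ∑ h ∈ Icc 1 n, 2 * (#n.divisors * #(n + h).divisors * (1 / (h : ℝ)) *
      min 1 ((T / n) ^ 2)) = ∑ m ∈ Icc (n + 1) (2 * n), nearWeight T m n := by
    refine Finset.sum_nbij' (fun h => n + h) (fun m => m - n) ?_ ?_ ?_ ?_ ?_
    · intro h hh
      simp only [Finset.mem_Icc] at hh ⊢
      omega
    · intro h hh
      simp only [Finset.mem_Icc] at hh ⊢
      omega
    · intro h hh
      simp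
    · intro h hh
      simp only [Finset.mem_Icc] at hh
      omega
    · intro h hh
      simp only [Finset.mem_Icc] at hh
      rw [nearWeight, if_pos ⟨by omega, by omega⟩, Nat.add_sub_cancel_left]
  rw [this, ← Finset.sum_filter_add_sum_filter_not (Icc 1 N) (fun m => n < m ∧ m ≤ 2 * n)]
  have h0 : ∑ m ∈ Icc 1 N with ¬(n < m ∧ m ≤ 2 * n), nearWeight T m n = 0 :=
    Finset.sum_eq_zero fun m hm => if_neg (Finset.mem_filter.1 hm).2
  rw [h0, add_zero]
  refine Finset.sum_le_sum_of_subset_of_nonneg (fun m hm => ?_) fun _ _ _ => nearWeight_nonneg _ _ _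
  simp only [Finset.mem_filter, Finset.mem_Icc] at hm ⊢
  omega

lemma exists_sum_offDiagWeight_le : ∃ C : ℝ, 0 ≤ C ∧ ∀ T : ℝ, 1 ≤ T → ∀ N : ℕ,
    ∑ m ∈ Icc 1 N, ∑ n ∈ Icc 1 N, offDiagWeight T m n ≤ C * T * (1 + Real.log T) ^ 3 := by
  obtain ⟨C, hC0, hC⟩ := sum_card_divisors_shift_le
  refine ⟨640 + 4 * C, by positivity, fun T hT N => ?_⟩
  have hL := Real.log_nonneg hT
  have h1 : ∑ m ∈ Icc 1 N, ∑ n ∈ Icc 1 N, offDiagWeight T m n ≤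
      ∑ m ∈ Icc 1 N, ∑ n ∈ Icc 1 N,
        (2 * (#m.divisors * #n.divisors * (1 / √(m * n) * min 1 (T ^ 2 / (m * n)))) +
      (nearWeight T m n + nearWeight T n m)) :=
    Finset.sum_le_sum fun m hm => Finset.sum_le_sum fun n hn =>
      offDiagWeight_le (Finset.mem_Icc.1 hm).1 (Finset.mem_Icc.1 hn).1
  have h2 := sum_card_divisors_mul_card_divisors_le hT N
  have h3 := (sum_nearWeight_le T N).trans (mul_le_mul_of_nonneg_left (hC T hT N) zero_le_two)
  simp only [Finset.sum_add_distrib, ← Finset.mul_sum] at h1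
  rw [Finset.sum_comm (f := fun m n => nearWeight T m n)] at h1
  have h4 : (4 + 2 * Real.log T) ^ 3 ≤ 64 * (1 + Real.log T) ^ 3 := by
    have : (4 + 2 * Real.log T) ^ 3 ≤ (4 * (1 + Real.log T)) ^ 3 := by gcongr; linarith
    linarith [mul_pow 4 (1 + Real.log T) 3]
  have h5 : 5 * T * (4 + 2 * Real.log T) ^ 3 ≤ 5 * T * (64 * (1 + Real.log T) ^ 3) := by gcongr
  linarith

/-- Weights `V t x` of size `min 1 (T² / x)`, slowly varying in `t ∈ [T, 2T]`, with
`V t (n²)` close to `1` for `n ≤ T`. -/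
structure IsMVWeight (A T : ℝ) (V : ℝ → ℝ → ℂ) : Prop where
  norm_le : ∀ t ∈ Set.Icc T (2 * T), ∀ x : ℝ, 1 ≤ x → ‖V t x‖ ≤ A * min 1 (T ^ 2 / x)
  norm_sub_le : ∀ t ∈ Set.Icc T (2 * T), ∀ t' ∈ Set.Icc T (2 * T), ∀ x : ℝ, 1 ≤ x →
    ‖V t x - V t' x‖ ≤ A / T * min 1 (T ^ 2 / x) * |t - t'|
  norm_sub_one_le : ∀ t ∈ Set.Icc T (2 * T), ∀ n : ℕ, 1 ≤ n →
    ‖V t ((n : ℝ) * n) - 1‖ ≤ A * (n / T)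

/-- The `(m, n)` term of a weighted mean square of a Dirichlet series with coefficients `b`. -/
noncomputable def mvTerm (b : ℕ → ℂ) (V : ℝ → ℝ → ℂ) (t : ℝ) (z : ℕ × ℕ) : ℂ :=
  b z.1 * starRingEnd ℂ (b z.2) * ((1 / √((z.1 : ℝ) * z.2) : ℝ) : ℂ) *
    (cexp (t * (Real.log ((z.2 : ℝ) / z.1) : ℝ) * I) * V t ((z.1 : ℝ) * z.2))

lemma summable_card_divisors_div :
    Summable fun n : ℕ => (#n.divisors : ℝ) * (1 / (n * √(n : ℝ))) := by
  refine summable_of_sum_range_le (c := 9) (fun n => by positivity) fun N => ?_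
  have h1 : ∑ n ∈ range N, (#n.divisors : ℝ) * (1 / (n * √(n : ℝ))) ≤
      ∑ n ∈ Icc 1 N, (#n.divisors : ℝ) * (1 / (n * √(n : ℝ))) := by
    rw [← Finset.sum_subset (s₁ := (range N).filter (fun n => n ≠ 0)) (Finset.filter_subset _ _)]
    · refine Finset.sum_le_sum_of_subset_of_nonneg (fun n hn => ?_) fun n _ _ => by positivity
      simp only [mem_filter, mem_range, mem_Icc] at hn ⊢
      omega
    · intro n hn hn'
      simp only [mem_filter, mem_range, not_and, not_not] at hn hn'
      rw [hn' hn]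
      simp
  refine h1.trans ((sum_card_divisors_mul_le (w := fun n => 1 / (n * √(n : ℝ)))
    (fun n => by positivity) N).trans ?_)
  have h2 : ∀ a b : ℕ, (1 : ℝ) / ((a * b : ℕ) * √((a * b : ℕ) : ℝ)) =
      1 / (a * √(a : ℝ)) * (1 / (b * √(b : ℝ))) := fun a b => by
    push_cast
    rw [Real.sqrt_mul (Nat.cast_nonneg a), one_div_mul_one_div]
    ring_nf
  simp only [h2]
  rw [← Finset.sum_mul_sum]
  have h3 := sum_Icc_inv_mul_sqrt_le N
  have h4 : 0 ≤ ∑ n ∈ Icc 1 N, 1 / ((n : ℝ) * √(n : ℝ)) := Finset.sum_nonneg fun n _ => by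
    positivity
  nlinarith

section MeanValue

variable {A T : ℝ} {V : ℝ → ℝ → ℂ} {b : ℕ → ℂ}

lemma IsMVWeight.continuousOn (hV : IsMVWeight A T V) (hA : 0 ≤ A) (hT : 0 < T) {x : ℝ}
    (hx : 1 ≤ x) : ContinuousOn (fun t => V t x) (Set.Icc T (2 * T)) := by
  have h0 : 0 ≤ A / T * min 1 (T ^ 2 / x) := by positivity
  refine (LipschitzOnWith.of_dist_le_mul (K := (A / T * min 1 (T ^ 2 / x)).toNNReal)
    fun t ht t' ht' => ?_).continuousOn
  rw [dist_eq_norm, Real.dist_eq, Real.coe_toNNReal _ h0]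
  exact hV.norm_sub_le t ht t' ht' x hx

lemma mvTerm_eq_zero (hb : ∀ n, ‖b n‖ ≤ #n.divisors) {z : ℕ × ℕ} (hz : z.1 = 0 ∨ z.2 = 0)
    (t : ℝ) : mvTerm b V t z = 0 := by
  have h0 : b 0 = 0 := by simpa using hb 0
  rcases hz with h | h <;> simp [mvTerm, h, h0]

lemma IsMVWeight.continuousOn_mvTerm (hV : IsMVWeight A T V) (hA : 0 ≤ A) (hT : 0 < T)
    (hb : ∀ n, ‖b n‖ ≤ #n.divisors) (z : ℕ × ℕ) :
    ContinuousOn (fun t => mvTerm b V t z) (Set.Icc T (2 * T)) := by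
  by_cases hz : z.1 = 0 ∨ z.2 = 0
  · simp only [mvTerm_eq_zero hb hz]
    exact continuousOn_const
  · push Not at hz
    have hx : (1 : ℝ) ≤ (z.1 : ℝ) * z.2 := by
      exact_mod_cast Nat.mul_pos (Nat.pos_of_ne_zero hz.1) (Nat.pos_of_ne_zero hz.2)
    unfold mvTerm
    exact continuousOn_const.mul ((Continuous.continuousOn (by fun_prop)).mul
      (hV.continuousOn hA hT hx))

lemma IsMVWeight.norm_mvTerm_le (hV : IsMVWeight A T V) (hA : 0 ≤ A)
    (hb : ∀ n, ‖b n‖ ≤ #n.divisors) {t : ℝ} (ht : t ∈ Set.Icc T (2 * T)) (z : ℕ × ℕ) :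
    ‖mvTerm b V t z‖ ≤ A * T ^ 2 * ((#z.1.divisors : ℝ) * (1 / (z.1 * √(z.1 : ℝ))) *
      ((#z.2.divisors : ℝ) * (1 / (z.2 * √(z.2 : ℝ))))) := by
  by_cases hz : z.1 = 0 ∨ z.2 = 0
  · rw [mvTerm_eq_zero hb hz, norm_zero]
    positivity
  · push Not at hz
    have hx : (1 : ℝ) ≤ (z.1 : ℝ) * z.2 := by
      exact_mod_cast Nat.mul_pos (Nat.pos_of_ne_zero hz.1) (Nat.pos_of_ne_zero hz.2)
    have h1 := (hV.norm_le t ht _ hx).trans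
      (mul_le_mul_of_nonneg_left (min_le_right _ _) hA)
    unfold mvTerm
    rw [norm_mul, norm_mul, norm_mul, norm_mul, RCLike.norm_conj, Complex.norm_real,
      Real.norm_of_nonneg (by positivity), ← Complex.ofReal_mul, Complex.norm_exp_ofReal_mul_I,
      one_mul]
    calc ‖b z.1‖ * ‖b z.2‖ * (1 / √((z.1 : ℝ) * z.2)) * ‖V t ((z.1 : ℝ) * z.2)‖
        ≤ #z.1.divisors * #z.2.divisors * (1 / √((z.1 : ℝ) * z.2)) *
            (A * (T ^ 2 / ((z.1 : ℝ) * z.2))) := by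
          gcongr
          · exact hb _
          · exact hb _
      _ = _ := by
          rw [Real.sqrt_mul (Nat.cast_nonneg _)]
          have : (z.1 : ℝ) ≠ 0 := by exact_mod_cast hz.1
          have : (z.2 : ℝ) ≠ 0 := by exact_mod_cast hz.2
          field_simp

lemma summable_card_divisors_mul_div :
    Summable fun z : ℕ × ℕ => (#z.1.divisors : ℝ) * (1 / (z.1 * √(z.1 : ℝ))) *
      ((#z.2.divisors : ℝ) * (1 / (z.2 * √(z.2 : ℝ)))) :=
  summable_card_divisors_div.mul_of_nonneg summable_card_divisors_div
    (fun n => by positivity) fun n => by positivity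

lemma IsMVWeight.summable_mvTerm (hV : IsMVWeight A T V) (hA : 0 ≤ A)
    (hb : ∀ n, ‖b n‖ ≤ #n.divisors) {t : ℝ} (ht : t ∈ Set.Icc T (2 * T)) :
    Summable (mvTerm b V t) :=
  Summable.of_norm_bounded (summable_card_divisors_mul_div.mul_left _)
    (hV.norm_mvTerm_le hA hb ht)

lemma IsMVWeight.hasSum_integral (hV : IsMVWeight A T V) (hA : 0 ≤ A) (hT : 0 < T)
    (hb : ∀ n, ‖b n‖ ≤ #n.divisors) :
    HasSum (fun z => ∫ t in T..(2 * T), mvTerm b V t z)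
      (∫ t in T..(2 * T), ∑' z, mvTerm b V t z) := by
  have hI : Set.uIoc T (2 * T) = Set.Ioc T (2 * T) := Set.uIoc_of_le (by linarith)
  refine intervalIntegral.hasSum_integral_of_dominated_convergence
    (fun z _ => A * T ^ 2 * ((#z.1.divisors : ℝ) * (1 / (z.1 * √(z.1 : ℝ))) *
      ((#z.2.divisors : ℝ) * (1 / (z.2 * √(z.2 : ℝ)))))) (fun z => ?_) (fun z => ?_) ?_ ?_ ?_
  · rw [hI]
    exact ((hV.continuousOn_mvTerm hA hT hb z).mono Set.Ioc_subset_Icc_self).aestronglyMeasurable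
      measurableSet_Ioc
  · refine Eventually.of_forall fun t ht => ?_
    rw [hI] at ht
    exact hV.norm_mvTerm_le hA hb (Set.Ioc_subset_Icc_self ht) z
  · exact Eventually.of_forall fun t _ => summable_card_divisors_mul_div.mul_left _
  · exact intervalIntegrable_const
  · refine Eventually.of_forall fun t ht => ?_
    rw [hI] at ht
    exact (hV.summable_mvTerm hA hb (Set.Ioc_subset_Icc_self ht)).hasSum

lemma IsMVWeight.continuousOn_tsum (hV : IsMVWeight A T V) (hA : 0 ≤ A) (hT : 0 < T)
    (hb : ∀ n, ‖b n‖ ≤ #n.divisors) :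
    ContinuousOn (fun t => ∑' z, mvTerm b V t z) (Set.Icc T (2 * T)) :=
  _root_.continuousOn_tsum (fun z => hV.continuousOn_mvTerm hA hT hb z)
    (summable_card_divisors_mul_div.mul_left _) fun z _ ht => hV.norm_mvTerm_le hA hb ht z

lemma IsMVWeight.norm_integral_mvTerm_le (hV : IsMVWeight A T V) (hA : 0 ≤ A) (hT : 0 < T)
    (hb : ∀ n, ‖b n‖ ≤ #n.divisors) {m n : ℕ} (hm : 1 ≤ m) (hn : 1 ≤ n) (hmn : m ≠ n) :
    ‖∫ t in T..(2 * T), mvTerm b V t (m, n)‖ ≤ 2 * π * A * offDiagWeight T m n := by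
  have hx : (1 : ℝ) ≤ (m : ℝ) * n := by exact_mod_cast Nat.mul_pos hm hn
  have hm' : (0 : ℝ) < m := by exact_mod_cast hm
  have hn' : (0 : ℝ) < n := by exact_mod_cast hn
  have hlog : Real.log ((n : ℝ) / m) ≠ 0 := by
    refine Real.log_ne_zero_of_pos_of_ne_one (by positivity) fun h => ?_
    rw [div_eq_one_iff_eq hm'.ne'] at h
    exact hmn (by exact_mod_cast h.symm)
  have hlog' : 0 < |Real.log ((n : ℝ) / m)| := abs_pos.2 hlog
  unfold mvTerm
  dsimp only
  rw [intervalIntegral.integral_const_mul, norm_mul]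
  have h1 := norm_integral_exp_mul_le (g := fun t => V t ((m : ℝ) * n)) (T := T)
    (S := A * min 1 (T ^ 2 / ((m : ℝ) * n))) (L := A / T * min 1 (T ^ 2 / ((m : ℝ) * n)))
    hT.le (by positivity) (fun t ht => hV.norm_le t ht _ hx)
    (fun t ht t' ht' => hV.norm_sub_le t ht t' ht' _ hx) hlog
  rw [norm_mul, norm_mul, RCLike.norm_conj, Complex.norm_real, Real.norm_of_nonneg (by positivity)]
  calc ‖b m‖ * ‖b n‖ * (1 / √((m : ℝ) * n)) *
        ‖∫ t in T..(2 * T), cexp (t * (Real.log ((n : ℝ) / m) : ℝ) * I) * V t ((m : ℝ) * n)‖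
      ≤ #m.divisors * #n.divisors * (1 / √((m : ℝ) * n)) *
        (π * (A * min 1 (T ^ 2 / ((m : ℝ) * n)) + A / T * min 1 (T ^ 2 / ((m : ℝ) * n)) * T) /
          |Real.log ((n : ℝ) / m)|) := by
        gcongr
        · exact hb _
        · exact hb _
    _ = _ := by
        rw [offDiagWeight, if_neg hmn]
        field_simp
        ring

lemma IsMVWeight.norm_integral_mvTerm_self_le (hV : IsMVWeight A T V) (hA : 0 ≤ A) (hT : 0 < T)
    (hb : ∀ n, ‖b n‖ ≤ #n.divisors) {n : ℕ} (hn : 1 ≤ n) :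
    ‖(∫ t in T..(2 * T), mvTerm b V t (n, n)) -
      (if (n : ℝ) ≤ T then T * (1 / (n : ℂ) * (b n * starRingEnd ℂ (b n))) else 0)‖ ≤
      A * T * ((#n.divisors : ℝ) ^ 2 * (1 / n * min (n / T) ((T / n) ^ 2))) := by
  have hn' : (0 : ℝ) < n := by exact_mod_cast hn
  have hx : (1 : ℝ) ≤ (n : ℝ) * n := by exact_mod_cast Nat.mul_pos hn hn
  have h0 : ∀ t, mvTerm b V t (n, n) = (1 / (n : ℂ) * (b n * starRingEnd ℂ (b n))) *
      V t ((n : ℝ) * n) := by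
    intro t
    unfold mvTerm
    dsimp only
    rw [div_self hn'.ne', Real.log_one, Real.sqrt_mul_self hn'.le]
    push_cast
    simp only [mul_zero, zero_mul, Complex.exp_zero, one_mul]
    ring
  simp only [h0]
  rw [intervalIntegral.integral_const_mul]
  have hc : ‖1 / (n : ℂ) * (b n * starRingEnd ℂ (b n))‖ ≤ (#n.divisors : ℝ) ^ 2 * (1 / n) := by
    rw [norm_mul, norm_mul, RCLike.norm_conj, norm_div, norm_one, Complex.norm_natCast]
    have := hb n
    have h2 : ‖b n‖ * ‖b n‖ ≤ (#n.divisors : ℝ) ^ 2 := by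
      rw [sq]; gcongr
    rw [mul_comm]
    gcongr
  have hlen : |2 * T - T| = T := by rw [abs_of_nonneg] <;> linarith
  have hI : Set.uIoc T (2 * T) = Set.Ioc T (2 * T) := Set.uIoc_of_le (by linarith)
  split_ifs with h
  · have h1 : (∫ t in T..(2 * T), V t ((n : ℝ) * n)) - T =
        ∫ t in T..(2 * T), (V t ((n : ℝ) * n) - 1) := by
      rw [intervalIntegral.integral_sub ((hV.continuousOn hA hT hx).intervalIntegrable_of_Icc
        (by linarith)) intervalIntegrable_const]
      simp
      ring
    rw [mul_comm (T : ℂ), ← mul_sub, h1, norm_mul]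
    have h2 : ‖∫ t in T..(2 * T), (V t ((n : ℝ) * n) - 1)‖ ≤ A * (n / T) * |2 * T - T| :=
      intervalIntegral.norm_integral_le_of_norm_le_const fun t ht => by
        rw [hI] at ht
        exact hV.norm_sub_one_le t (Set.Ioc_subset_Icc_self ht) n hn
    rw [hlen] at h2
    have h3 : min ((n : ℝ) / T) ((T / n) ^ 2) = n / T := by
      refine min_eq_left ?_
      have h4 : (n : ℝ) / T ≤ 1 := (div_le_one hT).2 h
      have h5 : 1 ≤ T / n := (one_le_div hn').2 h
      nlinarith
    rw [h3]
    calc _ ≤ (#n.divisors : ℝ) ^ 2 * (1 / n) * (A * (n / T) * T) := by gcongr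
      _ = _ := by ring
  · push Not at h
    rw [sub_zero, norm_mul]
    have h2 : ‖∫ t in T..(2 * T), V t ((n : ℝ) * n)‖ ≤ A * ((T / n) ^ 2) * |2 * T - T| :=
      intervalIntegral.norm_integral_le_of_norm_le_const fun t ht => by
        rw [hI] at ht
        refine (hV.norm_le t (Set.Ioc_subset_Icc_self ht) _ hx).trans ?_
        refine (mul_le_mul_of_nonneg_left (min_le_right _ _) hA).trans_eq ?_
        rw [div_pow, sq (n : ℝ)]
    rw [hlen] at h2
    have h3 : min ((n : ℝ) / T) ((T / n) ^ 2) = (T / n) ^ 2 := by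
      refine min_eq_right ?_
      have h4 : 1 ≤ (n : ℝ) / T := (one_le_div hT).2 h.le
      have h5 : T / n ≤ 1 := (div_le_one hn').2 h.le
      have h6 : 0 ≤ T / n := by positivity
      nlinarith
    rw [h3]
    calc _ ≤ (#n.divisors : ℝ) ^ 2 * (1 / n) * (A * (T / n) ^ 2 * T) := by gcongr
      _ = _ := by ring

end MeanValue

theorem exists_norm_integral_tsum_mvTerm_sub_le {A : ℝ} (hA : 0 ≤ A) :
    ∃ C : ℝ, 0 ≤ C ∧ ∀ T : ℝ, 1 ≤ T → ∀ (V : ℝ → ℝ → ℂ) (b : ℕ → ℂ), IsMVWeight A T V →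
      (∀ n, ‖b n‖ ≤ #n.divisors) →
      ‖(∫ t in T..(2 * T), ∑' z, mvTerm b V t z) -
        T * ∑ n ∈ Icc 1 ⌊T⌋₊, 1 / (n : ℂ) * (b n * starRingEnd ℂ (b n))‖ ≤
      C * T * (1 + Real.log T) ^ 3 := by
  obtain ⟨C₁, hC₁, h₁⟩ := exists_sum_offDiagWeight_le
  refine ⟨256 * A + 2 * π * A * C₁, by positivity, fun T hT V b hV hb => ?_⟩
  have hT0 : 0 < T := by linarith
  have hlog : 0 ≤ Real.log T := Real.log_nonneg hT
  have hlim : Tendsto (fun N : ℕ => ∑ z ∈ range (N + 1) ×ˢ range (N + 1),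
      ∫ t in T..(2 * T), mvTerm b V t z) atTop (nhds (∫ t in T..(2 * T), ∑' z, mvTerm b V t z)) := by
    have h1 : Tendsto (fun N : ℕ => range (N + 1) ×ˢ range (N + 1)) atTop
        (atTop : Filter (Finset (ℕ × ℕ))) := by
      refine tendsto_atTop_finset_of_monotone (fun a b hab => ?_) fun z => ⟨max z.1 z.2, ?_⟩
      · exact Finset.product_subset_product (Finset.range_mono (by omega))
          (Finset.range_mono (by omega))
      · simp only [mem_product, mem_range]
        omega
    exact (hV.hasSum_integral hA hT0 hb).comp h1
  refine le_of_tendsto ((hlim.sub_const _).norm) ?_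
  filter_upwards [eventually_ge_atTop ⌊T⌋₊] with N hN
  have hbox : ∑ z ∈ range (N + 1) ×ˢ range (N + 1), ∫ t in T..(2 * T), mvTerm b V t z =
      ∑ m ∈ Icc 1 N, ∑ n ∈ Icc 1 N, ∫ t in T..(2 * T), mvTerm b V t (m, n) := by
    rw [← Finset.sum_product', ]
    refine (Finset.sum_subset (fun z hz => ?_) fun z _ hz => ?_).symm
    · simp only [mem_product, mem_range, mem_Icc] at hz ⊢
      omega
    · have : z.1 = 0 ∨ z.2 = 0 := by
        simp only [mem_product, mem_range, mem_Icc] at *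
        omega
      simp [mvTerm_eq_zero hb this]
  have hdiag : (T : ℂ) * ∑ n ∈ Icc 1 ⌊T⌋₊, 1 / (n : ℂ) * (b n * starRingEnd ℂ (b n)) =
      ∑ n ∈ Icc 1 N, (if (n : ℝ) ≤ T then T * (1 / (n : ℂ) * (b n * starRingEnd ℂ (b n)))
        else 0) := by
    rw [Finset.mul_sum, ← Finset.sum_filter]
    refine Finset.sum_congr ?_ fun _ _ => rfl
    ext n
    simp only [mem_filter, mem_Icc]
    rw [Nat.le_floor_iff hT0.le]
    constructor
    · rintro ⟨h1, h2⟩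
      exact ⟨⟨h1, ((Nat.le_floor_iff hT0.le).2 h2).trans hN⟩, h2⟩
    · rintro ⟨⟨h1, _⟩, h2⟩
      exact ⟨h1, h2⟩
  have hsplit : ∀ m ∈ Icc 1 N, ∑ n ∈ Icc 1 N, ∫ t in T..(2 * T), mvTerm b V t (m, n) =
      (∫ t in T..(2 * T), mvTerm b V t (m, m)) + ∑ n ∈ Icc 1 N,
        if m = n then 0 else ∫ t in T..(2 * T), mvTerm b V t (m, n) := by
    intro m hm
    rw [← Finset.add_sum_erase _ _ hm]
    congr 1
    rw [← Finset.add_sum_erase (Icc 1 N) (fun n => if m = n then 0 else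
      ∫ t in T..(2 * T), mvTerm b V t (m, n)) hm]
    simp only [if_true, zero_add]
    refine Finset.sum_congr rfl fun n hn => ?_
    rw [if_neg (Finset.ne_of_mem_erase hn).symm]
  rw [hbox, Finset.sum_congr rfl hsplit, hdiag, Finset.sum_add_distrib, add_sub_right_comm,
    ← Finset.sum_sub_distrib]
  refine (norm_add_le _ _).trans ?_
  have e1 : ‖∑ n ∈ Icc 1 N, ((∫ t in T..(2 * T), mvTerm b V t (n, n)) -
      (if (n : ℝ) ≤ T then T * (1 / (n : ℂ) * (b n * starRingEnd ℂ (b n))) else 0))‖ ≤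
      A * T * (4 * (4 + Real.log T) ^ 3) := by
    refine (norm_sum_le _ _).trans ?_
    refine (Finset.sum_le_sum fun n hn => hV.norm_integral_mvTerm_self_le hA hT0 hb
      (mem_Icc.1 hn).1).trans ?_
    rw [← Finset.mul_sum]
    exact mul_le_mul_of_nonneg_left (sum_card_divisors_sq_mul_le hT N) (by positivity)
  have e2 : ‖∑ m ∈ Icc 1 N, ∑ n ∈ Icc 1 N,
      (if m = n then 0 else ∫ t in T..(2 * T), mvTerm b V t (m, n))‖ ≤
      2 * π * A * (C₁ * T * (1 + Real.log T) ^ 3) := by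
    refine (norm_sum_le _ _).trans ?_
    refine le_trans ?_ (mul_le_mul_of_nonneg_left (h₁ T hT N) (by positivity : 0 ≤ 2 * π * A))
    rw [Finset.mul_sum]
    refine Finset.sum_le_sum fun m hm => (norm_sum_le _ _).trans ?_
    rw [Finset.mul_sum]
    refine Finset.sum_le_sum fun n hn => ?_
    split_ifs with h
    · simp [h, offDiagWeight]
    · exact hV.norm_integral_mvTerm_le hA hT0 hb (mem_Icc.1 hm).1 (mem_Icc.1 hn).1 h
  have e3 : (4 + Real.log T) ^ 3 ≤ 64 * (1 + Real.log T) ^ 3 := by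
    calc (4 + Real.log T) ^ 3 ≤ (4 * (1 + Real.log T)) ^ 3 := by gcongr; linarith
      _ = _ := by ring
  have e4 := mul_le_mul_of_nonneg_left e3 (by positivity : 0 ≤ 4 * (A * T))
  nlinarith [e1, e2, e4]

lemma ne_zero_of_re_ne_zero {c v : ℝ} (hc : c ≠ 0) : (c : ℂ) + v * I ≠ 0 := fun h => by
  have := congrArg Complex.re h
  simp at this
  exact hc this

lemma abs_re_le_norm_add_mul_I (c v : ℝ) : |c| ≤ ‖(c : ℂ) + v * I‖ := by
  simpa using Complex.abs_re_le_norm ((c : ℂ) + v * I)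

lemma abs_im_le_norm_add_mul_I (c v : ℝ) : |v| ≤ ‖(c : ℂ) + v * I‖ := by
  simpa using Complex.abs_im_le_norm ((c : ℂ) + v * I)

lemma integral_inv_add_mul_I {c : ℝ} (hc : c ≠ 0) (N : ℝ) :
    ∫ v in (-N)..N, ((c : ℂ) + v * I)⁻¹ = (2 * Real.arctan (N / c) : ℝ) := by
  have hd : ∀ v : ℝ, HasDerivAt (fun v : ℝ => ((Real.arctan (v / c) : ℝ) : ℂ) -
      ((Real.log (c ^ 2 + v ^ 2) / 2 : ℝ) : ℂ) * I) (((c : ℂ) + v * I)⁻¹) v := by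
    intro v
    have hp : 0 < c ^ 2 + v ^ 2 := by positivity
    have h1 : HasDerivAt (fun v : ℝ => Real.arctan (v / c)) (c / (c ^ 2 + v ^ 2)) v := by
      refine ((hasDerivAt_id' v).div_const c).arctan.congr_deriv ?_
      have : (1 + (v / c) ^ 2) ≠ 0 := by positivity
      field_simp
    have h2 : HasDerivAt (fun v : ℝ => Real.log (c ^ 2 + v ^ 2) / 2) (v / (c ^ 2 + v ^ 2)) v := by
      refine ((((hasDerivAt_pow 2 v).const_add (c ^ 2)).log hp.ne').div_const 2).congr_deriv ?_
      field_simp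
      simp [mul_comm]
    refine (h1.ofReal_comp.sub (h2.ofReal_comp.mul_const I)).congr_deriv ?_
    have hp' : ((c : ℂ) ^ 2 + (v : ℂ) ^ 2) ≠ 0 := by exact_mod_cast hp.ne'
    push_cast
    refine eq_inv_of_mul_eq_one_left ?_
    field_simp
    ring_nf
    simp
  have hcont : Continuous fun v : ℝ => ((c : ℂ) + v * I)⁻¹ :=
    Continuous.inv₀ (by fun_prop) fun v => ne_zero_of_re_ne_zero hc
  rw [intervalIntegral.integral_eq_sub_of_hasDerivAt (fun v _ => hd v)
    (hcont.intervalIntegrable _ _)]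
  rw [neg_div, Real.arctan_neg, neg_sq]
  push_cast
  ring

section Shift

variable {g : ℂ → ℂ} {a b c C : ℝ}

lemma continuous_vertical_div (hg : DifferentiableOn ℂ g {w | c < w.re}) {x : ℝ} (hx : c < x)
    (hx0 : x ≠ 0) : Continuous fun v : ℝ => g (x + v * I) / (x + v * I) := by
  refine Continuous.div ?_ (by fun_prop) fun v => ne_zero_of_re_ne_zero hx0
  refine hg.continuousOn.comp_continuous (by fun_prop) fun v => ?_
  simpa using hx

lemma integrable_vertical_div (hg : DifferentiableOn ℂ g {w | c < w.re}) {x : ℝ} (hx : c < x)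
    (hx0 : x ≠ 0) (hC : ∀ v : ℝ, ‖g (x + v * I)‖ ≤ C * Real.exp (-(v ^ 2 / 2))) :
    Integrable fun v : ℝ => g (x + v * I) / (x + v * I) := by
  have h1 : Integrable fun v : ℝ => C / |x| * Real.exp (-(1 / 2) * v ^ 2) :=
    (integrable_exp_neg_mul_sq (by norm_num)).const_mul _
  refine h1.mono' (continuous_vertical_div hg hx hx0).aestronglyMeasurable
    (Eventually.of_forall fun v => ?_)
  rw [norm_div, div_mul_eq_mul_div, show -(1 / 2) * v ^ 2 = -(v ^ 2 / 2) by ring]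
  have := abs_pos.2 hx0
  exact div_le_div₀ ((norm_nonneg _).trans (hC v)) (hC v) this (abs_re_le_norm_add_mul_I _ _)

/-- Shifting the line of integration of `g w / w` past the pole at `0`. -/
theorem integral_vertical_div_sub (ha : a < 0) (hb : 0 < b) (hca : c < a)
    (hg : DifferentiableOn ℂ g {w | c < w.re})
    (hC : ∀ x ∈ Set.Icc a b, ∀ v : ℝ, ‖g (x + v * I)‖ ≤ C * Real.exp (-(v ^ 2 / 2))) :
    (∫ v : ℝ, g (b + v * I) / (b + v * I)) - (∫ v : ℝ, g (a + v * I) / (a + v * I)) =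
      2 * π * g 0 := by
  have hab : a ≤ b := by linarith
  have hopen : IsOpen {w : ℂ | c < w.re} := isOpen_lt continuous_const Complex.continuous_re
  have h0 : (0 : ℂ) ∈ {w : ℂ | c < w.re} := by
    change c < (0 : ℂ).re
    simp; linarith
  have hd : DifferentiableOn ℂ (dslope g 0) {w | c < w.re} :=
    (Complex.differentiableOn_dslope (hopen.mem_nhds h0)).2 hg
  have hds : ∀ w : ℂ, w ≠ 0 → dslope g 0 w = g w / w - g 0 * w⁻¹ := fun w hw => by
    rw [dslope_of_ne _ hw, slope_def_field]
    field_simp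
    simp
  have hC0 : 0 ≤ C := by
    have := (norm_nonneg _).trans (hC 0 ⟨ha.le, hb.le⟩ 0)
    simpa using this
  have hvert : ∀ x : ℝ, c < x → x ≠ 0 → ∀ N : ℝ, ∫ v in (-N)..N, dslope g 0 (x + v * I) =
      (∫ v in (-N)..N, g (x + v * I) / (x + v * I)) - g 0 * (2 * Real.arctan (N / x) : ℝ) := by
    intro x hx hx0 N
    rw [← integral_inv_add_mul_I hx0, ← intervalIntegral.integral_const_mul,
      ← intervalIntegral.integral_sub ((continuous_vertical_div hg hx hx0).intervalIntegrable _ _)]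
    · refine intervalIntegral.integral_congr fun v _ => ?_
      exact hds _ (ne_zero_of_re_ne_zero hx0)
    · exact (continuous_const.mul (Continuous.inv₀ (by fun_prop)
        fun v => ne_zero_of_re_ne_zero hx0)).intervalIntegrable _ _
  have hhor : ∀ N : ℝ, N ≠ 0 → ‖∫ x in a..b, dslope g 0 (x + N * I)‖ ≤
      (C + ‖g 0‖) / |N| * |b - a| := by
    intro N hN
    refine intervalIntegral.norm_integral_le_of_norm_le_const fun x hx => ?_
    rw [Set.uIoc_of_le hab] at hx
    have hne : (x : ℂ) + N * I ≠ 0 := fun h => by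
      have := congrArg Complex.im h
      simp at this
      exact hN this
    have hN' := abs_pos.2 hN
    rw [hds _ hne, ← div_eq_mul_inv, ← sub_div, norm_div]
    refine div_le_div₀ (by positivity) ?_ hN' (abs_im_le_norm_add_mul_I _ _)
    refine (norm_sub_le _ _).trans (add_le_add_left ((hC x ⟨hx.1.le, hx.2⟩ N).trans ?_) _)
    exact mul_le_of_le_one_right hC0 (Real.exp_le_one_iff.2 (by nlinarith [sq_nonneg N]))
  have hrect : ∀ N : ℝ, ((∫ x in a..b, dslope g 0 (x + (-N : ℝ) * I)) -
      ∫ x in a..b, dslope g 0 (x + N * I)) +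
      I * ((∫ v in (-N)..N, g (b + v * I) / (b + v * I)) - g 0 * (2 * Real.arctan (N / b) : ℝ)) -
      I * ((∫ v in (-N)..N, g (a + v * I) / (a + v * I)) - g 0 * (2 * Real.arctan (N / a) : ℝ)) =
      0 := by
    intro N
    rw [← hvert b (by linarith) hb.ne', ← hvert a hca ha.ne]
    have := Complex.integral_boundary_rect_eq_zero_of_differentiableOn (dslope g 0)
      ((a : ℂ) + (-N : ℝ) * I) ((b : ℂ) + (N : ℝ) * I) (hd.mono fun w hw => ?_)
    · simpa [smul_eq_mul] using this
    · have := hw.1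
      simp only [Set.mem_preimage, Complex.add_re, Complex.ofReal_re, Complex.mul_re, Complex.I_re,
        mul_zero, Complex.ofReal_im, Complex.I_im, mul_one, sub_self, add_zero,
        Set.uIcc_of_le hab] at this
      exact hca.trans_le this.1
  have hlim0 : ∀ e : ℝ → ℝ, (∀ N, |e N| = |N|) →
      Tendsto (fun N => ∫ x in a..b, dslope g 0 (x + e N * I)) atTop (nhds 0) := by
    intro e he
    refine squeeze_zero_norm' (a := fun N : ℝ => (C + ‖g 0‖) * |b - a| / N) ?_
      (tendsto_const_nhds.div_atTop tendsto_id)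
    filter_upwards [eventually_gt_atTop 0] with N hN
    refine (hhor (e N) fun h => ?_).trans_eq ?_
    · have := he N
      rw [h, abs_zero, abs_of_pos hN] at this
      exact hN.ne this
    · rw [he, abs_of_pos hN]
      ring
  have hI : ∀ x ∈ Set.Icc a b, x ≠ 0 → Tendsto
      (fun N : ℝ => ∫ v in (-N)..N, g (x + v * I) / (x + v * I)) atTop
      (nhds (∫ v : ℝ, g (x + v * I) / (x + v * I))) := fun x hx hx0 =>
    intervalIntegral_tendsto_integral
      (integrable_vertical_div hg (hca.trans_le hx.1) hx0 (hC x hx)) tendsto_neg_atTop_atBot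
      tendsto_id
  have hatb : Tendsto (fun N : ℝ => Real.arctan (N / b)) atTop (nhds (π / 2)) :=
    (tendsto_nhds_of_tendsto_nhdsWithin Real.tendsto_arctan_atTop).comp
      (tendsto_id.atTop_div_const hb)
  have hata : Tendsto (fun N : ℝ => Real.arctan (N / a)) atTop (nhds (-(π / 2))) :=
    (tendsto_nhds_of_tendsto_nhdsWithin Real.tendsto_arctan_atBot).comp
      (tendsto_id.atTop_div_const_of_neg ha)
  have hcast : ∀ {u : ℝ → ℝ} {l : ℝ}, Tendsto u atTop (nhds l) →
      Tendsto (fun N => ((2 * u N : ℝ) : ℂ)) atTop (nhds ((2 * l : ℝ) : ℂ)) := fun h =>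
    (Complex.continuous_ofReal.tendsto _).comp (h.const_mul 2)
  have hlim := (((hlim0 (fun N => -N) (fun N => abs_neg N)).sub
    (hlim0 (fun N => N) (fun N => rfl))).add
    (((hI b ⟨hab, le_rfl⟩ hb.ne').sub ((hcast hatb).const_mul (g 0))).const_mul I)).sub
    (((hI a ⟨le_rfl, hab⟩ ha.ne).sub ((hcast hata).const_mul (g 0))).const_mul I)
  have huniq := tendsto_nhds_unique hlim
    ((tendsto_const_nhds (x := (0 : ℂ))).congr fun N => (hrect N).symm)
  rw [sub_zero, zero_add, ← mul_sub] at huniq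
  have h4 := (mul_eq_zero.1 huniq).resolve_left Complex.I_ne_zero
  push_cast at h4
  linear_combination h4

end Shift

/-- The smooth cut-off attached to a kernel `k` through the Mellin transform. -/
noncomputable def mellinWeight (k : ℂ → ℂ) (x : ℝ) : ℂ :=
  1 / (2 * π) * ∫ v : ℝ, k ((1 : ℝ) + v * I) * (x : ℂ) ^ (-((1 : ℝ) + v * I : ℂ)) /
    ((1 : ℝ) + v * I)

/-- Functions on `-1 < Re w` with Gaussian decay in the strip `-1/2 ≤ Re w ≤ 1`. -/
structure IsStripKernel (k : ℂ → ℂ) : Prop where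
  differentiableOn : DifferentiableOn ℂ k {w | -1 < w.re}
  decay : ∃ C, ∀ x ∈ Set.Icc (-(1 / 2) : ℝ) 1, ∀ v : ℝ,
    ‖k (x + v * I)‖ ≤ C * Real.exp (-(v ^ 2 / 2))

lemma IsStripKernel.sub {k l : ℂ → ℂ} (hk : IsStripKernel k) (hl : IsStripKernel l) :
    IsStripKernel fun w => k w - l w := by
  refine ⟨hk.differentiableOn.sub hl.differentiableOn, ?_⟩
  obtain ⟨C, hC⟩ := hk.decay
  obtain ⟨D, hD⟩ := hl.decay
  exact ⟨C + D, fun x hx v => (norm_sub_le _ _).trans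
    ((add_le_add (hC x hx v) (hD x hx v)).trans_eq (by ring))⟩

lemma norm_integral_gaussian_le {G : ℝ → ℂ} {M : ℝ}
    (hG : ∀ v, ‖G v‖ ≤ M * Real.exp (-(v ^ 2 / 2))) :
    ‖(1 / (2 * π) : ℂ) * ∫ v, G v‖ ≤ M / 2 := by
  have hM : 0 ≤ M := by simpa using (norm_nonneg _).trans (hG 0)
  have hG' : ∀ v, ‖G v‖ ≤ M * Real.exp (-(1 / 2) * v ^ 2) := fun v => by
    rw [show -(1 / 2) * v ^ 2 = -(v ^ 2 / 2) by ring]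
    exact hG v
  have h1 := norm_integral_le_of_norm_le ((integrable_exp_neg_mul_sq (b := 1 / 2)
    (by norm_num)).const_mul M) (Eventually.of_forall hG')
  rw [integral_const_mul, integral_gaussian] at h1
  have h2 : √(π / (1 / 2)) ≤ π := by
    rw [Real.sqrt_le_left Real.pi_pos.le]
    nlinarith [Real.pi_gt_three]
  have h3 : ‖(1 / (2 * π) : ℂ)‖ = 1 / (2 * π) := by
    rw [show (1 / (2 * π) : ℂ) = ((1 / (2 * π) : ℝ) : ℂ) by push_cast; ring, Complex.norm_real,
      Real.norm_of_nonneg (by positivity)]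
  rw [norm_mul, h3]
  calc 1 / (2 * π) * ‖∫ v, G v‖ ≤ 1 / (2 * π) * (M * π) := by
        refine mul_le_mul_of_nonneg_left (h1.trans ?_) (by positivity)
        gcongr
    _ = M / 2 := by field_simp

lemma norm_ofReal_cpow_neg {x : ℝ} (hx : 0 < x) (c v : ℝ) :
    ‖(x : ℂ) ^ (-((c : ℂ) + v * I))‖ = x ^ (-c) := by
  rw [Complex.norm_cpow_eq_rpow_re_of_pos hx]
  simp

section

variable {k l : ℂ → ℂ} {M x : ℝ}

lemma norm_mellinWeight_le (hx : 0 < x)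
    (hk : ∀ v : ℝ, ‖k ((1 : ℝ) + v * I)‖ ≤ M * Real.exp (-(v ^ 2 / 2))) :
    ‖mellinWeight k x‖ ≤ M / x := by
  have hM : 0 ≤ M := by simpa using (norm_nonneg _).trans (hk 0)
  refine (norm_integral_gaussian_le (M := M / x) fun v => ?_).trans ?_
  · rw [norm_div, norm_mul, norm_ofReal_cpow_neg hx, Real.rpow_neg_one]
    have h1 : 1 ≤ ‖((1 : ℝ) : ℂ) + v * I‖ := by simpa using abs_re_le_norm_add_mul_I 1 v
    refine (div_le_self (by positivity) h1).trans ?_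
    rw [div_mul_eq_mul_div, div_eq_mul_inv]
    gcongr
    exact hk v
  · linarith [show 0 ≤ M / x by positivity]

lemma IsStripKernel.differentiableOn_mul_cpow (hk : IsStripKernel k) (hx : 0 < x) :
    DifferentiableOn ℂ (fun w => k w * (x : ℂ) ^ (-w)) {w | -1 < w.re} :=
  hk.differentiableOn.mul (DifferentiableOn.const_cpow differentiableOn_id.neg
    (Or.inl (by exact_mod_cast hx.ne')))

lemma IsStripKernel.exists_norm_mul_cpow_le (hk : IsStripKernel k) (hx : 1 ≤ x) :
    ∃ C, ∀ c ∈ Set.Icc (-(1 / 2) : ℝ) 1, ∀ v : ℝ,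
      ‖k (c + v * I) * (x : ℂ) ^ (-(c + v * I : ℂ))‖ ≤ C * Real.exp (-(v ^ 2 / 2)) := by
  obtain ⟨C, hC⟩ := hk.decay
  have hx0 : 0 < x := by linarith
  refine ⟨C * x, fun c hc v => ?_⟩
  rw [norm_mul, norm_ofReal_cpow_neg hx0]
  have h1 : x ^ (-c) ≤ x := by
    conv_rhs => rw [← Real.rpow_one x]
    exact Real.rpow_le_rpow_of_exponent_le hx (by linarith [hc.1])
  calc _ ≤ (C * Real.exp (-(v ^ 2 / 2))) * x :=
        mul_le_mul (hC c hc v) h1 (by positivity) ((norm_nonneg _).trans (hC c hc v))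
    _ = _ := by ring

lemma mellinWeight_sub (hk : IsStripKernel k) (hl : IsStripKernel l) (hx : 1 ≤ x) :
    mellinWeight (fun w => k w - l w) x = mellinWeight k x - mellinWeight l x := by
  have hx0 : 0 < x := by linarith
  obtain ⟨C, hC⟩ := hk.exists_norm_mul_cpow_le hx
  obtain ⟨D, hD⟩ := hl.exists_norm_mul_cpow_le hx
  have h1 := integrable_vertical_div (hk.differentiableOn_mul_cpow hx0) (x := 1) (by norm_num)
    one_ne_zero (hC 1 (by norm_num))
  have h2 := integrable_vertical_div (hl.differentiableOn_mul_cpow hx0) (x := 1) (by norm_num)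
    one_ne_zero (hD 1 (by norm_num))
  unfold mellinWeight
  rw [← mul_sub, ← integral_sub h1 h2]
  congr 2
  ext v
  ring

lemma norm_mellinWeight_sub_le (hx : 1 ≤ x) (hk : IsStripKernel k)
    (hM : ∀ v : ℝ, ‖k ((-(1 / 2) : ℝ) + v * I)‖ ≤ M * Real.exp (-(v ^ 2 / 2))) :
    ‖mellinWeight k x - k 0‖ ≤ M * √x := by
  have hx0 : 0 < x := by linarith
  obtain ⟨C, hC⟩ := hk.exists_norm_mul_cpow_le hx
  have h1 := integral_vertical_div_sub (a := -(1 / 2)) (b := 1) (c := -1) (by norm_num)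
    (by norm_num) (by norm_num) (hk.differentiableOn_mul_cpow hx0) hC
  simp only [neg_zero, Complex.cpow_zero, mul_one] at h1
  have h2 : mellinWeight k x - k 0 = 1 / (2 * π) * ∫ v : ℝ, k ((-(1 / 2) : ℝ) + v * I) *
      (x : ℂ) ^ (-((-(1 / 2) : ℝ) + v * I : ℂ)) / ((-(1 / 2) : ℝ) + v * I) := by
    have hpi : (π : ℂ) ≠ 0 := by exact_mod_cast Real.pi_ne_zero
    rw [mellinWeight, eq_add_of_sub_eq h1, mul_add, ← mul_assoc,
      one_div_mul_cancel (mul_ne_zero two_ne_zero hpi), one_mul, add_sub_cancel_left]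
  rw [h2]
  refine (norm_integral_gaussian_le (M := 2 * (M * √x)) fun v => ?_).trans_eq (by ring)
  have hhalf : x ^ (-(-(1 / 2)) : ℝ) = √x := by rw [neg_neg, Real.sqrt_eq_rpow]
  rw [norm_div, norm_mul, norm_ofReal_cpow_neg hx0, hhalf]
  have h3 : 1 / 2 ≤ ‖((-(1 / 2) : ℝ) : ℂ) + v * I‖ := by
    have := abs_re_le_norm_add_mul_I (-(1 / 2)) v
    rwa [abs_neg, abs_of_pos (by norm_num)] at this
  rw [div_le_iff₀ (by linarith)]
  have h4 := mul_le_mul_of_nonneg_right (hM v) (Real.sqrt_nonneg x)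
  have h5 := mul_le_mul_of_nonneg_left h3 ((by positivity : (0 : ℝ) ≤ _).trans h4)
  nlinarith

end

/-- Families of kernels whose Mellin weights can be used in the mean value theorem. -/
structure IsMVKernel (A T : ℝ) (K : ℝ → ℂ → ℂ) : Prop where
  strip : ∀ t ∈ Set.Icc T (2 * T), IsStripKernel (K t)
  right : ∀ t ∈ Set.Icc T (2 * T), ∀ v : ℝ,
    ‖K t ((1 : ℝ) + v * I)‖ ≤ A * T ^ 2 * Real.exp (-(v ^ 2 / 2))
  left : ∀ t ∈ Set.Icc T (2 * T), ∀ v : ℝ,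
    ‖K t ((-(1 / 2) : ℝ) + v * I)‖ ≤ A / T * Real.exp (-(v ^ 2 / 2))
  right_sub : ∀ t ∈ Set.Icc T (2 * T), ∀ t' ∈ Set.Icc T (2 * T), ∀ v : ℝ,
    ‖K t ((1 : ℝ) + v * I) - K t' ((1 : ℝ) + v * I)‖ ≤
      A * T * |t - t'| * Real.exp (-(v ^ 2 / 2))
  left_sub : ∀ t ∈ Set.Icc T (2 * T), ∀ t' ∈ Set.Icc T (2 * T), ∀ v : ℝ,
    ‖K t ((-(1 / 2) : ℝ) + v * I) - K t' ((-(1 / 2) : ℝ) + v * I)‖ ≤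
      A / T ^ 2 * |t - t'| * Real.exp (-(v ^ 2 / 2))
  zero_sub_one : ∀ t ∈ Set.Icc T (2 * T), ‖K t 0 - 1‖ ≤ A / T
  zero_sub : ∀ t ∈ Set.Icc T (2 * T), ∀ t' ∈ Set.Icc T (2 * T),
    ‖K t 0 - K t' 0‖ ≤ A / T * |t - t'|

theorem IsMVKernel.isMVWeight {A T : ℝ} {K : ℝ → ℂ → ℂ} (hT : 1 ≤ T) (hA : 0 ≤ A)
    (hK : IsMVKernel A T K) : IsMVWeight (1 + 2 * A) T fun t x => mellinWeight (K t) x := by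
  have hT0 : 0 < T := by linarith
  have hAT : A / T ≤ A := div_le_self hA hT
  refine ⟨fun t ht x hx => ?_, fun t ht t' ht' x hx => ?_, fun t ht n hn => ?_⟩
  · have hx0 : 0 < x := by linarith
    rcases le_total x (T ^ 2) with h | h
    · rw [min_eq_left ((one_le_div hx0).2 h), mul_one]
      have h1 := norm_mellinWeight_sub_le hx (hK.strip t ht) (hK.left t ht)
      have h2 : A / T * √x ≤ A := by
        rw [div_mul_eq_mul_div, div_le_iff₀ hT0]
        exact mul_le_mul_of_nonneg_left (Real.sqrt_le_left hT0.le |>.2 h) hA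
      have h3 := hK.zero_sub_one t ht
      calc ‖mellinWeight (K t) x‖ = ‖(mellinWeight (K t) x - K t 0) + (K t 0 - 1) + 1‖ := by
            congr 1; ring
        _ ≤ A + A + 1 := (norm_add₃_le).trans (by
            rw [norm_one]; linarith)
        _ = _ := by ring
    · rw [min_eq_right ((div_le_one hx0).2 h)]
      refine (norm_mellinWeight_le hx0 (hK.right t ht)).trans ?_
      rw [mul_div_assoc]
      exact mul_le_mul_of_nonneg_right (by linarith) (by positivity)
  · have hx0 : 0 < x := by linarith
    have hs := (hK.strip t ht).sub (hK.strip t' ht')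
    have hAA : A / T ≤ (1 + 2 * A) / T := by gcongr; linarith
    rw [← mellinWeight_sub (hK.strip t ht) (hK.strip t' ht') hx]
    rcases le_total x (T ^ 2) with h | h
    · rw [min_eq_left ((one_le_div hx0).2 h), mul_one]
      have h1 := norm_mellinWeight_sub_le hx hs (hK.left_sub t ht t' ht')
      have h2 : A / T ^ 2 * |t - t'| * √x ≤ A / T * |t - t'| := by
        have := mul_le_mul_of_nonneg_left (Real.sqrt_le_left hT0.le |>.2 h)
          (by positivity : 0 ≤ A / T ^ 2 * |t - t'|)
        refine this.trans_eq ?_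
        field_simp
      have h3 := hK.zero_sub t ht t' ht'
      calc _ = ‖(mellinWeight (fun w => K t w - K t' w) x - (K t 0 - K t' 0)) +
              (K t 0 - K t' 0)‖ := by congr 1; ring
        _ ≤ A / T * |t - t'| + A / T * |t - t'| := (norm_add_le _ _).trans (by linarith)
        _ = (2 * A) / T * |t - t'| := by ring
        _ ≤ _ := by gcongr; linarith
    · rw [min_eq_right ((div_le_one hx0).2 h)]
      refine (norm_mellinWeight_le hx0 (hK.right_sub t ht t' ht')).trans ?_
      calc _ = A / T * (T ^ 2 / x) * |t - t'| := by field_simp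
        _ ≤ _ := by gcongr
  · have hn' : (1 : ℝ) ≤ n := by exact_mod_cast hn
    have h1 := norm_mellinWeight_sub_le (x := (n : ℝ) * n) (by nlinarith) (hK.strip t ht)
      (hK.left t ht)
    rw [Real.sqrt_mul_self (by linarith)] at h1
    have h2 := hK.zero_sub_one t ht
    have h3 : A / T ≤ A / T * n := le_mul_of_one_le_right (by positivity) hn'
    calc _ = ‖(mellinWeight (K t) ((n : ℝ) * n) - K t 0) + (K t 0 - 1)‖ := by congr 1; ring
      _ ≤ A / T * n + A / T * n := (norm_add_le _ _).trans (by linarith)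
      _ = (2 * A) * (n / T) := by ring
      _ ≤ _ := by gcongr; linarith

/-- `F` is bounded by `M` on `[T, 2T]`, with relative variation at most `L / T` per unit length. -/
structure IsSlow (T M L : ℝ) (F : ℝ → ℂ) : Prop where
  norm_le : ∀ t ∈ Set.Icc T (2 * T), ‖F t‖ ≤ M
  norm_sub_le : ∀ t ∈ Set.Icc T (2 * T), ∀ t' ∈ Set.Icc T (2 * T),
    ‖F t - F t'‖ ≤ L / T * M * |t - t'|

section IsSlow

variable {T M L M' L' : ℝ} {F G : ℝ → ℂ}

lemma IsSlow.nonneg (hT : 0 ≤ T) (hF : IsSlow T M L F) : 0 ≤ M :=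
  (norm_nonneg _).trans (hF.norm_le T ⟨le_rfl, by linarith⟩)

lemma IsSlow.mul (hT : 0 ≤ T) (hF : IsSlow T M L F) (hG : IsSlow T M' L' G) :
    IsSlow T (M * M') (L + L') fun t => F t * G t := by
  have hM := hF.nonneg hT
  have hM' := hG.nonneg hT
  refine ⟨fun t ht => ?_, fun t ht t' ht' => ?_⟩
  · rw [norm_mul]
    exact mul_le_mul (hF.norm_le t ht) (hG.norm_le t ht) (norm_nonneg _) hM
  · calc ‖F t * G t - F t' * G t'‖ = ‖F t * (G t - G t') + (F t - F t') * G t'‖ := by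
          congr 1; ring
      _ ≤ M * (L' / T * M' * |t - t'|) + (L / T * M * |t - t'|) * M' := by
          refine (norm_add_le _ _).trans ?_
          rw [norm_mul, norm_mul]
          exact add_le_add
            (mul_le_mul (hF.norm_le t ht) (hG.norm_sub_le t ht t' ht') (norm_nonneg _) hM)
            (mul_le_mul (hF.norm_sub_le t ht t' ht') (hG.norm_le t' ht') (norm_nonneg _)
              ((norm_nonneg _).trans (hF.norm_sub_le t ht t' ht')))
      _ = _ := by ring

lemma isSlow_const (T : ℝ) (z : ℂ) : IsSlow T ‖z‖ 0 fun _ => z :=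
  ⟨fun _ _ => le_rfl, fun _ _ _ _ => by simp⟩

lemma IsSlow.mono (hT : 0 ≤ T) (hF : IsSlow T M L F) (hM : M ≤ M') (hL0 : 0 ≤ L) (hL : L ≤ L') :
    IsSlow T M' L' F := by
  have hM0 := hF.nonneg hT
  refine ⟨fun t ht => (hF.norm_le t ht).trans hM, fun t ht t' ht' =>
    (hF.norm_sub_le t ht t' ht').trans ?_⟩
  have : 0 ≤ L' / T := div_nonneg (hL0.trans hL) hT
  gcongr

lemma norm_quarter_add_sq (t : ℝ) : ‖(1 / 4 + (t : ℂ) ^ 2)‖ = 1 / 4 + t ^ 2 := by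
  rw [show (1 / 4 + (t : ℂ) ^ 2) = ((1 / 4 + t ^ 2 : ℝ) : ℂ) by push_cast; ring, Complex.norm_real,
    Real.norm_of_nonneg (by positivity)]

lemma quarter_add_sq_ne_zero (t : ℝ) : (1 / 4 + (t : ℂ) ^ 2) ≠ 0 := by
  rw [← norm_ne_zero_iff, norm_quarter_add_sq]
  positivity

lemma norm_inv_sub_inv_quarter_le {t t' : ℝ} (hT : 1 ≤ T) (ht : t ∈ Set.Icc T (2 * T))
    (ht' : t' ∈ Set.Icc T (2 * T)) :
    ‖(1 / 4 + (t : ℂ) ^ 2)⁻¹ - (1 / 4 + (t' : ℂ) ^ 2)⁻¹‖ ≤ 4 / T * (1 / T ^ 2) * |t - t'| := by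
  rw [inv_sub_inv (quarter_add_sq_ne_zero t) (quarter_add_sq_ne_zero t'), norm_div, norm_mul,
    norm_quarter_add_sq, norm_quarter_add_sq]
  have h1 : ‖(1 / 4 + (t' : ℂ) ^ 2) - (1 / 4 + (t : ℂ) ^ 2)‖ = |t - t'| * (t + t') := by
    rw [show (1 / 4 + (t' : ℂ) ^ 2) - (1 / 4 + (t : ℂ) ^ 2) = (((t' - t) * (t + t') : ℝ) : ℂ) by
      push_cast; ring, Complex.norm_real, Real.norm_eq_abs, abs_mul, abs_sub_comm t' t,
      abs_of_nonneg (a := t + t') (by linarith [ht.1, ht'.1])]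
  rw [h1]
  have hT0 : 0 < T := by linarith
  have h2 : T ^ 2 ≤ 1 / 4 + t ^ 2 := by nlinarith [ht.1]
  have h3 : T ^ 2 ≤ 1 / 4 + t' ^ 2 := by nlinarith [ht'.1]
  calc |t - t'| * (t + t') / ((1 / 4 + t ^ 2) * (1 / 4 + t' ^ 2))
      ≤ |t - t'| * (4 * T) / (T ^ 2 * T ^ 2) := by
        gcongr
        linarith [ht.2, ht'.2]
    _ = _ := by field_simp

lemma isSlow_inv_quarter_add_sq (hT : 1 ≤ T) :
    IsSlow T (1 / T ^ 2) 4 fun t => (1 / 4 + (t : ℂ) ^ 2)⁻¹ := by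
  refine ⟨fun t ht => ?_, fun t ht t' ht' => norm_inv_sub_inv_quarter_le hT ht ht'⟩
  rw [norm_inv, norm_quarter_add_sq, ← one_div]
  have h2 : T ^ 2 ≤ 1 / 4 + t ^ 2 := by nlinarith [ht.1]
  gcongr

lemma isSlow_add_sq_div (hT : 1 ≤ T) (z : ℂ) :
    IsSlow T (1 + ‖z - 1 / 4‖) 4 fun t => (z + (t : ℂ) ^ 2) / (1 / 4 + (t : ℂ) ^ 2) := by
  have h0 : ∀ t : ℝ, (z + (t : ℂ) ^ 2) / (1 / 4 + (t : ℂ) ^ 2) =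
      1 + (z - 1 / 4) * (1 / 4 + (t : ℂ) ^ 2)⁻¹ := fun t => by
    have := quarter_add_sq_ne_zero t
    rw [← div_eq_mul_inv, eq_comm, ← eq_sub_iff_add_eq', div_eq_iff this, sub_mul,
      div_mul_cancel₀ _ this]
    ring
  simp only [h0]
  have hT2 : 1 / T ^ 2 ≤ 1 := by
    rw [div_le_one (by positivity)]; nlinarith
  refine ⟨fun t ht => (norm_add_le _ _).trans ?_, fun t ht t' ht' => ?_⟩
  · rw [norm_one, norm_mul]
    gcongr
    exact mul_le_of_le_one_right (norm_nonneg _)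
      (((isSlow_inv_quarter_add_sq hT).norm_le t ht).trans hT2)
  · rw [add_sub_add_left_eq_sub, ← mul_sub, norm_mul]
    have hT0 : 0 < T := by linarith
    calc _ ≤ ‖z - 1 / 4‖ * (4 / T * (1 / T ^ 2) * |t - t'|) := by
          gcongr
          exact norm_inv_sub_inv_quarter_le hT ht ht'
      _ ≤ ‖z - 1 / 4‖ * (4 / T * 1 * |t - t'|) := by gcongr
      _ ≤ _ := by
          have : 0 ≤ 4 / T * |t - t'| := by positivity
          nlinarith

end IsSlow

lemma exp_mul_abs_sub_sq_le (β v : ℝ) :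
    Real.exp (β * |v|) * Real.exp (1 - v ^ 2) ≤
      Real.exp (1 + β ^ 2 / 2) * Real.exp (-(v ^ 2 / 2)) := by
  rw [← Real.exp_add, ← Real.exp_add, Real.exp_le_exp]
  nlinarith [sq_nonneg (β - |v|), sq_abs v]

/-- The kernel built from the ratio `R`, with the standard Gaussian factor. -/
noncomputable def gaussKernel (y : ℝ) (R : ℝ → ℂ → ℂ) (t : ℝ) (w : ℂ) : ℂ :=
  R t w ^ 2 * ((y : ℂ) ^ w * cexp (w ^ 2))

lemma norm_cpow_mul_exp_sq_le {y : ℝ} (hy : 0 < y) {σ : ℝ} (hσ : σ ∈ Set.Icc (-(1 / 2) : ℝ) 1)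
    (v : ℝ) : ‖(y : ℂ) ^ ((σ : ℂ) + v * I) * cexp (((σ : ℂ) + v * I) ^ 2)‖ ≤
      y ^ σ * Real.exp (1 - v ^ 2) := by
  rw [norm_mul, Complex.norm_cpow_eq_rpow_re_of_pos hy, Complex.norm_exp]
  have h1 : (((σ : ℂ) + v * I) ^ 2).re = σ ^ 2 - v ^ 2 := by
    simp [sq]
  rw [h1]
  simp only [Complex.add_re, Complex.ofReal_re, Complex.mul_re, Complex.I_re, mul_zero,
    Complex.ofReal_im, Complex.I_im, mul_one, sub_self, add_zero]
  gcongr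
  nlinarith [hσ.1, hσ.2]

theorem exists_isMVKernel_gaussKernel {c : ℝ} (k : ℝ) {B : ℝ} (β : ℝ) (hc : 0 < c) (hB : 1 ≤ B) :
    ∃ A : ℝ, 0 ≤ A ∧ ∀ T : ℝ, 1 ≤ T → ∀ R : ℝ → ℂ → ℂ,
      (∀ t ∈ Set.Icc T (2 * T), DifferentiableOn ℂ (R t) {w | -1 < w.re}) →
      (∀ t ∈ Set.Icc T (2 * T), ∃ C, ∀ σ ∈ Set.Icc (-(1 / 2) : ℝ) 1, ∀ v : ℝ,
        ‖R t (σ + v * I)‖ ≤ C * Real.exp (β * |v|)) →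
      (∀ σ : ℝ, σ = -(1 / 2) ∨ σ = 1 → ∀ v : ℝ, IsSlow T (B * T ^ (k * σ) * Real.exp (β * |v|))
        (B * Real.exp (β * |v|)) fun t => R t (σ + v * I)) →
      IsSlow T B B (fun t => R t 0) → (∀ t ∈ Set.Icc T (2 * T), ‖R t 0 - 1‖ ≤ B / T) →
      IsMVKernel A T (gaussKernel (c * T ^ (2 - 2 * k)) R) := by
  set c' : ℝ := c ^ (1 : ℝ) + c ^ (-(1 / 2) : ℝ) with hc'
  have hc'0 : 0 < c' := by positivity
  have hcs : ∀ σ : ℝ, σ = -(1 / 2) ∨ σ = 1 → c ^ σ ≤ c' := by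
    have h1 : 0 < c ^ (1 : ℝ) := by positivity
    have h2 : 0 < c ^ (-(1 / 2) : ℝ) := by positivity
    rintro σ (rfl | rfl)
    · exact le_add_of_nonneg_left h1.le
    · exact le_add_of_nonneg_right h2.le
  set D : ℝ := 2 * B ^ 3 * c' * Real.exp (1 + (3 * β) ^ 2 / 2) +
    B ^ 2 * c' * Real.exp (1 + (2 * β) ^ 2 / 2) with hD
  have hB0 : 0 < B := by linarith
  have hD0 : 0 ≤ D := by positivity
  refine ⟨D + 2 * B ^ 3 + B * (B + 1), by positivity, fun T hT R hdiff hstrip hslow h0 h1 => ?_⟩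
  have hT0 : 0 < T := by linarith
  set y : ℝ := c * T ^ (2 - 2 * k) with hy
  have hy0 : 0 < y := by positivity
  have hmem : ∀ σ : ℝ, σ = -(1 / 2) ∨ σ = 1 → σ ∈ Set.Icc (-(1 / 2) : ℝ) 1 := by
    rintro σ (rfl | rfl) <;> constructor <;> norm_num
  have hys : ∀ σ : ℝ, σ = -(1 / 2) ∨ σ = 1 → y ^ σ ≤ c' * T ^ ((2 - 2 * k) * σ) := fun σ hσ => by
    rw [hy, Real.mul_rpow hc.le (by positivity), ← Real.rpow_mul hT0.le]
    gcongr
    exact hcs σ hσ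
  have hpow : ∀ σ : ℝ, T ^ (k * σ) * T ^ (k * σ) * T ^ ((2 - 2 * k) * σ) = T ^ (2 * σ) :=
    fun σ => by
      rw [← Real.rpow_add hT0, ← Real.rpow_add hT0]
      ring_nf
  have hmain : ∀ σ : ℝ, σ = -(1 / 2) ∨ σ = 1 → ∀ v : ℝ, IsSlow T
      ((B * T ^ (k * σ) * Real.exp (β * |v|)) * (B * T ^ (k * σ) * Real.exp (β * |v|)) *
        (c' * T ^ ((2 - 2 * k) * σ) * Real.exp (1 - v ^ 2)))
      (B * Real.exp (β * |v|) + B * Real.exp (β * |v|) + 0)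
      fun t => gaussKernel y R t (σ + v * I) := fun σ hσ v => by
    have h2 := ((hslow σ hσ v).mul hT0.le (hslow σ hσ v)).mul hT0.le
      (isSlow_const T ((y : ℂ) ^ ((σ : ℂ) + v * I) * cexp (((σ : ℂ) + v * I) ^ 2)))
    simp only [gaussKernel, sq (R _ _)]
    refine h2.mono hT0.le ?_ (by positivity) le_rfl
    gcongr
    refine (norm_cpow_mul_exp_sq_le hy0 (hmem σ hσ) v).trans ?_
    gcongr
    exact hys σ hσ
  have hnorm : ∀ σ : ℝ, σ = -(1 / 2) ∨ σ = 1 → ∀ t ∈ Set.Icc T (2 * T), ∀ v : ℝ,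
      ‖gaussKernel y R t (σ + v * I)‖ ≤ D * T ^ (2 * σ) * Real.exp (-(v ^ 2 / 2)) := by
    intro σ hσ t ht v
    refine ((hmain σ hσ v).norm_le t ht).trans ?_
    have h3 := exp_mul_abs_sub_sq_le (2 * β) v
    calc _ = B ^ 2 * c' * (T ^ (k * σ) * T ^ (k * σ) * T ^ ((2 - 2 * k) * σ)) *
          (Real.exp (2 * β * |v|) * Real.exp (1 - v ^ 2)) := by
          rw [show 2 * β * |v| = β * |v| + β * |v| by ring, Real.exp_add]; ring
      _ ≤ B ^ 2 * c' * T ^ (2 * σ) *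
          (Real.exp (1 + (2 * β) ^ 2 / 2) * Real.exp (-(v ^ 2 / 2))) := by
          rw [hpow]
          gcongr
      _ = (B ^ 2 * c' * Real.exp (1 + (2 * β) ^ 2 / 2)) * T ^ (2 * σ) * Real.exp (-(v ^ 2 / 2)) := by
          ring
      _ ≤ _ := by
          gcongr
          rw [hD]
          linarith [show 0 ≤ 2 * B ^ 3 * c' * Real.exp (1 + (3 * β) ^ 2 / 2) by positivity]
  have hsub : ∀ σ : ℝ, σ = -(1 / 2) ∨ σ = 1 → ∀ t ∈ Set.Icc T (2 * T), ∀ t' ∈ Set.Icc T (2 * T),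
      ∀ v : ℝ, ‖gaussKernel y R t (σ + v * I) - gaussKernel y R t' (σ + v * I)‖ ≤
        D * (T ^ (2 * σ) / T) * |t - t'| * Real.exp (-(v ^ 2 / 2)) := by
    intro σ hσ t ht t' ht' v
    refine ((hmain σ hσ v).norm_sub_le t ht t' ht').trans ?_
    have h3 := exp_mul_abs_sub_sq_le (3 * β) v
    calc _ = 2 * B ^ 3 * c' * (T ^ (k * σ) * T ^ (k * σ) * T ^ ((2 - 2 * k) * σ) / T) * |t - t'| *
          (Real.exp (3 * β * |v|) * Real.exp (1 - v ^ 2)) := by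
          rw [show 3 * β * |v| = β * |v| + β * |v| + β * |v| by ring, Real.exp_add, Real.exp_add]
          ring
      _ ≤ 2 * B ^ 3 * c' * (T ^ (2 * σ) / T) * |t - t'| *
          (Real.exp (1 + (3 * β) ^ 2 / 2) * Real.exp (-(v ^ 2 / 2))) := by
          rw [hpow]
          gcongr
      _ = (2 * B ^ 3 * c' * Real.exp (1 + (3 * β) ^ 2 / 2)) * (T ^ (2 * σ) / T) * |t - t'| *
          Real.exp (-(v ^ 2 / 2)) := by
          ring
      _ ≤ _ := by
          gcongr
          rw [hD]
          linarith [show 0 ≤ B ^ 2 * c' * Real.exp (1 + (2 * β) ^ 2 / 2) by positivity]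
  have hDA : D ≤ D + 2 * B ^ 3 + B * (B + 1) := by
    linarith [show 0 ≤ 2 * B ^ 3 + B * (B + 1) by positivity]
  have hp1 : T ^ (2 * (1 : ℝ)) = T ^ 2 := by rw [mul_one]; exact_mod_cast Real.rpow_natCast T 2
  have hp2 : T ^ (2 * (-(1 / 2) : ℝ)) = 1 / T := by
    rw [show 2 * (-(1 / 2) : ℝ) = -1 by norm_num, Real.rpow_neg_one, one_div]
  have hzero : ∀ t, gaussKernel y R t 0 = R t 0 ^ 2 := fun t => by simp [gaussKernel]
  refine ⟨fun t ht => ⟨?_, ?_⟩, fun t ht v => ?_, fun t ht v => ?_, fun t ht t' ht' v => ?_,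
    fun t ht t' ht' v => ?_, fun t ht => ?_, fun t ht t' ht' => ?_⟩
  · exact ((hdiff t ht).pow 2).mul ((DifferentiableOn.const_cpow differentiableOn_id
      (Or.inl (by exact_mod_cast hy0.ne'))).mul (Differentiable.differentiableOn (by fun_prop)))
  · obtain ⟨C, hC⟩ := hstrip t ht
    refine ⟨C ^ 2 * (y + y ^ (-(1 / 2) : ℝ)) * Real.exp (1 + (2 * β) ^ 2 / 2), fun σ hσ v => ?_⟩
    have h3 := exp_mul_abs_sub_sq_le (2 * β) v
    have h4 : y ^ σ ≤ y + y ^ (-(1 / 2) : ℝ) := by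
      rcases le_total 1 y with h | h
      · have := Real.rpow_le_rpow_of_exponent_le h hσ.2
        rw [Real.rpow_one] at this
        linarith [show 0 ≤ y ^ (-(1 / 2) : ℝ) by positivity]
      · have := Real.rpow_le_rpow_of_exponent_ge hy0 h hσ.1
        linarith
    rw [gaussKernel, norm_mul, norm_pow]
    calc _ ≤ (C * Real.exp (β * |v|)) ^ 2 * (y ^ σ * Real.exp (1 - v ^ 2)) := by
          gcongr
          · exact hC σ hσ v
          · exact norm_cpow_mul_exp_sq_le hy0 hσ v
      _ = C ^ 2 * y ^ σ * (Real.exp (2 * β * |v|) * Real.exp (1 - v ^ 2)) := by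
          rw [show 2 * β * |v| = β * |v| + β * |v| by ring, Real.exp_add]; ring
      _ ≤ C ^ 2 * (y + y ^ (-(1 / 2) : ℝ)) *
          (Real.exp (1 + (2 * β) ^ 2 / 2) * Real.exp (-(v ^ 2 / 2))) := by gcongr
      _ = _ := by ring
  · refine (hnorm 1 (Or.inr rfl) t ht v).trans ?_
    rw [hp1]
    gcongr
  · refine (hnorm (-(1 / 2)) (Or.inl rfl) t ht v).trans ?_
    rw [hp2, mul_one_div]
    gcongr
  · refine (hsub 1 (Or.inr rfl) t ht t' ht' v).trans ?_
    rw [hp1, sq, mul_div_cancel_right₀ _ hT0.ne']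
    gcongr
  · refine (hsub (-(1 / 2)) (Or.inl rfl) t ht t' ht' v).trans ?_
    rw [hp2, div_div, mul_one_div, ← sq]
    gcongr
  · rw [hzero, show R t 0 ^ 2 - 1 = (R t 0 - 1) * (R t 0 + 1) by ring, norm_mul]
    calc _ ≤ B / T * (B + 1) := by
          refine mul_le_mul (h1 t ht) ((norm_add_le _ _).trans ?_) (norm_nonneg _) (by positivity)
          rw [norm_one]
          linarith [h0.norm_le t ht]
      _ = B * (B + 1) / T := by ring
      _ ≤ _ := by
          gcongr
          linarith [show 0 ≤ 2 * B ^ 3 by positivity]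
  · rw [hzero, hzero, sq, sq]
    refine ((h0.mul hT0.le h0).norm_sub_le t ht t' ht').trans ?_
    calc _ = 2 * B ^ 3 / T * |t - t'| := by ring
      _ ≤ _ := by
          gcongr
          linarith [show 0 ≤ B * (B + 1) by positivity]

/-- The ratio entering the kernel of the primal sum. -/
noncomputable def primalRatio (t : ℝ) (w : ℂ) : ℂ :=
  ((w - 1 / 2) ^ 2 + (t : ℂ) ^ 2) / (1 / 4 + (t : ℂ) ^ 2) *
    (((w + 1 / 2) ^ 2 + (t : ℂ) ^ 2) / (1 / 4 + (t : ℂ) ^ 2))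

lemma norm_strip_le {σ : ℝ} (hσ : σ ∈ Set.Icc (-(1 / 2) : ℝ) 1) (v : ℝ) :
    ‖(σ : ℂ) + v * I‖ ≤ Real.exp |v| := by
  refine (norm_add_le _ _).trans ?_
  rw [norm_mul, Complex.norm_I, mul_one, Complex.norm_real, Complex.norm_real, Real.norm_eq_abs,
    Real.norm_eq_abs]
  have h1 : |σ| ≤ 1 := abs_le.2 ⟨by linarith [hσ.1], hσ.2⟩
  linarith [Real.add_one_le_exp |v|]

lemma one_add_norm_sq_half_sub_le {w : ℂ} {v : ℝ} (hw : ‖w‖ ≤ Real.exp |v|) :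
    1 + ‖(w - 1 / 2) ^ 2 - 1 / 4‖ ≤ 3 * Real.exp (2 * |v|) ∧
      1 + ‖(w + 1 / 2) ^ 2 - 1 / 4‖ ≤ 3 * Real.exp (2 * |v|) := by
  have h1 : 1 ≤ Real.exp |v| := Real.one_le_exp (abs_nonneg v)
  have h2 : Real.exp (2 * |v|) = Real.exp |v| * Real.exp |v| := by
    rw [← Real.exp_add]; ring_nf
  have h3 : ‖w‖ * ‖w‖ ≤ Real.exp |v| * Real.exp |v| := by gcongr
  rw [h2]
  constructor
  · have : ‖(w - 1 / 2) ^ 2 - 1 / 4‖ ≤ ‖w‖ * ‖w‖ + ‖w‖ := by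
      rw [show (w - 1 / 2) ^ 2 - 1 / 4 = w * w - w by ring, ← norm_mul]
      exact norm_sub_le _ _
    nlinarith
  · have : ‖(w + 1 / 2) ^ 2 - 1 / 4‖ ≤ ‖w‖ * ‖w‖ + ‖w‖ := by
      rw [show (w + 1 / 2) ^ 2 - 1 / 4 = w * w + w by ring, ← norm_mul]
      exact norm_add_le _ _
    nlinarith

lemma isSlow_primalRatio {T : ℝ} (hT : 1 ≤ T) {w : ℂ} {v : ℝ} (hw : ‖w‖ ≤ Real.exp |v|) :
    IsSlow T (9 * Real.exp (4 * |v|)) 8 fun t => primalRatio t w := by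
  obtain ⟨h1, h2⟩ := one_add_norm_sq_half_sub_le hw
  refine ((isSlow_add_sq_div hT ((w - 1 / 2) ^ 2)).mul (by linarith)
    (isSlow_add_sq_div hT ((w + 1 / 2) ^ 2))).mono (by linarith) ?_ (by norm_num) (by norm_num)
  calc _ ≤ (3 * Real.exp (2 * |v|)) * (3 * Real.exp (2 * |v|)) := by gcongr
    _ = 9 * Real.exp (4 * |v|) := by
      rw [show 4 * |v| = 2 * |v| + 2 * |v| by ring, Real.exp_add]; ring

lemma primalRatio_zero (t : ℝ) : primalRatio t 0 = 1 := by
  have := quarter_add_sq_ne_zero t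
  rw [primalRatio, show ((0 - 1 / 2 : ℂ)) ^ 2 = 1 / 4 by norm_num,
    show ((0 + 1 / 2 : ℂ)) ^ 2 = 1 / 4 by norm_num, div_self this, one_mul]

theorem exists_isMVKernel_primal {c : ℝ} (hc : 0 < c) : ∃ A : ℝ, 0 ≤ A ∧ ∀ T : ℝ, 1 ≤ T →
    IsMVKernel A T (gaussKernel (c * T ^ (2 : ℝ)) primalRatio) := by
  obtain ⟨A, hA, h⟩ := exists_isMVKernel_gaussKernel (c := c) 0 (B := 9) 4 hc (by norm_num)
  refine ⟨A, hA, fun T hT => ?_⟩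
  have hT0 : 0 < T := by linarith
  simp only [mul_zero, sub_zero, zero_mul, Real.rpow_zero, mul_one] at h
  refine h T hT primalRatio (fun t _ => ?_) (fun t ht => ⟨9, fun σ hσ v => ?_⟩)
    (fun σ hσ v => ?_) ?_ fun t _ => ?_
  · unfold primalRatio
    exact Differentiable.differentiableOn (by fun_prop)
  · exact (isSlow_primalRatio (le_trans hT ht.1) (norm_strip_le hσ v)).norm_le t
      ⟨le_rfl, by linarith [ht.1]⟩
  · have hσ' : σ ∈ Set.Icc (-(1 / 2) : ℝ) 1 := by
      rcases hσ with rfl | rfl <;> constructor <;> norm_num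
    refine (isSlow_primalRatio hT (norm_strip_le hσ' v)).mono hT0.le le_rfl (by norm_num) ?_
    linarith [Real.one_le_exp (mul_nonneg (by norm_num : (0 : ℝ) ≤ 4) (abs_nonneg v))]
  · have := isSlow_primalRatio hT (w := 0) (v := 0) (by simp)
    simp only [abs_zero, mul_zero, Real.exp_zero, mul_one] at this
    exact this.mono hT0.le le_rfl (by norm_num) (by norm_num)
  · rw [primalRatio_zero, sub_self, norm_zero]
    positivity

lemma Gamma_half_mul_Gamma_half (y : ℝ) :
    Complex.Gamma (1 / 2 + y * I) * Complex.Gamma (1 / 2 - y * I) = (π / Real.cosh (π * y) : ℝ) := by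
  have h := Complex.Gamma_mul_Gamma_one_sub (1 / 2 + y * I)
  rw [show (1 : ℂ) - (1 / 2 + y * I) = 1 / 2 - y * I by ring,
    show (π : ℂ) * (1 / 2 + y * I) = ((π * y : ℝ) : ℂ) * I + π / 2 by push_cast; ring,
    Complex.sin_add_pi_div_two, Complex.cos_mul_I] at h
  rw [h]
  push_cast
  rfl

lemma conj_add_mul_I (x y : ℝ) : starRingEnd ℂ ((x : ℂ) + y * I) = x - y * I := by
  simp [sub_eq_add_neg]

lemma norm_Gamma_half_sq (y : ℝ) :
    ‖Complex.Gamma (1 / 2 + y * I)‖ ^ 2 = π / Real.cosh (π * y) := by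
  have h := Gamma_half_mul_Gamma_half y
  have h2 : (1 / 2 - y * I : ℂ) = starRingEnd ℂ (1 / 2 + y * I) := by
    have := conj_add_mul_I (1 / 2) y
    push_cast at this
    exact this.symm
  rw [h2, Complex.Gamma_conj, Complex.mul_conj, Complex.ofReal_inj, Complex.normSq_eq_norm_sq] at h
  exact h

lemma half_exp_abs_le_cosh (x : ℝ) : Real.exp |x| / 2 ≤ Real.cosh x := by
  rw [← Real.cosh_abs, Real.cosh_eq]
  linarith [Real.exp_pos (-|x|)]

lemma norm_Gamma_half_le (y : ℝ) :
    ‖Complex.Gamma (1 / 2 + y * I)‖ ≤ 3 * Real.exp (-(π * |y| / 2)) := by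
  refine le_of_sq_le_sq ?_ (by positivity)
  rw [norm_Gamma_half_sq, div_le_iff₀ (Real.cosh_pos _)]
  have h := half_exp_abs_le_cosh (π * y)
  rw [abs_mul, abs_of_pos Real.pi_pos] at h
  have h2 : (3 * Real.exp (-(π * |y| / 2))) ^ 2 = 9 * Real.exp (-(π * |y|)) := by
    rw [mul_pow, ← Real.exp_nat_mul]; norm_num; ring_nf
  have h3 : Real.exp (-(π * |y|)) * Real.exp (π * |y|) = 1 := by
    rw [← Real.exp_add]; simp
  rw [h2]
  have h4 := mul_le_mul_of_nonneg_left h (Real.exp_pos (-(π * |y|))).le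
  nlinarith [Real.pi_lt_d2]

lemma norm_Gamma_five_halves_le (y : ℝ) :
    ‖Complex.Gamma (5 / 2 + y * I)‖ ≤ 3 * (2 + |y|) ^ 2 * Real.exp (-(π * |y| / 2)) := by
  have hne : ∀ x : ℝ, x ≠ 0 → (x : ℂ) + y * I ≠ 0 := fun x hx => ne_zero_of_re_ne_zero hx
  have h1 : Complex.Gamma (5 / 2 + y * I) =
      ((3 / 2 : ℝ) + y * I) * (((1 / 2 : ℝ) + y * I) * Complex.Gamma (1 / 2 + y * I)) := by
    rw [show (1 / 2 + y * I : ℂ) = ((1 / 2 : ℝ) : ℂ) + y * I by push_cast; ring,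
      ← Complex.Gamma_add_one _ (hne _ (by norm_num)),
      show ((1 / 2 : ℝ) : ℂ) + y * I + 1 = ((3 / 2 : ℝ) : ℂ) + y * I by push_cast; ring,
      ← Complex.Gamma_add_one _ (hne _ (by norm_num))]
    congr 1
    push_cast
    ring
  have h2 : ∀ x : ℝ, 0 ≤ x → x ≤ 2 → ‖(x : ℂ) + y * I‖ ≤ 2 + |y| := fun x hx hx2 => by
    refine (norm_add_le _ _).trans ?_
    rw [norm_mul, Complex.norm_I, mul_one, Complex.norm_real, Complex.norm_real, Real.norm_eq_abs,
      Real.norm_eq_abs, abs_of_nonneg hx]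
    linarith
  rw [h1, norm_mul, norm_mul]
  calc _ ≤ (2 + |y|) * ((2 + |y|) * (3 * Real.exp (-(π * |y| / 2)))) := by
        gcongr
        · exact h2 _ (by norm_num) (by norm_num)
        · exact h2 _ (by norm_num) (by norm_num)
        · exact norm_Gamma_half_le y
    _ = _ := by ring

lemma div_sinh_le {x : ℝ} (hx : 0 < x) : x / Real.sinh x ≤ (1 + 2 * x) * Real.exp (-x) := by
  rw [div_le_iff₀ (Real.sinh_pos_iff.2 hx), Real.sinh_eq]
  have h1 : Real.exp (-x) * Real.exp x = 1 := by rw [← Real.exp_add]; simp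
  have h2 := Real.add_one_le_exp (2 * x)
  have h3 : Real.exp (-x) * Real.exp (-x) * Real.exp (2 * x) = 1 := by
    rw [← Real.exp_add, ← Real.exp_add]; ring_nf; simp
  have h4 := mul_le_mul_of_nonneg_left h2 (by positivity : 0 ≤ Real.exp (-x) * Real.exp (-x))
  nlinarith

lemma norm_Gamma_one_le (y : ℝ) :
    ‖Complex.Gamma (1 + y * I)‖ ≤ √(1 + 7 * |y|) * Real.exp (-(π * |y| / 2)) := by
  rcases eq_or_ne y 0 with rfl | hy
  · simp
  have hyI : (y : ℂ) * I ≠ 0 := mul_ne_zero (by exact_mod_cast hy) Complex.I_ne_zero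
  have hsinh : Real.sinh (π * y) ≠ 0 := by
    rw [Ne, Real.sinh_eq_zero]
    exact mul_ne_zero Real.pi_ne_zero hy
  have h := Complex.Gamma_mul_Gamma_one_sub (y * I)
  have h1 : Complex.Gamma (1 + y * I) * Complex.Gamma (1 - y * I) =
      (π * y / Real.sinh (π * y) : ℝ) := by
    rw [add_comm (1 : ℂ), Complex.Gamma_add_one _ hyI, mul_assoc, h,
      show (π : ℂ) * (y * I) = ((π * y : ℝ) : ℂ) * I by push_cast; ring, Complex.sin_mul_I,
      ← Complex.ofReal_sinh]
    have : ((Real.sinh (π * y) : ℝ) : ℂ) ≠ 0 := by exact_mod_cast hsinh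
    have hI := Complex.I_ne_zero
    push_cast at this ⊢
    field_simp
  have h2 : (1 - y * I : ℂ) = starRingEnd ℂ (1 + y * I) := by
    have := conj_add_mul_I 1 y
    push_cast at this
    exact this.symm
  rw [h2, Complex.Gamma_conj, Complex.mul_conj, Complex.ofReal_inj, Complex.normSq_eq_norm_sq] at h1
  refine le_of_sq_le_sq ?_ (by positivity)
  have h3 : π * y / Real.sinh (π * y) = (π * |y|) / Real.sinh (π * |y|) := by
    rcases abs_cases y with ⟨h, _⟩ | ⟨h, _⟩ <;> rw [h]
    rw [mul_neg, Real.sinh_neg, neg_div_neg_eq]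
  rw [h1, h3, mul_pow, Real.sq_sqrt (by positivity), ← Real.exp_nat_mul]
  have hpos : 0 < π * |y| := mul_pos Real.pi_pos (abs_pos.2 hy)
  refine (div_sinh_le hpos).trans ?_
  have h4 : Real.exp (((2 : ℕ) : ℝ) * -(π * |y| / 2)) = Real.exp (-(π * |y|)) := by
    congr 1; push_cast; ring
  rw [h4]
  refine mul_le_mul_of_nonneg_right ?_ (Real.exp_pos _).le
  nlinarith [Real.pi_lt_d2, abs_nonneg y]

lemma norm_le_of_forall_norm_sub_le_exp {f : ℝ → ℂ} {a b M D : ℝ} (hM : 0 ≤ M) (hD : 0 ≤ D)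
    (h : ∀ x ∈ Set.Icc a b, ∀ y ∈ Set.Icc a b,
      ‖f x - f y‖ ≤ M * (Real.exp (D * |x - y|) - 1)) {x y : ℝ} (hx : x ∈ Set.Icc a b)
    (hy : y ∈ Set.Icc a b) : ‖f x - f y‖ ≤ 2 * M * D * |x - y| := by
  obtain ⟨N, hN⟩ := exists_nat_ge (D * |x - y| + 1)
  have hN0 : (0 : ℝ) < N := by
    have : 0 ≤ D * |x - y| := by positivity
    linarith
  set p : ℕ → ℝ := fun i => y + (x - y) * (i / N) with hp
  have hpmem : ∀ i ∈ range (N + 1), p i ∈ Set.Icc a b := fun i hi => by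
    have h1 : (i : ℝ) / N ≤ 1 := (div_le_one hN0).2 (by
      exact_mod_cast Nat.lt_succ_iff.1 (mem_range.1 hi))
    have h2 : 0 ≤ (i : ℝ) / N := by positivity
    have := (convex_Icc a b) hy hx (a := 1 - (i : ℝ) / N) (b := (i : ℝ) / N) (by linarith) h2
      (by ring)
    convert this using 1
    simp only [hp, smul_eq_mul]
    ring
  have hstep : ∀ i ∈ range N, ‖f (p (i + 1)) - f (p i)‖ ≤ M * (2 * (D * |x - y| / N)) := by
    intro i hi
    refine (h _ (hpmem _ (by simp at hi ⊢; omega)) _ (hpmem _ (by simp at hi ⊢; omega))).trans ?_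
    have h1 : |p (i + 1) - p i| = |x - y| / N := by
      rw [show p (i + 1) - p i = (x - y) / N by simp only [hp]; push_cast; ring, abs_div,
        abs_of_pos hN0]
    rw [h1, ← mul_div_assoc]
    have h2 : |D * |x - y| / N| ≤ 1 := by
      rw [abs_of_nonneg (by positivity), div_le_one hN0]
      linarith
    have h3 := (le_abs_self _).trans (Real.abs_exp_sub_one_le h2)
    rw [abs_of_nonneg (a := D * |x - y| / N) (by positivity)] at h3
    gcongr
  have htel : f x - f y = ∑ i ∈ range N, (f (p (i + 1)) - f (p i)) := by
    rw [Finset.sum_range_sub (fun i => f (p i))]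
    congr 2
    · simp only [hp]
      rw [div_self hN0.ne']
      ring
    · simp [hp]
  rw [htel]
  refine (norm_sum_le _ _).trans ((Finset.sum_le_sum hstep).trans_eq ?_)
  rw [Finset.sum_const, card_range, nsmul_eq_mul]
  field_simp

lemma norm_Gamma_ratio_sub_one_le {z₁ z₂ a : ℂ} {p : ℝ} {S : ℕ → ℝ}
    (h₁ : ∀ j : ℕ, z₁ + j ≠ 0) (h₂ : ∀ j : ℕ, z₂ + j ≠ 0) (h₃ : ∀ j : ℕ, z₁ + a + j ≠ 0)
    (h₄ : ∀ j : ℕ, z₂ + a + j ≠ 0)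
    (hS : ∀ j : ℕ, ‖a * (z₂ - z₁) / ((z₂ + a + j) * (z₁ + j))‖ ≤ S j)
    (hp : ∀ n, ∑ j ∈ range n, S j ≤ p) :
    ‖Complex.Gamma (z₂ + a) * Complex.Gamma z₁ / (Complex.Gamma z₂ * Complex.Gamma (z₁ + a)) - 1‖ ≤
      Real.exp p - 1 := by
  have hG : ∀ z : ℂ, (∀ j : ℕ, z + j ≠ 0) → Complex.Gamma z ≠ 0 := fun z hz =>
    Complex.Gamma_ne_zero fun m h => hz m (by rw [h]; ring)
  have hlim : Tendsto (fun n : ℕ => Complex.GammaSeq (z₂ + a) n * Complex.GammaSeq z₁ n /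
      (Complex.GammaSeq z₂ n * Complex.GammaSeq (z₁ + a) n)) atTop (nhds
      (Complex.Gamma (z₂ + a) * Complex.Gamma z₁ / (Complex.Gamma z₂ * Complex.Gamma (z₁ + a)))) :=
    ((Complex.GammaSeq_tendsto_Gamma _).mul (Complex.GammaSeq_tendsto_Gamma _)).div
      ((Complex.GammaSeq_tendsto_Gamma _).mul (Complex.GammaSeq_tendsto_Gamma _))
      (mul_ne_zero (hG _ h₂) (hG _ h₃))
  refine le_of_tendsto (hlim.sub_const 1).norm ?_
  filter_upwards [eventually_gt_atTop 0] with n hn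
  have hn0 : (n : ℂ) ≠ 0 := by exact_mod_cast hn.ne'
  have hprod : Complex.GammaSeq (z₂ + a) n * Complex.GammaSeq z₁ n /
      (Complex.GammaSeq z₂ n * Complex.GammaSeq (z₁ + a) n) =
      ∏ j ∈ range (n + 1), (1 + a * (z₂ - z₁) / ((z₂ + a + j) * (z₁ + j))) := by
    have e1 : ∏ j ∈ range (n + 1), (1 + a * (z₂ - z₁) / ((z₂ + a + j) * (z₁ + j))) =
        ((∏ j ∈ range (n + 1), (z₂ + j)) * ∏ j ∈ range (n + 1), (z₁ + a + j)) /
        ((∏ j ∈ range (n + 1), (z₂ + a + j)) * ∏ j ∈ range (n + 1), (z₁ + j)) := by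
      rw [← Finset.prod_mul_distrib, ← Finset.prod_mul_distrib, ← Finset.prod_div_distrib]
      refine Finset.prod_congr rfl fun j _ => ?_
      have := h₁ j
      have := h₄ j
      field_simp
      ring
    rw [e1]
    have d1 : ∏ j ∈ range (n + 1), (z₁ + j) ≠ 0 := Finset.prod_ne_zero_iff.2 fun j _ => h₁ j
    have d2 : ∏ j ∈ range (n + 1), (z₂ + j) ≠ 0 := Finset.prod_ne_zero_iff.2 fun j _ => h₂ j
    have d3 : ∏ j ∈ range (n + 1), (z₁ + a + j) ≠ 0 := Finset.prod_ne_zero_iff.2 fun j _ => h₃ j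
    have d4 : ∏ j ∈ range (n + 1), (z₂ + a + j) ≠ 0 := Finset.prod_ne_zero_iff.2 fun j _ => h₄ j
    have d5 : ((n.factorial : ℕ) : ℂ) ≠ 0 := by exact_mod_cast n.factorial_ne_zero
    have d6 : ∀ z : ℂ, (n : ℂ) ^ z ≠ 0 := fun z => by
      rw [Ne, Complex.cpow_eq_zero_iff]
      tauto
    have d7 := d6 z₁
    have d8 := d6 z₂
    have d9 := d6 a
    simp only [Complex.GammaSeq]
    rw [Complex.cpow_add _ _ hn0, Complex.cpow_add _ _ hn0]
    field_simp
  rw [hprod]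
  refine (Finset.norm_prod_one_add_sub_one_le _ _).trans ?_
  gcongr
  exact (Finset.sum_le_sum fun j _ => hS j).trans (hp _)

lemma norm_mul_sub_one_le_exp {x y : ℂ} {p : ℝ} (hx : ‖x - 1‖ ≤ Real.exp p - 1)
    (hy : ‖y - 1‖ ≤ Real.exp p - 1) : ‖x * y - 1‖ ≤ Real.exp (2 * p) - 1 := by
  have h0 := norm_nonneg (x - 1)
  have h1 := norm_nonneg (y - 1)
  have h2 : Real.exp (2 * p) = Real.exp p * Real.exp p := by rw [← Real.exp_add]; ring_nf
  calc ‖x * y - 1‖ = ‖(x - 1) * (y - 1) + (x - 1) + (y - 1)‖ := by ring_nf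
    _ ≤ ‖x - 1‖ * ‖y - 1‖ + ‖x - 1‖ + ‖y - 1‖ := by
        rw [← norm_mul]; exact norm_add₃_le
    _ ≤ (Real.exp p - 1) * (Real.exp p - 1) + (Real.exp p - 1) + (Real.exp p - 1) := by
        gcongr; linarith
    _ = _ := by rw [h2]; ring

lemma norm_Gamma_ratio_half_sub_one_le {T : ℝ} (hT : 1 ≤ T) {a : ℂ} (ha : 1 / 2 ≤ a.re) {ε : ℝ}
    (hε : |ε| = 1) {t₁ t₂ : ℝ} (h₁ : T ≤ t₁) (h₂ : T ≤ t₂) :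
    ‖Complex.Gamma (1 / 2 + (ε * t₂ : ℝ) * I + a) * Complex.Gamma (1 / 2 + (ε * t₁ : ℝ) * I) /
      (Complex.Gamma (1 / 2 + (ε * t₂ : ℝ) * I) * Complex.Gamma (1 / 2 + (ε * t₁ : ℝ) * I + a)) - 1‖
      ≤ Real.exp (16 * ‖a‖ * (1 + |a.im|) * |t₂ - t₁| / T) - 1 := by
  have hT0 : 0 < T := by linarith
  have hne : ∀ z : ℂ, 0 < z.re → ∀ j : ℕ, z + j ≠ 0 := fun z hz j h => by
    have := congrArg Complex.re h
    simp at this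
    linarith [j.cast_nonneg (α := ℝ)]
  have hre : ∀ t : ℝ, ((1 / 2 : ℂ) + (ε * t : ℝ) * I).re = 1 / 2 := fun t => by
    rw [Complex.add_re, Complex.re_ofReal_mul]; simp
  have him : ∀ t : ℝ, ((1 / 2 : ℂ) + (ε * t : ℝ) * I).im = ε * t := fun t => by
    rw [Complex.add_im, Complex.im_ofReal_mul]; simp
  refine norm_Gamma_ratio_sub_one_le
    (S := fun j : ℕ => 16 * ‖a‖ * (1 + |a.im|) * |t₂ - t₁| * (1 / (T + j) - 1 / (T + (j + 1 : ℕ))))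
    (hne _ (by rw [hre]; norm_num)) (hne _ (by rw [hre]; norm_num))
    (hne _ (by rw [Complex.add_re, hre]; linarith))
    (hne _ (by rw [Complex.add_re, hre]; linarith)) (fun j => ?_) fun n => ?_
  · have hj := j.cast_nonneg (α := ℝ)
    have l1 : (T + j + 1) / 4 ≤ ‖(1 / 2 : ℂ) + (ε * t₁ : ℝ) * I + j‖ := by
      have e1 := Complex.abs_re_le_norm ((1 / 2 : ℂ) + (ε * t₁ : ℝ) * I + j)
      have e2 := Complex.abs_im_le_norm ((1 / 2 : ℂ) + (ε * t₁ : ℝ) * I + j)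
      rw [Complex.add_re, hre, Complex.natCast_re, abs_of_nonneg (by positivity)] at e1
      rw [Complex.add_im, him, Complex.natCast_im, add_zero, abs_mul, hε, one_mul,
        abs_of_nonneg (by linarith)] at e2
      linarith
    have l2 : (T + j + 1) / (4 * (1 + |a.im|)) ≤ ‖(1 / 2 : ℂ) + (ε * t₂ : ℝ) * I + a + j‖ := by
      have e1 := (le_abs_self _).trans
        (Complex.abs_re_le_norm ((1 / 2 : ℂ) + (ε * t₂ : ℝ) * I + a + j))
      have e2 := Complex.abs_im_le_norm ((1 / 2 : ℂ) + (ε * t₂ : ℝ) * I + a + j)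
      rw [Complex.add_re, Complex.add_re, hre, Complex.natCast_re] at e1
      rw [Complex.add_im, Complex.add_im, him, Complex.natCast_im, add_zero] at e2
      have e3 : |ε * t₂| ≤ |ε * t₂ + a.im| + |a.im| := by
        have := abs_sub (ε * t₂ + a.im) a.im
        simpa using this
      rw [abs_mul, hε, one_mul, abs_of_nonneg (by linarith)] at e3
      have hv := abs_nonneg a.im
      rw [div_le_iff₀ (by positivity)]
      set N := ‖(1 / 2 : ℂ) + (ε * t₂ : ℝ) * I + a + j‖
      nlinarith [mul_nonneg hv (by linarith : 0 ≤ N - 1)]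
    have hΔ : ‖((1 / 2 : ℂ) + (ε * t₂ : ℝ) * I) - (1 / 2 + (ε * t₁ : ℝ) * I)‖ = |t₂ - t₁| := by
      rw [show ((1 / 2 : ℂ) + (ε * t₂ : ℝ) * I) - (1 / 2 + (ε * t₁ : ℝ) * I) =
        ((ε * (t₂ - t₁) : ℝ) : ℂ) * I by push_cast; ring, norm_mul, Complex.norm_I, mul_one,
        Complex.norm_real, Real.norm_eq_abs, abs_mul, hε, one_mul]
    rw [norm_div, norm_mul, norm_mul, hΔ]
    have hv := abs_nonneg a.im
    calc _ ≤ ‖a‖ * |t₂ - t₁| / ((T + j + 1) / (4 * (1 + |a.im|)) * ((T + j + 1) / 4)) := by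
          gcongr
      _ = 16 * ‖a‖ * (1 + |a.im|) * |t₂ - t₁| * (1 / (T + j + 1) ^ 2) := by
          have : 0 < T + j + 1 := by positivity
          field_simp
          norm_num
      _ ≤ _ := by
          gcongr
          rw [div_sub_div _ _ (by positivity) (by positivity), div_le_div_iff₀ (by positivity)
            (by positivity)]
          push_cast
          nlinarith
  · rw [← Finset.mul_sum, Finset.sum_range_sub' (fun j : ℕ => 1 / (T + (j : ℝ))),
      mul_div_assoc _ _ T, mul_assoc _ (|t₂ - t₁|)]
    have : (0 : ℝ) ≤ 1 / (T + n) := by positivity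
    have hv := abs_nonneg a.im
    rw [div_eq_mul_one_div (|t₂ - t₁|)]
    gcongr
    simp only [Nat.cast_zero, add_zero]
    linarith

/-- `Γ(1/2 + a + it) Γ(1/2 + a - it)` normalized by its value at `a = 0`. -/
noncomputable def gammaPairRatio (a : ℂ) (t : ℝ) : ℂ :=
  Complex.Gamma (1 / 2 + a + t * I) * Complex.Gamma (1 / 2 + a - t * I) *
    ((Real.cosh (π * t) / π : ℝ) : ℂ)

lemma gammaPairRatio_eq (a : ℂ) (t : ℝ) : gammaPairRatio a t =
    Complex.Gamma (1 / 2 + a + t * I) * Complex.Gamma (1 / 2 + a - t * I) /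
      (Complex.Gamma (1 / 2 + t * I) * Complex.Gamma (1 / 2 - t * I)) := by
  rw [Gamma_half_mul_Gamma_half, gammaPairRatio, div_eq_mul_inv _ (Complex.ofReal _),
    ← Complex.ofReal_inv, inv_div]

lemma norm_gammaPairRatio_div_sub_one_le {T : ℝ} (hT : 1 ≤ T) {a : ℂ} (ha : 1 / 2 ≤ a.re)
    {t₁ t₂ : ℝ} (h₁ : T ≤ t₁) (h₂ : T ≤ t₂) :
    ‖gammaPairRatio a t₂ / gammaPairRatio a t₁ - 1‖ ≤
      Real.exp (32 * ‖a‖ * (1 + |a.im|) / T * |t₂ - t₁|) - 1 := by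
  have e1 := norm_Gamma_ratio_half_sub_one_le hT ha (ε := 1) (by norm_num) h₁ h₂
  have e2 := norm_Gamma_ratio_half_sub_one_le hT ha (ε := -1) (by norm_num) h₁ h₂
  have := norm_mul_sub_one_le_exp e1 e2
  rw [show 2 * (16 * ‖a‖ * (1 + |a.im|) * |t₂ - t₁| / T) =
    32 * ‖a‖ * (1 + |a.im|) / T * |t₂ - t₁| by ring] at this
  refine le_of_eq_of_le ?_ this
  congr 2
  rw [gammaPairRatio_eq, gammaPairRatio_eq]
  simp only [one_mul, neg_mul, Complex.ofReal_neg, ← sub_eq_add_neg]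
  rw [add_right_comm _ _ a, add_right_comm _ _ a, sub_add_eq_add_sub, sub_add_eq_add_sub]
  have hre : ∀ (z : ℂ) (s : ℝ), 0 < z.re → Complex.Gamma (z + s * I) ≠ 0 := fun z s hz =>
    Complex.Gamma_ne_zero_of_re_pos (by simpa using hz)
  have hre' : ∀ (z : ℂ) (s : ℝ), 0 < z.re → Complex.Gamma (z - s * I) ≠ 0 := fun z s hz =>
    Complex.Gamma_ne_zero_of_re_pos (by simpa using hz)
  have ha' : 0 < (1 / 2 + a).re := by rw [Complex.add_re]; norm_num; linarith
  have g1 := hre _ t₁ ha'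
  have g2 := hre _ t₂ ha'
  have g3 := hre' _ t₁ ha'
  have g4 := hre' _ t₂ ha'
  have g5 := hre (1 / 2) t₁ (by norm_num)
  have g6 := hre (1 / 2) t₂ (by norm_num)
  have g7 := hre' (1 / 2) t₁ (by norm_num)
  have g8 := hre' (1 / 2) t₂ (by norm_num)
  generalize Complex.Gamma (1 / 2 + a + t₁ * I) = x1 at *
  generalize Complex.Gamma (1 / 2 + a + t₂ * I) = x2 at *
  generalize Complex.Gamma (1 / 2 + a - t₁ * I) = x3 at *
  generalize Complex.Gamma (1 / 2 + a - t₂ * I) = x4 at *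
  generalize Complex.Gamma (1 / 2 + t₁ * I) = x5 at *
  generalize Complex.Gamma (1 / 2 + t₂ * I) = x6 at *
  generalize Complex.Gamma (1 / 2 - t₁ * I) = x7 at *
  generalize Complex.Gamma (1 / 2 - t₂ * I) = x8 at *
  field_simp

lemma gammaPairRatio_ne_zero {a : ℂ} (ha : 1 / 2 ≤ a.re) (t : ℝ) : gammaPairRatio a t ≠ 0 := by
  refine mul_ne_zero (mul_ne_zero ?_ ?_) ?_
  · refine Complex.Gamma_ne_zero_of_re_pos ?_
    simp; linarith
  · refine Complex.Gamma_ne_zero_of_re_pos ?_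
    simp; linarith
  · exact_mod_cast (div_pos (Real.cosh_pos _) Real.pi_pos).ne'

lemma isSlow_gammaPairRatio {T : ℝ} (hT : 1 ≤ T) {a : ℂ} (ha : 1 / 2 ≤ a.re) {M : ℝ}
    (hM : ∀ t ∈ Set.Icc T (2 * T), ‖gammaPairRatio a t‖ ≤ M) :
    IsSlow T M (64 * ‖a‖ * (1 + |a.im|)) (gammaPairRatio a) := by
  have hT0 : 0 < T := by linarith
  have hM0 : 0 ≤ M := (norm_nonneg _).trans (hM T ⟨le_rfl, by linarith⟩)
  have hv := abs_nonneg a.im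
  refine ⟨hM, fun t ht t' ht' => ?_⟩
  refine (norm_le_of_forall_norm_sub_le_exp (M := M) (D := 32 * ‖a‖ * (1 + |a.im|) / T) hM0
    (by positivity) (fun x hx y hy => ?_) ht ht').trans_eq (by ring)
  have h := norm_gammaPairRatio_div_sub_one_le hT ha hy.1 hx.1
  calc ‖gammaPairRatio a x - gammaPairRatio a y‖ =
        ‖gammaPairRatio a y‖ * ‖gammaPairRatio a x / gammaPairRatio a y - 1‖ := by
        rw [← norm_mul, mul_sub, mul_one, mul_div_cancel₀ _ (gammaPairRatio_ne_zero ha y)]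
    _ ≤ _ := mul_le_mul (hM y hy) h (norm_nonneg _) hM0

lemma norm_gammaPairRatio_le {T : ℝ} (hT : 1 ≤ T) {σ : ℝ} (hσ : σ = -(1 / 2) ∨ σ = 1) (v : ℝ)
    {t : ℝ} (ht : t ∈ Set.Icc T (2 * T)) :
    ‖gammaPairRatio (1 + (σ + v * I)) t‖ ≤ 1000 * T ^ (2 + 2 * σ) * Real.exp (4 * |v|) := by
  have hT0 : 0 < T := by linarith
  have ht0 : 0 < t := by linarith [ht.1]
  have hcosh : Real.cosh (π * t) / π ≤ Real.exp (π * t) / 3 := by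
    have : Real.cosh (π * t) ≤ Real.exp (π * t) := by
      rw [Real.cosh_eq]
      have : Real.exp (-(π * t)) ≤ Real.exp (π * t) := Real.exp_le_exp.2 (by
        have := mul_pos Real.pi_pos ht0
        linarith)
      linarith
    have := Real.pi_gt_three
    gcongr
  have a1 : |v + t| ≤ |v| + 2 * T := by
    refine (abs_add_le _ _).trans ?_
    rw [abs_of_pos ht0]; linarith [ht.2]
  have a2 : |v - t| ≤ |v| + 2 * T := by
    refine (abs_sub _ _).trans ?_
    rw [abs_of_pos ht0]; linarith [ht.2]
  have a3 : 2 * t ≤ |v + t| + |v - t| := by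
    linarith [le_abs_self (v + t), neg_le_abs (v - t)]
  have hexp : Real.exp (-(π * |v + t| / 2)) * Real.exp (-(π * |v - t| / 2)) * Real.exp (π * t)
      ≤ 1 := by
    rw [← Real.exp_add, ← Real.exp_add, Real.exp_le_one_iff]
    nlinarith [Real.pi_pos]
  have hv := abs_nonneg v
  have hev := Real.add_one_le_exp |v|
  have hpos := Real.exp_pos |v|
  rw [gammaPairRatio, norm_mul, norm_mul, Complex.norm_real, Real.norm_eq_abs,
    abs_of_pos (div_pos (Real.cosh_pos _) Real.pi_pos)]
  rcases hσ with rfl | rfl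
  · rw [show (1 / 2 + (1 + ((-(1 / 2) : ℝ) + v * I)) + t * I : ℂ) = 1 + (v + t : ℝ) * I by
      push_cast; ring, show (1 / 2 + (1 + ((-(1 / 2) : ℝ) + v * I)) - t * I : ℂ) =
      1 + (v - t : ℝ) * I by push_cast; ring]
    have hs : ∀ x : ℝ, |x| ≤ |v| + 2 * T → √(1 + 7 * |x|) ≤ √(15 * T * Real.exp |v|) := by
      intro x hx
      refine Real.sqrt_le_sqrt ?_
      nlinarith
    calc _ ≤ (√(15 * T * Real.exp |v|) * Real.exp (-(π * |v + t| / 2))) *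
          (√(15 * T * Real.exp |v|) * Real.exp (-(π * |v - t| / 2))) * (Real.exp (π * t) / 3) := by
          gcongr
          · exact (norm_Gamma_one_le _).trans
              (mul_le_mul_of_nonneg_right (hs _ a1) (Real.exp_pos _).le)
          · exact (norm_Gamma_one_le _).trans
              (mul_le_mul_of_nonneg_right (hs _ a2) (Real.exp_pos _).le)
      _ = √(15 * T * Real.exp |v|) * √(15 * T * Real.exp |v|) / 3 *
          (Real.exp (-(π * |v + t| / 2)) * Real.exp (-(π * |v - t| / 2)) * Real.exp (π * t)) := by
          ring
      _ ≤ √(15 * T * Real.exp |v|) * √(15 * T * Real.exp |v|) / 3 * 1 := by gcongr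
      _ = 5 * T * Real.exp |v| := by
          rw [Real.mul_self_sqrt (by positivity)]; ring
      _ ≤ _ := by
          rw [show 2 + 2 * (-(1 / 2) : ℝ) = 1 by norm_num, Real.rpow_one]
          have : Real.exp |v| ≤ Real.exp (4 * |v|) := Real.exp_le_exp.2 (by linarith)
          gcongr
          norm_num
  · rw [show (1 / 2 + (1 + ((1 : ℝ) + v * I)) + t * I : ℂ) = 5 / 2 + (v + t : ℝ) * I by
      push_cast; ring, show (1 / 2 + (1 + ((1 : ℝ) + v * I)) - t * I : ℂ) =
      5 / 2 + (v - t : ℝ) * I by push_cast; ring]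
    have hs : ∀ x : ℝ, |x| ≤ |v| + 2 * T → 2 + |x| ≤ 4 * T * Real.exp |v| := by
      intro x hx
      nlinarith
    calc _ ≤ (3 * (4 * T * Real.exp |v|) ^ 2 * Real.exp (-(π * |v + t| / 2))) *
          (3 * (4 * T * Real.exp |v|) ^ 2 * Real.exp (-(π * |v - t| / 2))) *
          (Real.exp (π * t) / 3) := by
          gcongr
          · exact (norm_Gamma_five_halves_le _).trans (by gcongr; exact hs _ a1)
          · exact (norm_Gamma_five_halves_le _).trans (by gcongr; exact hs _ a2)
      _ = 768 * (T ^ 4 * Real.exp |v| ^ 4) *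
          (Real.exp (-(π * |v + t| / 2)) * Real.exp (-(π * |v - t| / 2)) * Real.exp (π * t)) := by
          ring
      _ ≤ 768 * (T ^ 4 * Real.exp |v| ^ 4) * 1 := by gcongr
      _ ≤ _ := by
          rw [show 2 + 2 * (1 : ℝ) = ((4 : ℕ) : ℝ) by norm_num, Real.rpow_natCast,
            ← Real.exp_nat_mul]
          push_cast
          rw [mul_one, mul_assoc]
          gcongr
          norm_num

lemma isSlow_logistic {T : ℝ} (hT : 1 ≤ T) :
    IsSlow T 1 1 fun t => ((1 / (1 + Real.exp (-(2 * π * t))) : ℝ) : ℂ) := by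
  have hT0 : 0 < T := by linarith
  have hpos : ∀ t : ℝ, 0 < 1 + Real.exp (-(2 * π * t)) := fun t => by positivity
  refine ⟨fun t _ => ?_, fun t ht t' ht' => ?_⟩
  · rw [Complex.norm_real, Real.norm_eq_abs, abs_of_pos (one_div_pos.2 (hpos t)),
      div_le_one (hpos t)]
    linarith [Real.exp_pos (-(2 * π * t))]
  · have key : ∀ x y : ℝ, T ≤ x → x ≤ y →
        |Real.exp (-(2 * π * x)) - Real.exp (-(2 * π * y))| ≤ 1 / T * |x - y| := by
      intro x y hx hxy
      have e1 : Real.exp (-(2 * π * y)) =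
          Real.exp (-(2 * π * x)) * Real.exp (-(2 * π * (y - x))) := by
        rw [← Real.exp_add]; ring_nf
      have e2 := Real.add_one_le_exp (-(2 * π * (y - x)))
      have e3 : Real.exp (-(2 * π * x)) * (2 * π * T) ≤ 1 := by
        have : Real.exp (-(2 * π * x)) * Real.exp (2 * π * x) = 1 := by rw [← Real.exp_add]; simp
        rw [← this]
        gcongr
        have := Real.add_one_le_exp (2 * π * x)
        nlinarith [Real.pi_pos]
      have e4 : Real.exp (-(2 * π * x)) * (2 * π) ≤ 1 / T := by
        rw [le_div_iff₀ hT0]; linarith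
      have e5 : Real.exp (-(2 * π * (y - x))) ≤ 1 := by
        rw [Real.exp_le_one_iff]
        nlinarith [mul_nonneg Real.pi_pos.le (by linarith : 0 ≤ y - x)]
      have e6 := Real.exp_pos (-(2 * π * x))
      rw [e1, abs_of_nonneg (by nlinarith), abs_sub_comm, abs_of_nonneg (by linarith : 0 ≤ y - x)]
      nlinarith [mul_le_mul_of_nonneg_right e4 (by linarith : 0 ≤ y - x)]
    have key2 : |Real.exp (-(2 * π * t')) - Real.exp (-(2 * π * t))| ≤ 1 / T * |t - t'| := by
      rcases le_total t t' with h | h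
      · rw [abs_sub_comm]; exact key _ _ ht.1 h
      · rw [abs_sub_comm t]; exact key _ _ ht'.1 h
    rw [← Complex.ofReal_sub, Complex.norm_real, Real.norm_eq_abs, mul_one,
      div_sub_div _ _ (hpos t).ne' (hpos t').ne', abs_div]
    refine (div_le_self (abs_nonneg _) ?_).trans (le_of_eq_of_le ?_ key2)
    · rw [abs_of_pos (mul_pos (hpos t) (hpos t'))]
      nlinarith [Real.exp_pos (-(2 * π * t)), Real.exp_pos (-(2 * π * t')),
        mul_pos (Real.exp_pos (-(2 * π * t))) (Real.exp_pos (-(2 * π * t')))]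
    · ring_nf

lemma norm_Gamma_le_of_re_pos {z : ℂ} (hz : 0 < z.re) : ‖Complex.Gamma z‖ ≤ Real.Gamma z.re := by
  rw [Complex.Gamma_eq_integral hz, Real.Gamma_eq_integral hz, Complex.GammaIntegral]
  refine (norm_integral_le_integral_norm _).trans_eq ?_
  refine setIntegral_congr_fun measurableSet_Ioi fun x hx => ?_
  rw [norm_mul, Complex.norm_cpow_eq_rpow_re_of_pos hx, Complex.norm_real,
    Real.norm_of_nonneg (Real.exp_pos _).le]
  simp

lemma exists_norm_Gamma_le {a b : ℝ} (ha : 0 < a) :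
    ∃ G : ℝ, ∀ z : ℂ, a ≤ z.re → z.re ≤ b → ‖Complex.Gamma z‖ ≤ G := by
  have hc : ContinuousOn Real.Gamma (Set.Icc a b) := fun x hx =>
    (Real.differentiableAt_Gamma fun m h => by
      have := hx.1
      linarith [m.cast_nonneg (α := ℝ)]).continuousAt.continuousWithinAt
  obtain ⟨G, hG⟩ := isCompact_Icc.exists_bound_of_continuousOn hc
  refine ⟨G, fun z hz hz' => ?_⟩
  have h0 : 0 < z.re := by linarith
  refine (norm_Gamma_le_of_re_pos h0).trans ((le_abs_self _).trans (hG _ ⟨hz, hz'⟩))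

/-- The ratio entering the kernel of the dual sum. -/
noncomputable def dualRatio (t : ℝ) (u : ℂ) : ℂ :=
  (2 * π : ℂ) ^ (-1 - 2 * u) *
    (Complex.Gamma (3 / 2 + u + t * I) * Complex.Gamma (3 / 2 + u - t * I)) *
    (Real.exp (π * t) : ℂ) * (((u - 1 / 2) ^ 2 + (t : ℂ) ^ 2) / (1 / 4 + (t : ℂ) ^ 2)) *
    (1 / 4 + (t : ℂ) ^ 2)⁻¹

lemma dualRatio_eq (t : ℝ) (u : ℂ) : dualRatio t u =
    (2 * π : ℂ) ^ (-2 * u) * gammaPairRatio (1 + u) t *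
      ((1 / (1 + Real.exp (-(2 * π * t))) : ℝ) : ℂ) *
      (((u - 1 / 2) ^ 2 + (t : ℂ) ^ 2) / (1 / 4 + (t : ℂ) ^ 2)) * (1 / 4 + (t : ℂ) ^ 2)⁻¹ := by
  have h2π : (2 * π : ℂ) ≠ 0 := by exact_mod_cast Real.two_pi_pos.ne'
  have h1 : (Real.exp (π * t) : ℂ) = 2 * π * (((Real.cosh (π * t) / π : ℝ) : ℂ) *
      ((1 / (1 + Real.exp (-(2 * π * t))) : ℝ) : ℂ)) := by
    have h0 : Real.exp (π * t) = 2 * π * ((Real.cosh (π * t) / π) *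
        (1 / (1 + Real.exp (-(2 * π * t))))) := by
      have e1 : Real.exp (-(2 * π * t)) = Real.exp (-(π * t)) / Real.exp (π * t) := by
        rw [← Real.exp_sub]; ring_nf
      have := Real.exp_pos (π * t)
      have := Real.exp_pos (-(π * t))
      have := Real.pi_pos
      rw [e1, Real.cosh_eq]
      field_simp
    rw [h0]
    push_cast
    ring
  have h2 : (2 * π : ℂ) ^ (-1 - 2 * u) = (2 * π : ℂ)⁻¹ * (2 * π : ℂ) ^ (-2 * u) := by
    rw [show -1 - 2 * u = -1 + -2 * u by ring, Complex.cpow_add _ _ h2π, Complex.cpow_neg_one]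
  rw [dualRatio, gammaPairRatio, h1, h2, show 1 / 2 + (1 + u) = 3 / 2 + u by ring]
  field_simp

lemma dualRatio_zero (t : ℝ) : dualRatio t 0 = ((1 / (1 + Real.exp (-(2 * π * t))) : ℝ) : ℂ) := by
  have hq := quarter_add_sq_ne_zero t
  have h3 : ∀ z : ℂ, z.re = 1 / 2 → Complex.Gamma (z + 1) = z * Complex.Gamma z := fun z hz =>
    Complex.Gamma_add_one z fun h => by norm_num [h] at hz
  have h1 : gammaPairRatio (1 + 0) t = 1 / 4 + (t : ℂ) ^ 2 := by
    have hre : ((1 : ℂ) / 2 + t * I).re = 1 / 2 := by simp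
    have hre' : ((1 : ℂ) / 2 - t * I).re = 1 / 2 := by simp
    have hc : ((Real.cosh (π * t) / π : ℝ) : ℂ) ≠ 0 := by
      exact_mod_cast (div_pos (Real.cosh_pos _) Real.pi_pos).ne'
    have hI : (1 / 2 + t * I : ℂ) * (1 / 2 - t * I) = 1 / 4 + (t : ℂ) ^ 2 := by
      linear_combination (-(t : ℂ) ^ 2) * Complex.I_sq
    rw [gammaPairRatio, show (1 / 2 + (1 + 0) + t * I : ℂ) = 1 / 2 + t * I + 1 by ring,
      show (1 / 2 + (1 + 0) - t * I : ℂ) = 1 / 2 - t * I + 1 by ring, h3 _ hre, h3 _ hre',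
      mul_mul_mul_comm, Gamma_half_mul_Gamma_half, hI, ← inv_div (Real.cosh _), mul_assoc,
      Complex.ofReal_inv, inv_mul_cancel₀ hc, mul_one]
  rw [dualRatio_eq, h1, show ((0 - 1 / 2 : ℂ)) ^ 2 = 1 / 4 by norm_num, div_self hq]
  simp only [mul_zero, Complex.cpow_zero, one_mul, mul_one]
  rw [mul_right_comm, mul_inv_cancel₀ hq, one_mul]

lemma isSlow_dualRatio {T : ℝ} (hT : 1 ≤ T) {σ : ℝ} (hσ : σ = -(1 / 2) ∨ σ = 1) (v : ℝ) :
    IsSlow T (21000 * T ^ (2 * σ) * Real.exp (6 * |v|)) (21000 * Real.exp (6 * |v|))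
      fun t => dualRatio t (σ + v * I) := by
  have hT0 : 0 < T := by linarith
  have hσ' : σ ∈ Set.Icc (-(1 / 2) : ℝ) 1 := by
    rcases hσ with rfl | rfl <;> constructor <;> norm_num
  have hw := norm_strip_le hσ' v
  have hev := Real.add_one_le_exp |v|
  have h1v : 1 ≤ Real.exp |v| := Real.one_le_exp (abs_nonneg v)
  have hre : (1 + ((σ : ℂ) + v * I)).re = 1 + σ := by simp
  have him : (1 + ((σ : ℂ) + v * I)).im = v := by simp
  have ha : ‖(1 : ℂ) + ((σ : ℂ) + v * I)‖ ≤ 2 * Real.exp |v| := by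
    refine (norm_add_le _ _).trans ?_
    rw [norm_one]; linarith
  have hpow : ‖(2 * π : ℂ) ^ (-2 * ((σ : ℂ) + v * I))‖ ≤ 7 := by
    rw [show (2 * π : ℂ) = ((2 * π : ℝ) : ℂ) by push_cast; rfl,
      Complex.norm_cpow_eq_rpow_re_of_pos Real.two_pi_pos]
    have : (-2 * ((σ : ℂ) + v * I)).re = -2 * σ := by simp
    rw [this]
    have h7 : 2 * π ≤ 7 := by linarith [Real.pi_lt_d2]
    have h1 : 1 ≤ 2 * π := by linarith [Real.pi_gt_three]
    calc (2 * π) ^ (-2 * σ) ≤ (2 * π) ^ (1 : ℝ) :=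
          Real.rpow_le_rpow_of_exponent_le h1 (by linarith [hσ'.1])
      _ ≤ 7 := by rwa [Real.rpow_one]
  have main := ((((isSlow_const T ((2 * π : ℂ) ^ (-2 * ((σ : ℂ) + v * I)))).mul hT0.le
    (isSlow_gammaPairRatio hT (a := 1 + ((σ : ℂ) + v * I)) (by rw [hre]; linarith [hσ'.1])
      fun t ht => norm_gammaPairRatio_le hT hσ v ht)).mul hT0.le (isSlow_logistic hT)).mul hT0.le
    (isSlow_add_sq_div hT (((σ : ℂ) + v * I - 1 / 2) ^ 2))).mul hT0.le
    (isSlow_inv_quarter_add_sq hT)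
  simp only [dualRatio_eq]
  have h6 : Real.exp (6 * |v|) = Real.exp (4 * |v|) * Real.exp (2 * |v|) := by
    rw [← Real.exp_add]; ring_nf
  refine main.mono hT0.le ?_ (by positivity) ?_
  · calc _ ≤ 7 * (1000 * T ^ (2 + 2 * σ) * Real.exp (4 * |v|)) * 1 * (3 * Real.exp (2 * |v|)) *
        (1 / T ^ 2) := by
          gcongr
          exact (one_add_norm_sq_half_sub_le hw).1
      _ = _ := by
          rw [Real.rpow_add hT0, Real.rpow_two, h6]
          field_simp
          norm_num
  · rw [him]
    have h2 : Real.exp (2 * |v|) = Real.exp |v| * Real.exp |v| := by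
      rw [← Real.exp_add]; ring_nf
    have h4 : 1 ≤ Real.exp (4 * |v|) := Real.one_le_exp (by positivity)
    calc _ ≤ 0 + 64 * (2 * Real.exp |v|) * Real.exp |v| + 1 + 4 + 4 := by
          gcongr
          linarith
      _ ≤ 21000 * (1 * (Real.exp |v| * Real.exp |v|)) := by nlinarith
      _ ≤ _ := by
          rw [h6, h2]
          gcongr

lemma differentiableOn_dualRatio (t : ℝ) : DifferentiableOn ℂ (dualRatio t) {w | -1 < w.re} := by
  have h2π : (2 * π : ℂ) ≠ 0 := by exact_mod_cast Real.two_pi_pos.ne'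
  intro u hu
  have hu' : -1 < u.re := hu
  have hG : ∀ s : ℂ, s.re = 0 →
      DifferentiableAt ℂ (fun u => Complex.Gamma (3 / 2 + u + s)) u := fun s hs => by
    refine DifferentiableAt.comp u (f := fun u => 3 / 2 + u + s) (g := Complex.Gamma)
      (Complex.differentiableAt_Gamma _ fun m h => ?_) (by fun_prop)
    have := congrArg Complex.re h
    simp [hs] at this
    linarith [m.cast_nonneg (α := ℝ)]
  have h1 := hG (t * I) (by simp)
  have h2 := hG (-(t * I)) (by simp)
  simp only [← sub_eq_add_neg] at h2
  have h3 : DifferentiableAt ℂ (fun u : ℂ => (2 * π : ℂ) ^ (-1 - 2 * u)) u :=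
    DifferentiableAt.const_cpow (by fun_prop) (Or.inl h2π)
  unfold dualRatio
  refine DifferentiableAt.differentiableWithinAt ?_
  refine ((((h3.mul (h1.mul h2)).mul_const _).mul ?_).mul_const _)
  fun_prop

lemma exists_norm_dualRatio_le {t : ℝ} (ht : 1 ≤ t) : ∃ C, ∀ σ ∈ Set.Icc (-(1 / 2) : ℝ) 1,
    ∀ v : ℝ, ‖dualRatio t (σ + v * I)‖ ≤ C * Real.exp (6 * |v|) := by
  obtain ⟨G, hG⟩ := exists_norm_Gamma_le (a := 1) (b := 5 / 2) one_pos
  refine ⟨1 * (G * G) * Real.exp (π * t) * 3 * (1 / t ^ 2), fun σ hσ v => ?_⟩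
  have hG0 : 0 ≤ G := (norm_nonneg _).trans (hG 1 (by norm_num) (by norm_num))
  have h1 : ‖(2 * π : ℂ) ^ (-1 - 2 * ((σ : ℂ) + v * I))‖ ≤ 1 := by
    rw [show (2 * π : ℂ) = ((2 * π : ℝ) : ℂ) by push_cast; rfl,
      Complex.norm_cpow_eq_rpow_re_of_pos Real.two_pi_pos]
    refine Real.rpow_le_one_of_one_le_of_nonpos (by linarith [Real.pi_gt_three]) ?_
    simp
    linarith [hσ.1]
  have h2 := (isSlow_inv_quarter_add_sq ht).norm_le t ⟨le_rfl, by linarith⟩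
  have h3 := (isSlow_add_sq_div ht (((σ : ℂ) + v * I - 1 / 2) ^ 2)).norm_le t
    ⟨le_rfl, by linarith⟩
  rw [dualRatio, norm_mul, norm_mul, norm_mul, norm_mul, norm_mul, Complex.norm_real,
    Real.norm_of_nonneg (Real.exp_pos _).le]
  have h6 : Real.exp (2 * |v|) ≤ Real.exp (6 * |v|) := by
    gcongr; norm_num
  calc _ ≤ 1 * (G * G) * Real.exp (π * t) * (3 * Real.exp (6 * |v|)) * (1 / t ^ 2) := by
        gcongr
        · exact hG _ (by simp; linarith [hσ.1]) (by simp; linarith [hσ.2])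
        · exact hG _ (by simp; linarith [hσ.1]) (by simp; linarith [hσ.2])
        · exact h3.trans ((one_add_norm_sq_half_sub_le (norm_strip_le hσ v)).1.trans
            (by gcongr))
    _ = _ := by ring

theorem exists_isMVKernel_dual : ∃ A : ℝ, 0 ≤ A ∧ ∀ T : ℝ, 1 ≤ T →
    IsMVKernel A T (gaussKernel (1 * T ^ (2 - 2 * 2 : ℝ)) dualRatio) := by
  obtain ⟨A, hA, h⟩ := exists_isMVKernel_gaussKernel (c := 1) 2 (B := 21000) 6 one_pos (by norm_num)
  refine ⟨A, hA, fun T hT => ?_⟩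
  have hT0 : 0 < T := by linarith
  refine h T hT dualRatio (fun t _ => differentiableOn_dualRatio t)
    (fun t ht => exists_norm_dualRatio_le (le_trans hT ht.1))
    (fun σ hσ v => isSlow_dualRatio hT hσ v) ?_ fun t ht => ?_
  · simp only [dualRatio_zero]
    exact (isSlow_logistic hT).mono hT0.le (by norm_num) (by norm_num) (by norm_num)
  · have hx := Real.exp_pos (-(2 * π * t))
    have e1 : 1 / (1 + Real.exp (-(2 * π * t))) - 1 =
        -(Real.exp (-(2 * π * t)) / (1 + Real.exp (-(2 * π * t)))) := by
      field_simp
      ring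
    rw [dualRatio_zero, ← Complex.ofReal_one, ← Complex.ofReal_sub, Complex.norm_real, e1,
      norm_neg, Real.norm_of_nonneg (by positivity)]
    have e2 : Real.exp (-(2 * π * t)) * Real.exp (2 * π * t) = 1 := by rw [← Real.exp_add]; simp
    have e3 : T ≤ Real.exp (2 * π * t) := by
      have := Real.add_one_le_exp (2 * π * t)
      nlinarith [Real.pi_gt_three, ht.1]
    calc _ ≤ Real.exp (-(2 * π * t)) / 1 := by gcongr; linarith
      _ ≤ 21000 / T := by
        rw [div_one, le_div_iff₀ hT0]
        nlinarith

lemma norm_mellin_le_of_mem_strip {f : ℝ → ℂ} {a b : ℝ} (ha : MellinConvergent f a)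
    (hb : MellinConvergent f b) :
    ∃ C : ℝ, 0 ≤ C ∧ ∀ s : ℂ, a ≤ s.re → s.re ≤ b → ‖mellin f s‖ ≤ C := by
  have hnorm : ∀ s : ℂ, ∀ x ∈ Set.Ioi (0 : ℝ),
      ‖(x : ℂ) ^ (s - 1) • f x‖ = x ^ (s.re - 1) * ‖f x‖ := fun s x hx => by
    rw [norm_smul, Complex.norm_cpow_eq_rpow_re_of_pos hx]
    simp
  have hconv : ∀ c : ℝ, MellinConvergent f c →
      IntegrableOn (fun x => x ^ (c - 1) * ‖f x‖) (Set.Ioi 0) := fun c hc => by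
    refine (integrableOn_congr_fun (fun x hx => ?_) measurableSet_Ioi).1 hc.norm
    rw [hnorm _ x hx, Complex.ofReal_re]
  have h := (hconv a ha).add (hconv b hb)
  refine ⟨∫ x in Set.Ioi (0 : ℝ), (x ^ (a - 1) * ‖f x‖ + x ^ (b - 1) * ‖f x‖),
    setIntegral_nonneg measurableSet_Ioi fun x hx => ?_, fun s has hsb => ?_⟩
  · have : 0 < x := hx
    positivity
  · refine norm_integral_le_of_norm_le h ((ae_restrict_iff' measurableSet_Ioi).2 (.of_forall
      fun x hx => ?_))
    rw [hnorm s x hx]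
    have hx0 : 0 < x := hx
    rw [← add_mul]
    gcongr
    rcases le_total x 1 with h1 | h1
    · have := Real.rpow_le_rpow_of_exponent_ge hx0 h1 (by linarith : a - 1 ≤ s.re - 1)
      linarith [Real.rpow_pos_of_pos hx0 (b - 1)]
    · have := Real.rpow_le_rpow_of_exponent_le h1 (by linarith : s.re - 1 ≤ b - 1)
      linarith [Real.rpow_pos_of_pos hx0 (a - 1)]

lemma exists_norm_weakFEPair_le (P : WeakFEPair ℂ) (a b : ℝ) :
    ∃ C : ℝ, 0 ≤ C ∧ ∀ s : ℂ, a ≤ s.re → s.re ≤ b → ‖P.Λ₀ s‖ ≤ C :=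
  norm_mellin_le_of_mem_strip (P.isStrongFEPair_toStrongFEPair.hasMellin a).1
    (P.isStrongFEPair_toStrongFEPair.hasMellin b).1

lemma norm_sin_le_exp_abs_im (z : ℂ) : ‖Complex.sin z‖ ≤ Real.exp |z.im| := by
  have h1 : ‖cexp (-z * I)‖ ≤ Real.exp |z.im| := by
    rw [Complex.norm_exp]
    simpa using le_abs_self _
  have h2 : ‖cexp (z * I)‖ ≤ Real.exp |z.im| := by
    rw [Complex.norm_exp]
    simpa using neg_le_abs _
  rw [Complex.sin, norm_div, norm_mul, Complex.norm_I, Complex.norm_ofNat]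
  linarith [norm_sub_le (cexp (-z * I)) (cexp (z * I))]

lemma exists_norm_inv_Gamma_le : ∃ C : ℝ, 0 ≤ C ∧ ∀ z : ℂ, -1 ≤ z.re → z.re ≤ 3 / 2 →
    1 / 2 ≤ |z.im| → ‖(Complex.Gamma z)⁻¹‖ ≤ C * Real.exp (π * |z.im|) := by
  obtain ⟨G, hG⟩ := exists_norm_Gamma_le (a := 1 / 2) (b := 3) (by norm_num)
  have hG0 : 0 ≤ G := (norm_nonneg _).trans (hG 1 (by norm_num) (by norm_num))
  refine ⟨G, hG0, fun z h1 h2 h3 => ?_⟩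
  have him : z.im ≠ 0 := fun h => by norm_num [h] at h3
  have hz1 : z - 1 ≠ 0 := fun h => him (by simpa using congrArg Complex.im h)
  have hne : ∀ w : ℂ, w.im ≠ 0 → Complex.Gamma w ≠ 0 := fun w hw =>
    Complex.Gamma_ne_zero fun m h => hw (by simp [h])
  have e1 := Complex.Gamma_add_one (z - 1) hz1
  have e2 := Complex.Gamma_mul_Gamma_one_sub (z - 1)
  rw [sub_add_cancel] at e1
  rw [show 1 - (z - 1) = 2 - z by ring] at e2
  have hG1 : Complex.Gamma (z - 1) ≠ 0 := hne _ (by simpa using him)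
  have hG2 : Complex.Gamma (2 - z) ≠ 0 := hne _ (by simpa using him)
  have hpi : (π : ℂ) ≠ 0 := by exact_mod_cast Real.pi_ne_zero
  have hsin : Complex.sin (π * (z - 1)) ≠ 0 := fun h => by
    rw [h, div_zero] at e2
    exact mul_ne_zero hG1 hG2 e2
  have e3 : (Complex.Gamma z)⁻¹ =
      Complex.Gamma (2 - z) * Complex.sin (π * (z - 1)) / (π * (z - 1)) := by
    rw [eq_div_iff hsin] at e2
    rw [e1]
    generalize Complex.sin (π * (z - 1)) = S at *
    field_simp
    rw [← e2]
  have hden : 1 ≤ ‖(π : ℂ) * (z - 1)‖ := by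
    rw [norm_mul, Complex.norm_real, Real.norm_of_nonneg Real.pi_pos.le]
    have := Complex.abs_im_le_norm (z - 1)
    simp only [Complex.sub_im, Complex.one_im, sub_zero] at this
    nlinarith [Real.pi_gt_three]
  have hs := norm_sin_le_exp_abs_im (π * (z - 1))
  rw [Complex.im_ofReal_mul, Complex.sub_im, Complex.one_im, sub_zero, abs_mul,
    abs_of_pos Real.pi_pos] at hs
  rw [e3, norm_div, norm_mul]
  refine (div_le_self (by positivity) hden).trans ?_
  gcongr
  exact hG _ (by simp; linarith) (by simp; linarith)

lemma exists_norm_inv_Gammaℝ_le : ∃ C : ℝ, 0 ≤ C ∧ ∀ s : ℂ, -2 ≤ s.re → s.re ≤ 3 →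
    1 ≤ |s.im| → ‖(Gammaℝ s)⁻¹‖ ≤ C * Real.exp (2 * |s.im|) := by
  obtain ⟨C, hC, h⟩ := exists_norm_inv_Gamma_le
  refine ⟨π ^ (2 : ℝ) * C, by positivity, fun s h1 h2 h3 => ?_⟩
  have hre : (s / 2).re = s.re / 2 := by simp
  have him : (s / 2).im = s.im / 2 := by simp
  have hG := h (s / 2) (by rw [hre]; linarith) (by rw [hre]; linarith)
    (by rw [him, abs_div, abs_of_pos (by norm_num : (0 : ℝ) < 2)]; linarith)
  rw [him, abs_div, abs_of_pos (by norm_num : (0 : ℝ) < 2)] at hG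
  rw [Gammaℝ_def, mul_inv, norm_mul, ← Complex.cpow_neg,
    Complex.norm_cpow_eq_rpow_re_of_pos Real.pi_pos, mul_assoc]
  have hre' : (-(-s / 2)).re = s.re / 2 := by simp; ring
  rw [hre']
  refine mul_le_mul (Real.rpow_le_rpow_of_exponent_le (by linarith [Real.pi_gt_three])
    (by linarith)) ?_ (norm_nonneg _) (by positivity)
  · refine hG.trans ?_
    refine mul_le_mul_of_nonneg_left (Real.exp_le_exp.2 ?_) hC
    nlinarith [Real.pi_lt_d2, abs_nonneg s.im]

/-- The entire function `(s - 1) ζ(s, a)`. -/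
noncomputable def entireHurwitz (a : UnitAddCircle) (s : ℂ) : ℂ :=
  (s - 1) * (hurwitzZeta a s - 1 / (s - 1) / Gammaℝ s) + (Gammaℝ s)⁻¹

lemma entireHurwitz_eq (a : UnitAddCircle) {s : ℂ} (hs : s ≠ 1) :
    entireHurwitz a s = (s - 1) * hurwitzZeta a s := by
  have := sub_ne_zero.2 hs
  rw [entireHurwitz, mul_sub, div_div, one_div, mul_inv, mul_inv_cancel_left₀ this,
    sub_add_cancel]

lemma differentiable_entireHurwitz (a : UnitAddCircle) : Differentiable ℂ (entireHurwitz a) := by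
  intro s
  unfold entireHurwitz
  refine ((differentiableAt_id.sub_const 1).mul ?_).add (differentiable_Gammaℝ_inv s)
  rcases eq_or_ne s 1 with rfl | hs
  · exact differentiableAt_hurwitzZeta_sub_one_div a
  · have hs' := sub_ne_zero.2 hs
    refine (differentiableAt_hurwitzZeta a hs).sub ?_
    simp only [div_eq_mul_inv]
    refine DifferentiableAt.mul ?_ (differentiable_Gammaℝ_inv s)
    exact (((differentiableAt_id (𝕜 := ℂ) (x := s)).sub_const (1 : ℂ)).inv hs').const_mul _

lemma exists_norm_hurwitzZeta_le (a : UnitAddCircle) : ∃ C : ℝ, 0 ≤ C ∧ ∀ s : ℂ,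
    -(1 / 2) ≤ s.re → s.re ≤ 3 / 2 → 1 ≤ |s.im| →
    ‖hurwitzZeta a s‖ ≤ C * Real.exp (2 * |s.im|) := by
  obtain ⟨G, hG, hΓ⟩ := exists_norm_inv_Gammaℝ_le
  obtain ⟨C₁, hC₁, h₁⟩ := exists_norm_weakFEPair_le (hurwitzEvenFEPair a) (-(1 / 4)) (3 / 4)
  obtain ⟨C₂, hC₂, h₂⟩ := norm_mellin_le_of_mem_strip
    ((isStrong_hurwitzOddFEPair a).hasMellin ((1 / 4 : ℝ) : ℂ)).1
    ((isStrong_hurwitzOddFEPair a).hasMellin ((5 / 4 : ℝ) : ℂ)).1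
  refine ⟨(C₁ / 2 + 2) * G + C₂ / 2 * G, by positivity, fun s hs1 hs2 him => ?_⟩
  have hs0 : s ≠ 0 := fun h => by norm_num [h] at him
  have hn0 : 1 ≤ ‖s‖ := him.trans (Complex.abs_im_le_norm s)
  have hn1 : 1 ≤ ‖1 - s‖ := by
    refine him.trans ?_
    simpa using Complex.abs_im_le_norm (1 - s)
  have e1 : ‖completedHurwitzZetaEven a s‖ ≤ C₁ / 2 + 2 := by
    rw [completedHurwitzZetaEven_eq, completedHurwitzZetaEven₀]
    have b1 : ‖(hurwitzEvenFEPair a).Λ₀ (s / 2) / 2‖ ≤ C₁ / 2 := by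
      rw [norm_div, Complex.norm_ofNat]
      gcongr
      exact h₁ _ (by simp; linarith) (by simp; linarith)
    have b2 : ‖((if a = 0 then 1 else 0 : ℂ)) / s‖ ≤ 1 := by
      rw [norm_div]
      refine (div_le_self (norm_nonneg _) hn0).trans ?_
      split_ifs <;> simp
    have b3 : ‖1 / (1 - s)‖ ≤ 1 := by
      rw [norm_div, norm_one]
      exact div_le_self zero_le_one hn1
    refine (norm_sub_le _ _).trans ?_
    have := norm_sub_le ((hurwitzEvenFEPair a).Λ₀ (s / 2) / 2)
      (((if a = 0 then 1 else 0 : ℂ)) / s)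
    linarith
  have e2 : ‖completedHurwitzZetaOdd a s‖ ≤ C₂ / 2 := by
    rw [completedHurwitzZetaOdd, (isStrong_hurwitzOddFEPair a).Λ_eq, norm_div, Complex.norm_ofNat]
    gcongr
    exact h₂ _ (by simp; linarith) (by simp; linarith)
  have g1 := hΓ s (by linarith) (by linarith) him
  have g2 := hΓ (s + 1) (by simp; linarith) (by simp; linarith) (by simpa using him)
  simp only [Complex.add_im, Complex.one_im, add_zero] at g2
  rw [hurwitzZeta, hurwitzZetaEven_def_of_ne_or_ne (Or.inr hs0), hurwitzZetaOdd, div_eq_mul_inv,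
    div_eq_mul_inv]
  refine (norm_add_le _ _).trans ?_
  rw [norm_mul, norm_mul, add_mul, mul_assoc, mul_assoc]
  gcongr

lemma exists_norm_entireHurwitz_le (a : UnitAddCircle) : ∃ C : ℝ, 0 ≤ C ∧ ∀ s : ℂ,
    -(1 / 2) ≤ s.re → s.re ≤ 3 / 2 → ‖entireHurwitz a s‖ ≤ C * Real.exp (3 * |s.im|) := by
  obtain ⟨C, hC, h⟩ := exists_norm_hurwitzZeta_le a
  have hK : IsCompact (Set.Icc (-(1 / 2) : ℝ) (3 / 2) ×ℂ Set.Icc (-1 : ℝ) 1) :=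
    isCompact_Icc.reProdIm isCompact_Icc
  obtain ⟨M, hM⟩ := hK.exists_bound_of_continuousOn
    (differentiable_entireHurwitz a).continuous.continuousOn
  refine ⟨|M| + 3 * C, by positivity, fun s h1 h2 => ?_⟩
  rcases le_total |s.im| 1 with him | him
  · have := hM s ⟨⟨h1, h2⟩, abs_le.1 him⟩
    have h3 : 1 ≤ Real.exp (3 * |s.im|) := Real.one_le_exp (by positivity)
    nlinarith [le_abs_self M, abs_nonneg M]
  · have hs : s ≠ 1 := fun h => by norm_num [h] at him
    rw [entireHurwitz_eq a hs, norm_mul]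
    have e1 : ‖s - 1‖ ≤ 3 * Real.exp |s.im| := by
      refine (Complex.norm_le_abs_re_add_abs_im _).trans ?_
      simp only [Complex.sub_re, Complex.one_re, Complex.sub_im, Complex.one_im, sub_zero]
      have : |s.re - 1| ≤ 3 / 2 := abs_le.2 ⟨by linarith, by linarith⟩
      have := Real.add_one_le_exp |s.im|
      linarith
    have e2 : Real.exp (3 * |s.im|) = Real.exp |s.im| * Real.exp (2 * |s.im|) := by
      rw [← Real.exp_add]; ring_nf
    calc _ ≤ (3 * Real.exp |s.im|) * (C * Real.exp (2 * |s.im|)) := by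
          gcongr
          exact h s h1 h2 him
      _ = 3 * C * Real.exp (3 * |s.im|) := by rw [e2]; ring
      _ ≤ _ := by
          gcongr
          linarith [abs_nonneg M]

/-- For `w = c + iv`, the product `L(1/2 + it + w) * conj L(1/2 + it + conj w)`, which is
holomorphic in `w`. -/
noncomputable def pairSeries (b : ℕ → ℂ) (t : ℝ) (w : ℂ) : ℂ :=
  LSeries b (1 / 2 + t * I + w) *
    starRingEnd ℂ (LSeries b (1 / 2 + t * I + starRingEnd ℂ w))

section

variable {b : ℕ → ℂ} {k : ℂ → ℂ} {t : ℝ}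

lemma norm_LSeries_term_le (hb : ∀ n, ‖b n‖ ≤ #n.divisors) {s : ℂ} (hs : s.re = 3 / 2) (n : ℕ) :
    ‖LSeries.term b s n‖ ≤ (#n.divisors : ℝ) * (1 / (n * √(n : ℝ))) := by
  rcases eq_or_ne n 0 with rfl | hn
  · simp
  · rw [LSeries.norm_term_eq, if_neg hn, hs, show (3 / 2 : ℝ) = 1 + 1 / 2 by norm_num,
      Real.rpow_add (by positivity), Real.rpow_one, ← Real.sqrt_eq_rpow, div_eq_mul_one_div]
    gcongr
    exact hb n

lemma summable_norm_LSeries_term (hb : ∀ n, ‖b n‖ ≤ #n.divisors) {s : ℂ} (hs : s.re = 3 / 2) :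
    Summable fun n => ‖LSeries.term b s n‖ :=
  summable_card_divisors_div.of_nonneg_of_le (fun _ => norm_nonneg _) (norm_LSeries_term_le hb hs)

noncomputable def pairTerm (b : ℕ → ℂ) (t : ℝ) (w : ℂ) (z : ℕ × ℕ) : ℂ :=
  LSeries.term b (1 / 2 + t * I + w) z.1 *
    starRingEnd ℂ (LSeries.term b (1 / 2 + t * I + starRingEnd ℂ w) z.2)

lemma norm_pairTerm_le (hb : ∀ n, ‖b n‖ ≤ #n.divisors) (v : ℝ) (z : ℕ × ℕ) :
    ‖pairTerm b t ((1 : ℝ) + v * I) z‖ ≤ (#z.1.divisors : ℝ) * (1 / (z.1 * √(z.1 : ℝ))) *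
      ((#z.2.divisors : ℝ) * (1 / (z.2 * √(z.2 : ℝ)))) := by
  rw [pairTerm, norm_mul, RCLike.norm_conj]
  refine mul_le_mul (norm_LSeries_term_le hb ?_ _) (norm_LSeries_term_le hb ?_ _)
    (norm_nonneg _) (by positivity) <;> norm_num

lemma tsum_pairTerm (hb : ∀ n, ‖b n‖ ≤ #n.divisors) (v : ℝ) :
    ∑' z, pairTerm b t ((1 : ℝ) + v * I) z = pairSeries b t ((1 : ℝ) + v * I) := by
  rw [pairSeries, LSeries, LSeries, Complex.conj_tsum]
  have h1 := summable_norm_LSeries_term hb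
    (s := 1 / 2 + t * I + ((1 : ℝ) + v * I)) (by norm_num)
  have h2 := summable_norm_LSeries_term hb
    (s := 1 / 2 + t * I + starRingEnd ℂ ((1 : ℝ) + v * I)) (by norm_num)
  simp only [← RCLike.norm_conj (K := ℂ) (LSeries.term b (1 / 2 + t * I + starRingEnd ℂ _) _)]
    at h2
  exact (tsum_mul_tsum_of_summable_norm h1 h2).symm

lemma continuous_pairTerm (z : ℕ × ℕ) :
    Continuous fun v : ℝ => pairTerm b t ((1 : ℝ) + v * I) z := by
  have h : ∀ (n : ℕ) (σ : ℝ → ℂ), Continuous σ → Continuous fun v => LSeries.term b (σ v) n := by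
    intro n σ hσ
    rcases eq_or_ne n 0 with rfl | hn
    · simp only [LSeries.term_zero]
      exact continuous_const
    · simp only [LSeries.term_of_ne_zero hn]
      refine continuous_const.div (hσ.const_cpow (Or.inl (by exact_mod_cast hn))) fun v => ?_
      rw [Ne, Complex.cpow_eq_zero_iff]
      simp [hn]
  unfold pairTerm
  exact (h _ _ (by fun_prop)).mul (Complex.continuous_conj.comp
    (h _ _ (continuous_const.add (Complex.continuous_conj.comp (by fun_prop)))))

lemma integrable_pairSeries_mul (hb : ∀ n, ‖b n‖ ≤ #n.divisors) (hk : IsStripKernel k) :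
    Integrable fun v : ℝ => pairSeries b t ((1 : ℝ) + v * I) *
      (k ((1 : ℝ) + v * I) / ((1 : ℝ) + v * I)) := by
  obtain ⟨C, hC⟩ := hk.decay
  have hg := integrable_vertical_div hk.differentiableOn (x := 1) (by norm_num) one_ne_zero
    (hC 1 (by norm_num))
  have hc : Continuous fun v : ℝ => pairSeries b t ((1 : ℝ) + v * I) := by
    simp only [← tsum_pairTerm hb]
    exact continuous_tsum continuous_pairTerm summable_card_divisors_mul_div
      fun z v => norm_pairTerm_le hb v z
  exact hg.bdd_mul hc.aestronglyMeasurable (Eventually.of_forall fun v =>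
    tsum_pairTerm (t := t) hb v ▸ tsum_of_norm_bounded summable_card_divisors_mul_div.hasSum
      fun z => norm_pairTerm_le hb v z)

lemma pairTerm_eq {z : ℕ × ℕ} (h1 : z.1 ≠ 0) (h2 : z.2 ≠ 0) (w : ℂ) :
    pairTerm b t w z = b z.1 * starRingEnd ℂ (b z.2) * ((1 / √((z.1 : ℝ) * z.2) : ℝ) : ℂ) *
      (cexp (t * (Real.log ((z.2 : ℝ) / z.1) : ℝ) * I) * (((z.1 : ℝ) * z.2 : ℝ) : ℂ) ^ (-w)) := by
  have h1' : (0 : ℝ) < z.1 := by positivity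
  have h2' : (0 : ℝ) < z.2 := by positivity
  have hexp : ∀ {x : ℝ}, 0 < x → ∀ s : ℂ, (x : ℂ) ^ s = cexp ((Real.log x : ℂ) * s) := by
    intro x hx s
    rw [Complex.cpow_def_of_ne_zero (by exact_mod_cast hx.ne'), Complex.ofReal_log hx.le]
  have hn : ∀ n : ℕ, (n : ℂ) = ((n : ℝ) : ℂ) := fun n => by push_cast; rfl
  have hs : ((1 / √((z.1 : ℝ) * z.2) : ℝ) : ℂ) =
      cexp (-(1 / 2) * (Real.log z.1 + Real.log z.2 : ℝ)) := by
    rw [← Real.log_mul h1'.ne' h2'.ne', Real.sqrt_eq_rpow, one_div, ← Real.rpow_neg (by positivity),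
      Real.rpow_def_of_pos (by positivity), Complex.ofReal_exp]
    push_cast
    ring_nf
  rw [pairTerm, LSeries.term_of_ne_zero h1, LSeries.term_of_ne_zero h2, map_div₀, hs, hn z.1,
    hn z.2, hexp h1', hexp h2', hexp (by positivity), ← Complex.exp_conj,
    Real.log_mul h1'.ne' h2'.ne', Real.log_div h2'.ne' h1'.ne', div_mul_div_comm,
    ← Complex.exp_add, div_eq_mul_inv, ← Complex.exp_neg, mul_assoc _ (cexp _),
    ← Complex.exp_add, ← Complex.exp_add]
  congr 2
  simp only [map_mul, map_add, Complex.conj_ofReal, Complex.conj_I, map_div₀, map_one,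
    map_ofNat, Complex.conj_conj]
  push_cast
  ring

lemma tsum_mvTerm_mellinWeight {K : ℝ → ℂ → ℂ} (hb : ∀ n, ‖b n‖ ≤ #n.divisors)
    (hk : IsStripKernel (K t)) :
    ∑' z, mvTerm b (fun t x => mellinWeight (K t) x) t z =
      1 / (2 * π) * ∫ v : ℝ, pairSeries b t ((1 : ℝ) + v * I) *
        (K t ((1 : ℝ) + v * I) / ((1 : ℝ) + v * I)) := by
  obtain ⟨C, hC⟩ := hk.decay
  have hg := integrable_vertical_div hk.differentiableOn (x := 1) (by norm_num) one_ne_zero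
    (hC 1 (by norm_num))
  have hF : ∀ z, Integrable fun v : ℝ => pairTerm b t ((1 : ℝ) + v * I) z *
      (K t ((1 : ℝ) + v * I) / ((1 : ℝ) + v * I)) := fun z =>
    hg.bdd_mul (continuous_pairTerm z).aestronglyMeasurable
      (Eventually.of_forall fun v => norm_pairTerm_le hb v z)
  have hS : Summable fun z => ∫ v : ℝ, ‖pairTerm b t ((1 : ℝ) + v * I) z *
      (K t ((1 : ℝ) + v * I) / ((1 : ℝ) + v * I))‖ := by
    refine (summable_card_divisors_mul_div.mul_right
      (∫ v : ℝ, ‖K t ((1 : ℝ) + v * I) / ((1 : ℝ) + v * I)‖)).of_nonneg_of_le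
      (fun z => integral_nonneg fun v => norm_nonneg _) fun z => ?_
    rw [← integral_const_mul]
    refine integral_mono (hF z).norm (hg.norm.const_mul _) fun v => ?_
    simp only [norm_mul]
    gcongr
    exact norm_pairTerm_le hb v z
  have h := (hasSum_integral_of_summable_integral_norm hF hS).mul_left (1 / (2 * π) : ℂ)
  simp only [tsum_mul_right, tsum_pairTerm hb] at h
  rw [← h.tsum_eq]
  refine tsum_congr fun z => ?_
  by_cases hz : z.1 = 0 ∨ z.2 = 0
  · rw [mvTerm_eq_zero hb hz]
    rcases hz with hz | hz <;> simp [pairTerm, hz]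
  · push Not at hz
    simp only [pairTerm_eq hz.1 hz.2, mvTerm, mellinWeight]
    rw [mul_left_comm (cexp _), mul_left_comm _ (1 / (2 * π) : ℂ), ← integral_const_mul,
      ← integral_const_mul]
    congr 2
    ext v
    ring

end

/-- The product `ζ(1/2 + it + w, a) * conj ζ(1/2 + it + conj w, a)`. -/
noncomputable def pairZeta (a : UnitAddCircle) (t : ℝ) (w : ℂ) : ℂ :=
  hurwitzZeta a (1 / 2 + t * I + w) *
    starRingEnd ℂ (hurwitzZeta a (1 / 2 + t * I + starRingEnd ℂ w))

/-- The entire function whose value at `0` is `|ζ(1/2 + it, a)| ^ 4`. -/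
noncomputable def momentKernel (a : UnitAddCircle) (y t : ℝ) (w : ℂ) : ℂ :=
  (entireHurwitz a (1 / 2 + t * I + w) *
    starRingEnd ℂ (entireHurwitz a (1 / 2 + t * I + starRingEnd ℂ w))) ^ 2 *
  (((w + 1 / 2) ^ 2 + (t : ℂ) ^ 2) / (1 / 4 + (t : ℂ) ^ 2) ^ 2) ^ 2 *
  ((y : ℂ) ^ w * cexp (w ^ 2))

section

variable {a : UnitAddCircle} {y t : ℝ} {w : ℂ}

lemma momentKernel_eq (h1 : 1 / 2 + t * I + w ≠ 1) (h2 : 1 / 2 + t * I + starRingEnd ℂ w ≠ 1) :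
    momentKernel a y t w = pairZeta a t w ^ 2 * gaussKernel y primalRatio t w := by
  rw [momentKernel, entireHurwitz_eq a h1, entireHurwitz_eq a h2, gaussKernel, primalRatio,
    pairZeta]
  simp only [map_mul, map_sub, map_add, Complex.conj_ofReal, Complex.conj_I, map_div₀, map_one,
    map_ofNat, Complex.conj_conj]
  have hf : (1 / 2 + (t : ℂ) * I + w - 1) * (1 / 2 + (t : ℂ) * -I + w - 1) =
      (w - 1 / 2) ^ 2 + (t : ℂ) ^ 2 := by
    linear_combination -(t : ℂ) ^ 2 * Complex.I_sq
  simp only [div_mul_div_comm, ← sq, ← hf]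
  ring

lemma momentKernel_zero (ht : 0 < t) :
    momentKernel a y t 0 = ((‖hurwitzZeta a (1 / 2 + t * I)‖ ^ 4 : ℝ) : ℂ) := by
  have h1 : 1 / 2 + t * I + 0 ≠ 1 := fun h => by
    simpa [ht.ne'] using congr_arg Complex.im h
  rw [momentKernel_eq h1 (by rwa [map_zero]), gaussKernel, primalRatio_zero, pairZeta, map_zero,
    add_zero, Complex.mul_conj, Complex.normSq_eq_norm_sq]
  simp
  ring

lemma differentiable_momentKernel (hy : 0 < y) : Differentiable ℂ (momentKernel a y t) := by
  intro w
  have hE := differentiable_entireHurwitz a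
  have h1 : DifferentiableAt ℂ (fun w => entireHurwitz a (1 / 2 + t * I + w)) w :=
    (hE _).comp w (by fun_prop)
  have h2 : DifferentiableAt ℂ (fun w =>
      starRingEnd ℂ (entireHurwitz a (1 / 2 + t * I + starRingEnd ℂ w))) w := by
    have h3 : DifferentiableAt ℂ (fun w => entireHurwitz a (1 / 2 + t * I + w))
        (starRingEnd ℂ w) := (hE _).comp _ (by fun_prop)
    simpa [Function.comp_def] using h3.conj_conj
  have h4 : DifferentiableAt ℂ (fun w => (y : ℂ) ^ w) w :=
    differentiableAt_id.const_cpow (Or.inl (by exact_mod_cast hy.ne'))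
  unfold momentKernel
  exact (((h1.mul h2).pow 2).mul (by fun_prop)).mul (h4.mul (by fun_prop))

lemma exists_norm_momentKernel_le (a : UnitAddCircle) (hy : 1 ≤ y) (t : ℝ) : ∃ C : ℝ,
    ∀ x ∈ Set.Icc (-1 : ℝ) 1, ∀ v : ℝ,
      ‖momentKernel a y t (x + v * I)‖ ≤ C * Real.exp (-(v ^ 2 / 2)) := by
  obtain ⟨C, hC, hE⟩ := exists_norm_entireHurwitz_le a
  set D := C * Real.exp (3 * |t|)
  refine ⟨(D * D) ^ 2 * ((4 + t ^ 2) / (1 / 4 + t ^ 2) ^ 2) ^ 2 * (y * Real.exp 1) * Real.exp 128,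
    fun x hx v => ?_⟩
  have hD : 0 ≤ D := by positivity
  have hA : ‖entireHurwitz a (1 / 2 + t * I + (x + v * I))‖ ≤ D * Real.exp (3 * |v|) := by
    refine (hE _ ?_ ?_).trans ?_
    · simp; linarith [hx.1]
    · simp; linarith [hx.2]
    · simp only [D, mul_assoc, ← Real.exp_add]
      refine mul_le_mul_of_nonneg_left (Real.exp_le_exp.2 ?_) hC
      have := abs_add_le t v
      simp
      linarith
  have hB : ‖starRingEnd ℂ (entireHurwitz a (1 / 2 + t * I + starRingEnd ℂ (x + v * I)))‖ ≤
      D * Real.exp (3 * |v|) := by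
    rw [RCLike.norm_conj]
    refine (hE _ ?_ ?_).trans ?_
    · simp; linarith [hx.1]
    · simp; linarith [hx.2]
    · simp only [D, mul_assoc, ← Real.exp_add]
      refine mul_le_mul_of_nonneg_left (Real.exp_le_exp.2 ?_) hC
      have := abs_sub t v
      simp [← sub_eq_add_neg]
      linarith
  have hw : ‖(x : ℂ) + v * I‖ ≤ Real.exp |v| := by
    refine (norm_add_le _ _).trans ?_
    rw [norm_mul, Complex.norm_I, mul_one, Complex.norm_real, Complex.norm_real, Real.norm_eq_abs,
      Real.norm_eq_abs]
    linarith [Real.add_one_le_exp |v|, abs_le.2 hx]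
  have hR : ‖((x + v * I + 1 / 2) ^ 2 + (t : ℂ) ^ 2) / (1 / 4 + (t : ℂ) ^ 2) ^ 2‖ ≤
      (4 + t ^ 2) / (1 / 4 + t ^ 2) ^ 2 * Real.exp (2 * |v|) := by
    rw [norm_div, norm_pow, norm_quarter_add_sq, div_mul_eq_mul_div]
    refine div_le_div_of_nonneg_right ?_ (by positivity)
    have h1 := (one_add_norm_sq_half_sub_le hw).2
    have h2 : 1 ≤ Real.exp (2 * |v|) := Real.one_le_exp (by positivity)
    have h3 := norm_add_le (((x : ℂ) + v * I + 1 / 2) ^ 2 - 1 / 4) (1 / 4 + (t : ℂ) ^ 2)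
    rw [norm_quarter_add_sq, sub_add, sub_add_cancel_left, sub_neg_eq_add] at h3
    nlinarith [sq_nonneg t]
  have hG : ‖(y : ℂ) ^ ((x : ℂ) + v * I) * cexp (((x : ℂ) + v * I) ^ 2)‖ ≤
      y * Real.exp 1 * Real.exp (-v ^ 2) := by
    rw [norm_mul, Complex.norm_cpow_eq_rpow_re_of_pos (by linarith), Complex.norm_exp, mul_assoc,
      ← Real.exp_add]
    have h1 : (((x : ℂ) + v * I) ^ 2).re = x ^ 2 - v ^ 2 := by simp [sq]
    have h2 : ((x : ℂ) + v * I).re = x := by simp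
    rw [h1, h2]
    refine mul_le_mul ?_ (Real.exp_le_exp.2 ?_) (Real.exp_pos _).le (by linarith)
    · simpa using Real.rpow_le_rpow_of_exponent_le hy hx.2
    · nlinarith [hx.1, hx.2]
  rw [momentKernel, norm_mul, norm_mul, norm_pow, norm_pow, norm_mul]
  calc _ ≤ (D * Real.exp (3 * |v|) * (D * Real.exp (3 * |v|))) ^ 2 *
        ((4 + t ^ 2) / (1 / 4 + t ^ 2) ^ 2 * Real.exp (2 * |v|)) ^ 2 *
        (y * Real.exp 1 * Real.exp (-v ^ 2)) := by gcongr
    _ = (D * D) ^ 2 * ((4 + t ^ 2) / (1 / 4 + t ^ 2) ^ 2) ^ 2 * (y * Real.exp 1) *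
        Real.exp (16 * |v| - v ^ 2) := by
      rw [show 16 * |v| - v ^ 2 = 3 * |v| * 4 + 2 * |v| * 2 + -v ^ 2 by ring, Real.exp_add,
        Real.exp_add, show Real.exp (3 * |v| * 4) = Real.exp (3 * |v|) ^ 4 by
          rw [← Real.exp_nat_mul]; push_cast; ring_nf,
        show Real.exp (2 * |v| * 2) = Real.exp (2 * |v|) ^ 2 by
          rw [← Real.exp_nat_mul]; push_cast; ring_nf]
      ring
    _ ≤ _ := by
      rw [mul_assoc _ (Real.exp 128), ← Real.exp_add]
      refine mul_le_mul_of_nonneg_left (Real.exp_le_exp.2 ?_) (by positivity)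
      nlinarith [sq_nonneg (|v| - 16), sq_abs v]

/-- The contour shift behind the approximate functional equation. -/
lemma norm_hurwitzZeta_pow_four_eq (hy : 1 ≤ y) (ht : 0 < t) :
    ((‖hurwitzZeta a (1 / 2 + t * I)‖ ^ 4 : ℝ) : ℂ) =
      1 / (2 * π) * (∫ v : ℝ, momentKernel a y t ((1 : ℝ) + v * I) / ((1 : ℝ) + v * I)) +
      1 / (2 * π) * ∫ v : ℝ, momentKernel a y t (-((1 : ℝ) + v * I)) / ((1 : ℝ) + v * I) := by
  obtain ⟨C, hC⟩ := exists_norm_momentKernel_le a hy t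
  have h := integral_vertical_div_sub (a := -1) (b := 1) (c := -2) (by norm_num) one_pos
    (by norm_num) (differentiable_momentKernel (a := a) (t := t)
      (show 0 < y by linarith)).differentiableOn hC
  have h2 : (∫ v : ℝ, momentKernel a y t (((-1 : ℝ) : ℂ) + v * I) / (((-1 : ℝ) : ℂ) + v * I)) =
      -∫ v : ℝ, momentKernel a y t (-((1 : ℝ) + v * I)) / ((1 : ℝ) + v * I) := by
    rw [← integral_neg, ← integral_neg_eq_self]
    congr 1
    ext v
    rw [show ((-1 : ℝ) : ℂ) + ((-v : ℝ) : ℂ) * I = -((1 : ℝ) + v * I) by push_cast; ring, div_neg]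
  rw [h2, sub_neg_eq_add, momentKernel_zero ht] at h
  rw [← mul_add, h, ← mul_assoc, one_div_mul_cancel (by simp), one_mul]

end

lemma LSeries_dirichletSq {f : ℕ → ℂ} {s : ℂ} (hf : LSeriesSummable f s) :
    LSeries (dirichletSq f) s = LSeries f s ^ 2 := by
  rw [sq, ← LSeries_convolution' hf hf]
  congr 1
  ext n
  rw [LSeries.convolution_def]
  rfl

section

variable {q : ℕ} [NeZero q]

lemma hurwitzZeta_natCast_div (a : ℕ) {s : ℂ} (hs : 1 < s.re) :
    hurwitzZeta (((a : ℝ) / (q : ℝ) : ℝ) : UnitAddCircle) s =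
      (q : ℂ) ^ s * LSeries (fun n => if (n : ZMod q) = a then 1 else 0) s := by
  have h1 := ZMod.LFunction_eq_LSeries (fun r : ZMod q => if r = a then (1 : ℂ) else 0) hs
  have hq : (q : ℂ) ^ s ≠ 0 := by
    rw [Ne, Complex.cpow_eq_zero_iff]
    simp [NeZero.ne q]
  rw [← h1, ZMod.LFunction, ← mul_assoc, Complex.cpow_neg, mul_inv_cancel₀ hq, one_mul]
  simp only [ite_mul, one_mul, zero_mul, sum_ite_eq', mem_univ, if_true]
  rw [ZMod.toAddCircle_natCast]

lemma pairZeta_one_add (a : ℕ) (t v : ℝ) :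
    pairZeta (((a : ℝ) / (q : ℝ) : ℝ) : UnitAddCircle) t ((1 : ℝ) + v * I) ^ 2 =
      (q : ℂ) ^ 2 * ((q : ℝ) ^ 4 : ℝ) ^ ((1 : ℝ) + v * I : ℂ) *
      pairSeries (dirichletSq fun n => if (n : ZMod q) = a then 1 else 0) t ((1 : ℝ) + v * I) := by
  have h1 : 1 < (1 / 2 + t * I + ((1 : ℝ) + v * I)).re := by norm_num
  have h2 : 1 < (1 / 2 + t * I + starRingEnd ℂ ((1 : ℝ) + v * I)).re := by norm_num
  have hsum : ∀ {s : ℂ}, 1 < s.re →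
      LSeriesSummable (fun n => if (n : ZMod q) = a then (1 : ℂ) else 0) s := fun hs =>
    ZMod.LSeriesSummable_of_one_lt_re (fun r : ZMod q => if r = a then (1 : ℂ) else 0) hs
  rw [pairZeta, pairSeries, hurwitzZeta_natCast_div a h1, hurwitzZeta_natCast_div a h2,
    LSeries_dirichletSq (hsum h1), LSeries_dirichletSq (hsum h2)]
  have hq : (q : ℂ) ≠ 0 := by exact_mod_cast NeZero.ne q
  have hlog : Complex.log q = (Real.log q : ℂ) := (Complex.natCast_log).symm
  have h3 : ((q : ℂ) ^ (1 / 2 + t * I + ((1 : ℝ) + v * I)) *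
      starRingEnd ℂ ((q : ℂ) ^ (1 / 2 + t * I + starRingEnd ℂ ((1 : ℝ) + v * I)))) ^ 2 =
      (q : ℂ) ^ 2 * ((q : ℝ) ^ 4 : ℝ) ^ ((1 : ℝ) + v * I : ℂ) := by
    have h4 : (q : ℂ) ^ 2 = cexp (Real.log q * 2) := by
      rw [← hlog, ← Complex.cpow_def_of_ne_zero hq]
      norm_num
    have h5 : ((((q : ℝ) ^ 4 : ℝ)) : ℂ) ^ ((1 : ℝ) + v * I : ℂ) =
        cexp (Real.log q * 4 * ((1 : ℝ) + v * I)) := by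
      rw [Complex.cpow_def_of_ne_zero (by simpa using hq), ← Complex.ofReal_log (by positivity),
        Real.log_pow]
      push_cast
      ring_nf
    rw [h4, h5, Complex.cpow_def_of_ne_zero hq, Complex.cpow_def_of_ne_zero hq, hlog,
      ← Complex.exp_conj, ← Complex.exp_add, ← Complex.exp_nat_mul, ← Complex.exp_add]
    congr 1
    simp only [map_mul, map_add, Complex.conj_ofReal, Complex.conj_I, map_div₀, map_one,
      map_ofNat, map_neg]
    push_cast
    ring
  rw [← h3, map_mul, map_pow]
  ring

lemma momentKernel_one_add (a : ℕ) {T : ℝ} (hT : 0 < T) {t : ℝ} (v : ℝ) :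
    momentKernel (((a : ℝ) / (q : ℝ) : ℝ) : UnitAddCircle) (T ^ (2 : ℝ)) t ((1 : ℝ) + v * I) =
      (q : ℂ) ^ 2 * (pairSeries (dirichletSq fun n => if (n : ZMod q) = a then 1 else 0) t
        ((1 : ℝ) + v * I) *
        gaussKernel ((q : ℝ) ^ 4 * T ^ (2 : ℝ)) primalRatio t ((1 : ℝ) + v * I)) := by
  rw [momentKernel_eq, pairZeta_one_add, gaussKernel, gaussKernel, Complex.ofReal_mul,
    Complex.mul_cpow_ofReal_nonneg (by positivity) (by positivity)]
  · ring
  all_goals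
    intro h
    have := congr_arg Complex.re h
    norm_num at this

lemma integral_momentKernel_one_add (a : ℕ) {T : ℝ} (hT : 0 < T) {t : ℝ}
    (hk : IsStripKernel (gaussKernel ((q : ℝ) ^ 4 * T ^ (2 : ℝ)) primalRatio t)) :
    1 / (2 * π) * (∫ v : ℝ, momentKernel (((a : ℝ) / (q : ℝ) : ℝ) : UnitAddCircle) (T ^ (2 : ℝ)) t
      ((1 : ℝ) + v * I) / ((1 : ℝ) + v * I)) =
    (q : ℂ) ^ 2 * ∑' z, mvTerm (dirichletSq fun n => if (n : ZMod q) = a then 1 else 0)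
      (fun t x => mellinWeight (gaussKernel ((q : ℝ) ^ 4 * T ^ (2 : ℝ)) primalRatio t) x) t z := by
  rw [tsum_mvTerm_mellinWeight (norm_dirichletSq_le fun n => ?_) hk, mul_left_comm,
    ← integral_const_mul ((q : ℂ) ^ 2)]
  · refine congr_arg _ (integral_congr_ae (Eventually.of_forall fun v => ?_))
    simp only [momentKernel_one_add a hT]
    ring
  · split_ifs <;> simp

end

lemma conj_LSeries (f : ℕ → ℂ) (s : ℂ) :
    starRingEnd ℂ (LSeries f s) = LSeries (fun n => starRingEnd ℂ (f n)) (starRingEnd ℂ s) := by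
  rw [LSeries, LSeries, Complex.conj_tsum]
  refine tsum_congr fun n => ?_
  rcases eq_or_ne n 0 with rfl | hn
  · simp
  · rw [LSeries.term_of_ne_zero hn, LSeries.term_of_ne_zero hn, map_div₀,
      Complex.cpow_conj _ _ (by rw [Complex.natCast_arg]; exact Real.pi_ne_zero.symm),
      Complex.conj_natCast]

section

variable {q : ℕ} [NeZero q]

lemma expZeta_toAddCircle (j : ZMod q) {s : ℂ} (hs : 1 < s.re) :
    expZeta (ZMod.toAddCircle j) s = LSeries (fun n => ZMod.stdAddChar (j * (n : ZMod q))) s := by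
  rw [← ZMod.LFunction_stdAddChar_eq_expZeta j s (Or.inr fun h => by simp [h] at hs),
    ZMod.LFunction_eq_LSeries _ hs]

lemma expZeta_neg_toAddCircle (j : ZMod q) {s : ℂ} (hs : 1 < s.re) :
    expZeta (-ZMod.toAddCircle j) s =
      starRingEnd ℂ (expZeta (ZMod.toAddCircle j) (starRingEnd ℂ s)) := by
  rw [← map_neg, expZeta_toAddCircle _ hs, expZeta_toAddCircle _ (by simpa using hs), conj_LSeries,
    Complex.conj_conj]
  simp only [neg_mul, AddChar.map_neg_eq_conj]

lemma norm_expZeta_toAddCircle_le (j : ZMod q) {s : ℂ} (hs : s.re = 3 / 2) :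
    ‖expZeta (ZMod.toAddCircle j) s‖ ≤ ∑' n : ℕ, 1 / (n : ℝ) ^ (3 / 2 : ℝ) := by
  rw [expZeta_toAddCircle j (by rw [hs]; norm_num), LSeries]
  refine tsum_of_norm_bounded (Real.summable_one_div_nat_rpow.2 (by norm_num)).hasSum fun n => ?_
  rw [LSeries.norm_term_eq, hs]
  split_ifs
  · positivity
  · rw [AddChar.norm_apply]

lemma pairSeries_dirichletSq_stdAddChar (j : ZMod q) (t v : ℝ) :
    pairSeries (dirichletSq fun n => ZMod.stdAddChar (j * (n : ZMod q))) t ((1 : ℝ) + v * I) =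
      (expZeta (ZMod.toAddCircle j) (1 / 2 + t * I + ((1 : ℝ) + v * I)) *
        starRingEnd ℂ (expZeta (ZMod.toAddCircle j)
          (1 / 2 + t * I + starRingEnd ℂ ((1 : ℝ) + v * I)))) ^ 2 := by
  have h1 : 1 < (1 / 2 + t * I + ((1 : ℝ) + v * I)).re := by norm_num
  have h2 : 1 < (1 / 2 + t * I + starRingEnd ℂ ((1 : ℝ) + v * I)).re := by norm_num
  rw [pairSeries, LSeries_dirichletSq (ZMod.LSeriesSummable_of_one_lt_re
    (fun r => ZMod.stdAddChar (j * r)) h1), LSeries_dirichletSq (ZMod.LSeriesSummable_of_one_lt_re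
    (fun r => ZMod.stdAddChar (j * r)) h2), expZeta_toAddCircle j h1, expZeta_toAddCircle j h2,
    map_pow, mul_pow]

end

/-- The two exponential sums produced by the functional equation at `1 - s`. -/
noncomputable def dualSeries (a : UnitAddCircle) (s : ℂ) : ℂ :=
  cexp (-π * I * s / 2) * expZeta a s + cexp (π * I * s / 2) * expZeta (-a) s

lemma pairZeta_neg {a : UnitAddCircle} {t : ℝ} {u : ℂ} (hu : u.re = 1) :
    pairZeta a t (-u) = (2 * π : ℂ) ^ (-1 - 2 * u) *
      (Complex.Gamma (1 / 2 + u - t * I) * Complex.Gamma (1 / 2 + u + t * I)) *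
      (dualSeries a (1 / 2 - t * I + u) *
        starRingEnd ℂ (dualSeries a (1 / 2 - t * I + starRingEnd ℂ u))) := by
  have hne : ∀ {s : ℂ}, s.re = 3 / 2 → ∀ n : ℕ, s ≠ -n := by
    rintro s hs n rfl
    have : (0 : ℝ) ≤ n := n.cast_nonneg
    simp at hs
    linarith
  have hne1 : ∀ {s : ℂ}, s.re = 3 / 2 → s ≠ 1 := by
    rintro s hs rfl
    norm_num at hs
  have h1 : (1 / 2 - t * I + u).re = 3 / 2 := by simp [hu]; norm_num
  have h2 : (1 / 2 - t * I + starRingEnd ℂ u).re = 3 / 2 := by simp [hu]; norm_num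
  have hpi : (2 * π : ℂ) = ((2 * π : ℝ) : ℂ) := by push_cast; rfl
  have hpi0 : (2 * π : ℂ) ≠ 0 := by rw [hpi]; exact_mod_cast Real.two_pi_pos.ne'
  have harg : (2 * π : ℂ).arg ≠ π := by
    rw [hpi, Complex.arg_ofReal_of_nonneg Real.two_pi_pos.le]
    exact Real.pi_ne_zero.symm
  rw [pairZeta, map_neg, show 1 / 2 + t * I + -u = 1 - (1 / 2 - t * I + u) by ring,
    show 1 / 2 + t * I + -starRingEnd ℂ u = 1 - (1 / 2 - t * I + starRingEnd ℂ u) by ring,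
    hurwitzZeta_one_sub a (hne h1) (Or.inr (hne1 h1)),
    hurwitzZeta_one_sub a (hne h2) (Or.inr (hne1 h2)), ← dualSeries, ← dualSeries, map_mul,
    map_mul, ← Complex.Gamma_conj]
  have h3 : starRingEnd ℂ (1 / 2 - t * I + starRingEnd ℂ u) = 1 / 2 + u + t * I := by
    simp [map_ofNat]
    ring
  have h4 : starRingEnd ℂ ((2 * π : ℂ) ^ (-(1 / 2 - t * I + starRingEnd ℂ u))) =
      (2 * π : ℂ) ^ (-(1 / 2 + u + t * I)) := by
    rw [← h3, ← map_neg, Complex.cpow_conj _ _ harg, hpi, Complex.conj_ofReal]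
  rw [h3, h4, show -1 - 2 * u = -(1 / 2 - t * I + u) + -(1 / 2 + u + t * I) by ring,
    Complex.cpow_add _ _ hpi0, show 1 / 2 + u - t * I = 1 / 2 - t * I + u by ring]
  ring

lemma momentKernel_neg {a : UnitAddCircle} {t T : ℝ} (hT : 0 < T) {u : ℂ} (hu : u.re = 1) :
    momentKernel a (T ^ (2 : ℝ)) t (-u) =
      gaussKernel (1 * T ^ (2 - 2 * 2 : ℝ)) dualRatio t u *
        (cexp (-(π * t)) * (dualSeries a (1 / 2 - t * I + u) *
          starRingEnd ℂ (dualSeries a (1 / 2 - t * I + starRingEnd ℂ u)))) ^ 2 := by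
  have hne : ∀ z : ℂ, z.re = 1 → 1 / 2 + t * I + -z ≠ 1 := by
    intro z hz h
    have := congr_arg Complex.re h
    simp [hz] at this
    norm_num at this
  rw [momentKernel_eq (hne u hu) (by rw [map_neg]; exact hne _ (by simpa using hu)),
    pairZeta_neg hu, gaussKernel, gaussKernel, dualRatio, primalRatio]
  have hy : ((T ^ (2 : ℝ) : ℝ) : ℂ) ^ (-u) = ((1 * T ^ (2 - 2 * 2 : ℝ) : ℝ) : ℂ) ^ u := by
    rw [one_mul, Complex.cpow_neg, ← Complex.inv_cpow, ← Complex.ofReal_inv, ← Real.rpow_neg hT.le]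
    · norm_num
    · rw [Complex.arg_ofReal_of_nonneg (by positivity)]
      exact Real.pi_ne_zero.symm
  have hG : ∀ z : ℂ, 0 < z.re → Complex.Gamma (z + 1) = z * Complex.Gamma z := fun z hz =>
    Complex.Gamma_add_one z fun h => by simp [h] at hz
  have h1 : Complex.Gamma (3 / 2 + u + t * I) =
      (1 / 2 + u + t * I) * Complex.Gamma (1 / 2 + u + t * I) := by
    rw [← hG _ (by simp [hu]; norm_num)]
    ring_nf
  have h2 : Complex.Gamma (3 / 2 + u - t * I) =
      (1 / 2 + u - t * I) * Complex.Gamma (1 / 2 + u - t * I) := by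
    rw [← hG _ (by simp [hu]; norm_num)]
    ring_nf
  have h3 : (u + 1 / 2) ^ 2 + (t : ℂ) ^ 2 = (1 / 2 + u + t * I) * (1 / 2 + u - t * I) := by
    linear_combination (t : ℂ) ^ 2 * Complex.I_sq
  have h4 : (-u - 1 / 2) ^ 2 + (t : ℂ) ^ 2 = (1 / 2 + u + t * I) * (1 / 2 + u - t * I) := by
    rw [← h3]; ring
  have h5 : (-u + 1 / 2) ^ 2 + (t : ℂ) ^ 2 = (u - 1 / 2) ^ 2 + (t : ℂ) ^ 2 := by ring
  have h6 : (Real.exp (π * t) : ℂ) * cexp (-(π * t)) = 1 := by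
    rw [Complex.ofReal_exp, ← Complex.exp_add]
    simp
  rw [hy, h1, h2, h4, h5, neg_sq]
  generalize cexp (-(π * t)) = e at h6 ⊢
  generalize (Real.exp (π * t) : ℂ) = e' at h6 ⊢
  generalize dualSeries a (1 / 2 - t * I + u) * _ = S
  generalize (2 * π : ℂ) ^ (-1 - 2 * u) = P
  generalize Complex.Gamma (1 / 2 + u + t * I) = G1
  generalize Complex.Gamma (1 / 2 + u - t * I) = G2
  generalize ((1 * T ^ (2 - 2 * 2 : ℝ) : ℝ) : ℂ) ^ u * _ = Y
  generalize (1 / 4 + (t : ℂ) ^ 2) = Q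
  generalize (u - 1 / 2) ^ 2 + (t : ℂ) ^ 2 = R
  generalize (1 / 2 + u + t * I) = A
  generalize (1 / 2 + u - t * I) = B
  have h7 : e' ^ 2 * e ^ 2 = 1 := by rw [← mul_pow, h6, one_pow]
  linear_combination -(P * (G2 * G1) * S) ^ 2 * (A * B / Q * (R / Q)) ^ 2 * Y * h7

section

variable {q : ℕ} [NeZero q]

lemma norm_dualSeries_sq_sub_le (j : ZMod q) {t : ℝ} (ht : 0 ≤ t) (v : ℝ) {Z : ℝ}
    (hZ : ∀ s : ℂ, s.re = 3 / 2 → ‖expZeta (ZMod.toAddCircle j) s‖ ≤ Z) :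
    ‖(cexp (-(π * t)) * (dualSeries (ZMod.toAddCircle j) (1 / 2 - t * I + ((1 : ℝ) + v * I)) *
        starRingEnd ℂ (dualSeries (ZMod.toAddCircle j)
          (1 / 2 - t * I + starRingEnd ℂ ((1 : ℝ) + v * I))))) ^ 2 -
      pairSeries (dirichletSq fun n => ZMod.stdAddChar (j * (n : ZMod q))) t
        ((1 : ℝ) + v * I)‖ ≤
      15 * Z ^ 4 * Real.exp (-(π * t)) * Real.exp (2 * π * |v|) := by
  set x := ZMod.toAddCircle j
  set u : ℂ := (1 : ℝ) + v * I with hu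
  set s := 1 / 2 - t * I + u with hs
  set s' := 1 / 2 - t * I + starRingEnd ℂ u with hs'
  have hZ0 : 0 ≤ Z := (norm_nonneg _).trans (hZ (3 / 2 : ℝ) (Complex.ofReal_re _))
  have hsre : s.re = 3 / 2 := by simp [hs, hu]; norm_num
  have hsre' : s'.re = 3 / 2 := by simp [hs', hu]; norm_num
  have hc : starRingEnd ℂ s = 1 / 2 + t * I + starRingEnd ℂ u := by simp [hs, map_ofNat]
  have hc' : starRingEnd ℂ s' = 1 / 2 + t * I + u := by simp [hs', map_ofNat]
  have hneg : ∀ z : ℂ, z.re = 3 / 2 → ‖expZeta (-x) z‖ ≤ Z := by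
    intro z hz
    rw [expZeta_neg_toAddCircle j (by rw [hz]; norm_num), RCLike.norm_conj]
    exact hZ _ (by simpa using hz)
  have hE : ∀ z : ℂ, ‖cexp (π * I * z / 2)‖ = Real.exp (-(π * z.im / 2)) := by
    intro z
    rw [Complex.norm_exp, show π * I * z / 2 = (π / 2 : ℝ) * (I * z) by push_cast; ring,
      Complex.re_ofReal_mul, Complex.I_mul_re]
    ring_nf
  have hE' : ∀ z : ℂ, ‖cexp (-π * I * z / 2)‖ = Real.exp (π * z.im / 2) := by
    intro z
    rw [show -π * I * z / 2 = π * I * (-z) / 2 by ring, hE, Complex.neg_im]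
    ring_nf
  have him : s.im = v - t := by simp [hs, hu]; ring
  have him' : s'.im = -v - t := by simp [hs', hu]; ring
  set p := cexp (-(π * t)) with hp
  have hpn : ‖p‖ = Real.exp (-(π * t)) := by
    rw [hp, Complex.norm_exp]
    simp
  set X := p * (cexp (π * I * s / 2) * expZeta (-x) s *
    starRingEnd ℂ (cexp (π * I * s' / 2) * expZeta (-x) s')) with hX
  set Y := p * (cexp (π * I * s / 2) * expZeta (-x) s *
      starRingEnd ℂ (cexp (-π * I * s' / 2) * expZeta x s') +
    cexp (-π * I * s / 2) * expZeta x s *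
      starRingEnd ℂ (cexp (π * I * s' / 2) * expZeta (-x) s') +
    cexp (-π * I * s / 2) * expZeta x s *
      starRingEnd ℂ (cexp (-π * I * s' / 2) * expZeta x s')) with hY
  have hXY : p * (dualSeries x s * starRingEnd ℂ (dualSeries x s')) = X + Y := by
    rw [hX, hY, dualSeries, dualSeries, map_add]
    ring
  have hXeq : X = expZeta x (1 / 2 + t * I + u) *
      starRingEnd ℂ (expZeta x (1 / 2 + t * I + starRingEnd ℂ u)) := by
    have h1 : p * cexp (π * I * s / 2) * starRingEnd ℂ (cexp (π * I * s' / 2)) = 1 := by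
      rw [hp, ← Complex.exp_conj, ← Complex.exp_add, ← Complex.exp_add, ← Complex.exp_zero]
      congr 1
      rw [map_div₀, map_mul, map_mul, hc', Complex.conj_ofReal, Complex.conj_I, map_ofNat, hs]
      linear_combination -(π * t) * Complex.I_sq
    rw [hX, map_mul, expZeta_neg_toAddCircle j (s := s) (by rw [hsre]; norm_num),
      expZeta_neg_toAddCircle j (s := s') (by rw [hsre']; norm_num), hc, hc', Complex.conj_conj]
    linear_combination (expZeta x (1 / 2 + t * I + u) *
      starRingEnd ℂ (expZeta x (1 / 2 + t * I + starRingEnd ℂ u))) * h1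
  have hXn : ‖X‖ ≤ Z ^ 2 := by
    rw [hXeq, norm_mul, RCLike.norm_conj, sq]
    exact mul_le_mul (hZ _ (by rw [← hc']; simpa using hsre')) (hZ _ (by rw [← hc]; simpa using hsre))
      (norm_nonneg _) hZ0
  have hev : 1 ≤ Real.exp (π * |v|) := Real.one_le_exp (by positivity)
  have hYn : ‖Y‖ ≤ 3 * Z ^ 2 * Real.exp (-(π * t)) * Real.exp (π * |v|) := by
    have hprod : ∀ {A B F G : ℂ} {e f : ℝ}, ‖A‖ = Real.exp e → ‖B‖ = Real.exp f → ‖F‖ ≤ Z →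
        ‖G‖ ≤ Z → e + f ≤ π * |v| →
        ‖A * F * starRingEnd ℂ (B * G)‖ ≤ Z ^ 2 * Real.exp (π * |v|) := by
      intro A B F G e f hA hB hF hG hef
      rw [norm_mul, RCLike.norm_conj, norm_mul, norm_mul, hA, hB]
      calc Real.exp e * ‖F‖ * (Real.exp f * ‖G‖) ≤ Real.exp e * Z * (Real.exp f * Z) := by gcongr
        _ = Z ^ 2 * Real.exp (e + f) := by rw [Real.exp_add]; ring
        _ ≤ _ := by
          refine mul_le_mul_of_nonneg_left (Real.exp_le_exp.2 hef) (by positivity)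
    have hv1 : π * v ≤ π * |v| := mul_le_mul_of_nonneg_left (le_abs_self v) Real.pi_pos.le
    have hv2 : π * -v ≤ π * |v| := mul_le_mul_of_nonneg_left (neg_le_abs v) Real.pi_pos.le
    have hv3 : 0 ≤ π * t := by positivity
    have hv4 : 0 ≤ π * |v| := by positivity
    have h1 := hprod (hE s) (hE' s') (hneg s hsre) (hZ s' hsre') (by rw [him, him']; linarith)
    have h2 := hprod (hE' s) (hE s') (hZ s hsre) (hneg s' hsre') (by rw [him, him']; linarith)
    have h3 := hprod (hE' s) (hE' s') (hZ s hsre) (hZ s' hsre') (by rw [him, him']; linarith)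
    rw [hY, norm_mul, hpn]
    calc _ ≤ Real.exp (-(π * t)) * (Z ^ 2 * Real.exp (π * |v|) + Z ^ 2 * Real.exp (π * |v|) +
          Z ^ 2 * Real.exp (π * |v|)) := by
          refine mul_le_mul_of_nonneg_left ((norm_add_le _ _).trans (add_le_add
            ((norm_add_le _ _).trans (add_le_add h1 h2)) h3)) (Real.exp_pos _).le
      _ = _ := by ring
  have het : Real.exp (-(π * t)) ≤ 1 := Real.exp_le_one_iff.2 (by simpa using by positivity)
  rw [pairSeries_dirichletSq_stdAddChar, hXY, ← hXeq, show (X + Y) ^ 2 - X ^ 2 = Y * (2 * X + Y) by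
    ring, norm_mul]
  have h5 : ‖2 * X + Y‖ ≤ 5 * Z ^ 2 * Real.exp (π * |v|) := by
    refine (norm_add_le _ _).trans ?_
    rw [norm_mul, RCLike.norm_ofNat]
    have h6 : Real.exp (-(π * t)) * (Z ^ 2 * Real.exp (π * |v|)) ≤
        1 * (Z ^ 2 * Real.exp (π * |v|)) := by gcongr
    have h7 : Z ^ 2 * 1 ≤ Z ^ 2 * Real.exp (π * |v|) := by gcongr
    linarith
  calc ‖Y‖ * ‖2 * X + Y‖ ≤ 3 * Z ^ 2 * Real.exp (-(π * t)) * Real.exp (π * |v|) *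
        (5 * Z ^ 2 * Real.exp (π * |v|)) := by gcongr
    _ = _ := by
      rw [show 2 * π * |v| = π * |v| + π * |v| by ring, Real.exp_add]
      ring

lemma exists_norm_momentKernel_neg_sub_le (j : ZMod q) : ∃ M : ℝ, 0 ≤ M ∧ ∀ T : ℝ, 1 ≤ T →
    ∀ t ∈ Set.Icc T (2 * T), ∀ v : ℝ,
      ‖momentKernel (ZMod.toAddCircle j) (T ^ (2 : ℝ)) t (-((1 : ℝ) + v * I)) -
        pairSeries (dirichletSq fun n => ZMod.stdAddChar (j * (n : ZMod q))) t ((1 : ℝ) + v * I) *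
          gaussKernel (1 * T ^ (2 - 2 * 2 : ℝ)) dualRatio t ((1 : ℝ) + v * I)‖ ≤
      M * Real.exp (-(v ^ 2 / 2)) := by
  set Z := ∑' n : ℕ, 1 / (n : ℝ) ^ (3 / 2 : ℝ)
  refine ⟨2 * 15 * Z ^ 4 * 21000 ^ 2 * Real.exp 201, by positivity, fun T hT t ht v => ?_⟩
  have hT0 : 0 < T := by linarith
  have ht0 : 0 < t := hT0.trans_le ht.1
  rw [momentKernel_neg hT0 (by simp), mul_comm (pairSeries _ _ _), ← mul_sub, norm_mul]
  have h1 := norm_dualSeries_sq_sub_le j ht0.le v fun s => norm_expZeta_toAddCircle_le j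
  have h2 := (isSlow_dualRatio hT (Or.inr rfl) v).norm_le t ht
  have h3 := norm_cpow_mul_exp_sq_le (show 0 < 1 * T ^ (2 - 2 * 2 : ℝ) by positivity)
    (σ := 1) (by norm_num) v
  have h4 : T ^ 2 * Real.exp (-(π * t)) ≤ 2 := by
    have h5 : Real.exp (-(π * t)) ≤ (Real.exp T)⁻¹ := by
      rw [← Real.exp_neg]
      refine Real.exp_le_exp.2 ?_
      nlinarith [Real.pi_gt_three, ht.1]
    have h6 := Real.quadratic_le_exp_of_nonneg hT0.le
    calc T ^ 2 * Real.exp (-(π * t)) ≤ T ^ 2 * (Real.exp T)⁻¹ := by gcongr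
      _ ≤ 2 := by
        rw [← div_eq_mul_inv, div_le_iff₀ (Real.exp_pos _)]
        linarith
  have hpow : (T ^ (2 * 1 : ℝ)) ^ 2 * T ^ (2 - 2 * 2 : ℝ) = T ^ 2 := by
    rw [← Real.rpow_natCast, ← Real.rpow_mul hT0.le, ← Real.rpow_add hT0, ← Real.rpow_natCast]
    norm_num
  have h7 : ‖gaussKernel (1 * T ^ (2 - 2 * 2 : ℝ)) dualRatio t ((1 : ℝ) + v * I)‖ ≤
      21000 ^ 2 * T ^ 2 * Real.exp (12 * |v|) * Real.exp (1 - v ^ 2) := by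
    rw [gaussKernel, norm_mul, norm_pow]
    calc _ ≤ (21000 * T ^ (2 * 1 : ℝ) * Real.exp (6 * |v|)) ^ 2 *
          ((1 * T ^ (2 - 2 * 2 : ℝ)) ^ (1 : ℝ) * Real.exp (1 - v ^ 2)) :=
          mul_le_mul (pow_le_pow_left₀ (norm_nonneg _) h2 2) h3 (norm_nonneg _) (by positivity)
      _ = 21000 ^ 2 * ((T ^ (2 * 1 : ℝ)) ^ 2 * T ^ (2 - 2 * 2 : ℝ)) *
          Real.exp (6 * |v|) ^ 2 * Real.exp (1 - v ^ 2) := by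
          rw [Real.rpow_one]
          ring
      _ = _ := by
          rw [hpow, ← Real.exp_nat_mul]
          push_cast
          ring_nf
  calc _ ≤ 21000 ^ 2 * T ^ 2 * Real.exp (12 * |v|) * Real.exp (1 - v ^ 2) *
        (15 * Z ^ 4 * Real.exp (-(π * t)) * Real.exp (2 * π * |v|)) := by gcongr
    _ = T ^ 2 * Real.exp (-(π * t)) * (15 * Z ^ 4 * 21000 ^ 2 *
        Real.exp (12 * |v| + (1 - v ^ 2) + 2 * π * |v|)) := by
      rw [Real.exp_add, Real.exp_add]
      ring
    _ ≤ 2 * (15 * Z ^ 4 * 21000 ^ 2 * Real.exp (201 + -(v ^ 2 / 2))) := by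
      refine mul_le_mul h4 (mul_le_mul_of_nonneg_left (Real.exp_le_exp.2 ?_) (by positivity))
        (by positivity) zero_le_two
      have h8 : 2 * π * |v| ≤ 8 * |v| := by
        have := Real.pi_le_four
        gcongr
        linarith
      nlinarith [sq_nonneg (|v| - 20), sq_abs v]
    _ = _ := by
      rw [Real.exp_add]
      ring

lemma exists_norm_integral_momentKernel_neg_sub_le (j : ZMod q) : ∃ M : ℝ, 0 ≤ M ∧
    ∀ T : ℝ, 1 ≤ T → ∀ t ∈ Set.Icc T (2 * T),
    IsStripKernel (gaussKernel (1 * T ^ (2 - 2 * 2 : ℝ)) dualRatio t) →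
    ‖1 / (2 * π) * (∫ v : ℝ, momentKernel (ZMod.toAddCircle j) (T ^ (2 : ℝ)) t
        (-((1 : ℝ) + v * I)) / ((1 : ℝ) + v * I)) -
      ∑' z, mvTerm (dirichletSq fun n => ZMod.stdAddChar (j * (n : ZMod q)))
        (fun t x => mellinWeight (gaussKernel (1 * T ^ (2 - 2 * 2 : ℝ)) dualRatio t) x) t z‖ ≤
      M := by
  obtain ⟨M, hM, h⟩ := exists_norm_momentKernel_neg_sub_le j
  refine ⟨M / 2, by positivity, fun T hT t ht hk => ?_⟩
  have hb : ∀ n, ‖dirichletSq (fun n => ZMod.stdAddChar (j * (n : ZMod q))) n‖ ≤ #n.divisors :=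
    norm_dirichletSq_le fun n => (AddChar.norm_apply _ _).le
  have hi := integrable_pairSeries_mul (t := t) hb hk
  have hy : (1 : ℝ) ≤ T ^ (2 : ℝ) := Real.one_le_rpow hT (by norm_num)
  obtain ⟨C, hC⟩ := exists_norm_momentKernel_le (ZMod.toAddCircle j) hy t
  have hJ := (integrable_vertical_div (x := -1) (c := -2) (differentiable_momentKernel
    (a := ZMod.toAddCircle j) (t := t) (show 0 < T ^ (2 : ℝ) by linarith)).differentiableOn
    (by norm_num) (by norm_num) (hC (-1) (by norm_num))).comp_neg.neg
  have hJ' : Integrable fun v : ℝ => momentKernel (ZMod.toAddCircle j) (T ^ (2 : ℝ)) t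
      (-((1 : ℝ) + v * I)) / ((1 : ℝ) + v * I) := by
    refine hJ.congr (Eventually.of_forall fun v => ?_)
    simp only [Pi.neg_apply]
    rw [show ((-1 : ℝ) : ℂ) + ((-v : ℝ) : ℂ) * I = -((1 : ℝ) + v * I) by push_cast; ring, div_neg,
      neg_neg]
  rw [tsum_mvTerm_mellinWeight hb hk, ← mul_sub, ← integral_sub hJ' hi]
  refine norm_integral_gaussian_le fun v => ?_
  rw [← mul_div_assoc, ← sub_div, norm_div]
  have h1 : 1 ≤ ‖((1 : ℝ) : ℂ) + v * I‖ := by simpa using abs_re_le_norm_add_mul_I 1 v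
  exact (div_le_self (norm_nonneg _) h1).trans (h T hT t ht v)

end

lemma exists_norm_integral_tsum_mvTerm_sub_log_le {q : ℕ} [NeZero q] {f : ZMod q → ℂ}
    (hf : ∀ r, ‖f r‖ ≤ 1) {A : ℝ} (hA : 0 ≤ A) : ∃ C : ℝ, 0 ≤ C ∧ ∀ T : ℝ, 1 ≤ T → ∀ V,
      IsMVWeight A T V →
      ‖(∫ t in T..(2 * T), ∑' z, mvTerm (dirichletSq fun n => f n) V t z) -
        (∑' e : ℕ, (ArithmeticFunction.moebius e : ℂ) / (e : ℂ) ^ 2 * quadMean f e) * T *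
          (Real.log T : ℂ) ^ 4‖ ≤ C * T * (1 + Real.log T) ^ 3 := by
  obtain ⟨C, hC, h⟩ := exists_norm_integral_tsum_mvTerm_sub_le hA
  obtain ⟨D, hD, h'⟩ := exists_norm_sum_dirichletSq_sub_le hf
  refine ⟨C + D, by positivity, fun T hT V hV => ?_⟩
  have h1 := h T hT V _ hV (norm_dirichletSq_le fun n => hf (n : ZMod q))
  have h2 := mul_le_mul_of_nonneg_left (h' T hT) (show 0 ≤ T by linarith)
  rw [← Complex.norm_of_nonneg (show 0 ≤ T by linarith), ← norm_mul, mul_sub] at h2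
  rw [Complex.norm_of_nonneg (show 0 ≤ T by linarith)] at h2
  refine (norm_sub_le_norm_sub_add_norm_sub _ _ _).trans ((add_le_add h1 ((le_of_eq ?_).trans h2)).trans_eq ?_)
  · congr 2
    ring
  · ring

section

variable {q : ℕ} [NeZero q]

lemma norm_hurwitzZeta_pow_four_continuousOn (x : UnitAddCircle) {T : ℝ} (hT : 0 < T) :
    ContinuousOn (fun t : ℝ => ‖hurwitzZeta x (1 / 2 + t * I)‖ ^ 4) (Set.Icc T (2 * T)) := by
  intro t ht
  have ht0 : 0 < t := hT.trans_le ht.1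
  have h1 : 1 / 2 + t * I ≠ 1 := fun h => by simpa [ht0.ne'] using congr_arg Complex.im h
  have h2 : ContinuousAt (fun t : ℝ => hurwitzZeta x (1 / 2 + t * I)) t :=
    ContinuousAt.comp (f := fun t : ℝ => (1 / 2 + t * I : ℂ))
      (differentiableAt_hurwitzZeta x h1).continuousAt (by fun_prop)
  exact (h2.norm.pow 4).continuousWithinAt

lemma norm_integral_sub_le_of_norm_sub_le {Z P Q : ℝ → ℂ} {c k l : ℂ} {M D E T : ℝ} (hT : 0 ≤ T)
    (hZ : ContinuousOn Z (Set.Icc T (2 * T))) (hP : ContinuousOn P (Set.Icc T (2 * T)))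
    (hQ : ContinuousOn Q (Set.Icc T (2 * T)))
    (h : ∀ t ∈ Set.Icc T (2 * T), ‖Z t - (c * P t + Q t)‖ ≤ M)
    (hk : ‖(∫ t in T..(2 * T), P t) - k‖ ≤ D) (hl : ‖(∫ t in T..(2 * T), Q t) - l‖ ≤ E) :
    ‖(∫ t in T..(2 * T), Z t) - (c * k + l)‖ ≤ M * T + ‖c‖ * D + E := by
  have hle : T ≤ 2 * T := by linarith
  rw [← Set.uIcc_of_le hle] at hZ hP hQ
  have h1 := intervalIntegral.norm_integral_le_of_norm_le_const (a := T) (b := 2 * T) (C := M)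
    fun t ht => h t (Set.Ioc_subset_Icc_self (Set.uIoc_of_le hle ▸ ht))
  rw [intervalIntegral.integral_sub hZ.intervalIntegrable
      ((hP.intervalIntegrable.const_mul c).add hQ.intervalIntegrable),
    intervalIntegral.integral_add (hP.intervalIntegrable.const_mul c) hQ.intervalIntegrable,
    intervalIntegral.integral_const_mul, two_mul, add_sub_cancel_right, abs_of_nonneg hT,
    ← two_mul] at h1
  have h2 := mul_le_mul_of_nonneg_left hk (norm_nonneg c)
  rw [← norm_mul, mul_sub] at h2
  refine (le_of_eq ?_).trans (norm_add₃_le.trans (add_le_add_three h1 h2 hl))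
  congr 1
  ring

lemma norm_hurwitzZeta_pow_four_sub_le (a : ℕ) {T t M : ℝ} {S : ℂ} (hT : 1 ≤ T)
    (ht : 0 < t) (hk : IsStripKernel (gaussKernel ((q : ℝ) ^ 4 * T ^ (2 : ℝ)) primalRatio t))
    (hS : ‖1 / (2 * π) * (∫ v : ℝ, momentKernel (ZMod.toAddCircle (a : ZMod q)) (T ^ (2 : ℝ)) t
        (-((1 : ℝ) + v * I)) / ((1 : ℝ) + v * I)) - S‖ ≤ M) :
    ‖((‖hurwitzZeta (((a : ℝ) / (q : ℝ) : ℝ) : UnitAddCircle) (1 / 2 + t * I)‖ ^ 4 : ℝ) : ℂ) -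
      ((q : ℂ) ^ 2 * (∑' z, mvTerm (dirichletSq fun n => if (n : ZMod q) = a then 1 else 0)
        (fun t x => mellinWeight (gaussKernel ((q : ℝ) ^ 4 * T ^ (2 : ℝ)) primalRatio t) x) t z) +
      S)‖ ≤ M := by
  rw [ZMod.toAddCircle_natCast] at hS
  rw [norm_hurwitzZeta_pow_four_eq (Real.one_le_rpow hT zero_le_two) ht,
    integral_momentKernel_one_add a (by linarith) hk, add_sub_add_left_eq_sub]
  exact hS

lemma exists_norm_integral_norm_hurwitzZeta_pow_four_sub_le (a : ℕ) (ha : IsUnit (a : ZMod q)) :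
    ∃ C : ℝ, 0 ≤ C ∧ ∀ T : ℝ, 1 ≤ T →
      ‖((∫ t in T..(2 * T), ‖hurwitzZeta (((a : ℝ) / (q : ℝ) : ℝ) : UnitAddCircle)
        (1 / 2 + t * I)‖ ^ 4 : ℝ) : ℂ) - 1 / (2 * (π : ℂ) ^ 2 * q) *
          (∏ p ∈ q.primeFactors, (1 - 1 / ((p : ℂ) + 1))) * T * (Real.log T : ℂ) ^ 4‖ ≤
        C * T * (1 + Real.log T) ^ 3 := by
  obtain ⟨A, hA, hK⟩ := exists_isMVKernel_primal (c := (q : ℝ) ^ 4)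
    (by have := NeZero.pos q; positivity)
  obtain ⟨B, hB, hL⟩ := exists_isMVKernel_dual
  obtain ⟨M, hM, hdual⟩ := exists_norm_integral_momentKernel_neg_sub_le (a : ZMod q)
  have hf1 : ∀ r : ZMod q, ‖(if r = a then 1 else 0 : ℂ)‖ ≤ 1 := fun r => by
    split_ifs <;> simp
  have hf2 : ∀ r : ZMod q, ‖(ZMod.stdAddChar ((a : ZMod q) * r) : ℂ)‖ ≤ 1 := fun r =>
    (AddChar.norm_apply _ _).le
  obtain ⟨C, hC, h1⟩ := exists_norm_integral_tsum_mvTerm_sub_log_le hf1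
    (show 0 ≤ 1 + 2 * A by positivity)
  obtain ⟨D, hD, h2⟩ := exists_norm_integral_tsum_mvTerm_sub_log_le hf2
    (show 0 ≤ 1 + 2 * B by positivity)
  refine ⟨M + (q : ℝ) ^ 2 * C + D, by positivity, fun T hT => ?_⟩
  have hT0 : 0 < T := by linarith
  have hV := (hK T hT).isMVWeight hT hA
  have hW := (hL T hT).isMVWeight hT hB
  have h3 := norm_integral_sub_le_of_norm_sub_le hT0.le
    (Complex.continuous_ofReal.comp_continuousOn (norm_hurwitzZeta_pow_four_continuousOn
      (((a : ℝ) / (q : ℝ) : ℝ) : UnitAddCircle) hT0))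
    (hV.continuousOn_tsum (by positivity) hT0 (norm_dirichletSq_le fun n => hf1 (n : ZMod q)))
    (hW.continuousOn_tsum (by positivity) hT0 (norm_dirichletSq_le fun n => hf2 (n : ZMod q)))
    (fun t ht => norm_hurwitzZeta_pow_four_sub_le a hT (hT0.trans_le ht.1)
      ((hK T hT).strip t ht) (hdual T hT t ht ((hL T hT).strip t ht)))
    (h1 T hT _ hV) (h2 T hT _ hW)
  simp only [Function.comp_def] at h3
  rw [intervalIntegral.integral_ofReal, ← mul_assoc, ← mul_assoc,
    tsum_moebius_mul_quadMean_indicator q ha, tsum_moebius_mul_quadMean_stdAddChar q ha, norm_pow,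
    Complex.norm_natCast] at h3
  have hlog : 0 ≤ Real.log T := Real.log_nonneg hT
  have h4 : M * T ≤ M * T * (1 + Real.log T) ^ 3 :=
    le_mul_of_one_le_right (by positivity) (one_le_pow₀ (by linarith))
  refine (le_of_eq ?_).trans (h3.trans ?_)
  · have hπ : (π : ℂ) ≠ 0 := by exact_mod_cast Real.pi_ne_zero
    have hq : (q : ℂ) ≠ 0 := by exact_mod_cast NeZero.ne q
    congr 2
    field_simp
    ring
  · linarith

end

/-- Fourth moment of the Hurwitz zeta function with rational shift `α = a/q`:
`∫_T^{2T} |ζ(1/2+it, α)|⁴ dt = c₂(α)·T (log T)⁴ + O_q(T (log T)³)` where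
`c₂(α) = (1/(2π²q)) ∏_{p ∣ q} (1 − 1/(p+1))`. -/
theorem fourth_moment_hurwitz (a q : ℕ) [NeZero q] (ha : 1 ≤ a) (haq : a ≤ q)
    (hgcd : Nat.gcd a q = 1) :
    ∃ C T₀ : ℝ, ∀ T : ℝ, T₀ ≤ T →
      |(∫ t in T..(2*T),
          ‖hurwitzZeta (((a : ℝ) / (q : ℝ) : ℝ) : UnitAddCircle) (1/2 + t * Complex.I)‖ ^ 4)
        - (1 / (2 * π ^ 2 * (q : ℝ))) * (∏ p ∈ q.primeFactors, (1 - 1 / ((p : ℝ) + 1)))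
            * T * Real.log T ^ 4|
      ≤ C * T * Real.log T ^ 3 := by
  obtain ⟨C, hC, h⟩ := exists_norm_integral_norm_hurwitzZeta_pow_four_sub_le (q := q) a
    ((ZMod.isUnit_iff_coprime a q).2 hgcd)
  refine ⟨8 * C, Real.exp 1, fun T hT => ?_⟩
  have hT1 : 1 ≤ T := (Real.one_le_exp zero_le_one).trans hT
  have hlog : 1 ≤ Real.log T := (Real.le_log_iff_exp_le (by linarith)).2 hT
  have h1 := h T hT1
  have h2 : (1 + Real.log T) ^ 3 ≤ (2 * Real.log T) ^ 3 :=
    pow_le_pow_left₀ (by linarith) (by linarith) 3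
  rw [← Real.norm_eq_abs, ← Complex.norm_real]
  refine (le_of_eq ?_).trans (h1.trans ((mul_le_mul_of_nonneg_left h2 (by positivity)).trans_eq ?_))
  · push_cast
    rfl
  · ring
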